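/- arXiv:2312.03220 — 3 statements merged into one kernel-verified Lean document; each statement's English description precedes it below -/
import Mathlib

section
/- For every finite-dimensional unitary representation ρ of SL₄(ℤ) on a nonzero complex inner product space, ‖ρ(ι(S)) + ρ(ι(S))⁻¹ + ρ(ι(T)) + ρ(ι(T))⁻¹‖ = 4, where the norm is the operator norm. -/
open Matrix

/-- The embedding of SL₂ into SL₄ as the top-left block. -/
def iota {R : Type*} [CommRing R] (A : Matrix.SpecialLinearGroup (Fin 2) R) :
    Matrix.SpecialLinearGroup (Fin 4) R :=
  ⟨Matrix.reindex (finSumFinEquiv : Fin 2 ⊕ Fin 2 ≃ Fin 4)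
      (finSumFinEquiv : Fin 2 ⊕ Fin 2 ≃ Fin 4) (Matrix.fromBlocks A.1 0 0 1),
   by simp [Matrix.det_fromBlocks_zero₂₁, A.2]⟩

/-- The standard generator `S = [[0,-1],[1,0]]` of SL₂(ℤ). -/
def S : Matrix.SpecialLinearGroup (Fin 2) ℤ :=
  ⟨!![0, -1; 1, 0], by norm_num [Matrix.det_fin_two_of]⟩

/-- The standard generator `T = [[1,1],[0,1]]` of SL₂(ℤ). -/
def T : Matrix.SpecialLinearGroup (Fin 2) ℤ :=
  ⟨!![1, 1; 0, 1], by norm_num [Matrix.det_fin_two_of]⟩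


set_option linter.unusedSimpArgs false
set_option linter.style.longLine false

namespace SLProof

/-- Shorthand for `SL₄(ℤ)`. -/
abbrev SL4 := Matrix.SpecialLinearGroup (Fin 4) ℤ

/-- Shorthand for `SL₂(ℤ)`. -/
abbrev SL2 := Matrix.SpecialLinearGroup (Fin 2) ℤ

/-- Elementary matrices (equal to `1` if `i = j`). -/
def elm (i j : Fin 4) (t : ℤ) : SL4 :=
  if h : i ≠ j then SpecialLinearGroup.transvection h t else 1

/-- The elementary subgroup. -/
def EG : Subgroup SL4 := Subgroup.closure {g | ∃ i j t, g = elm i j t}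

/-- The matrix of an element of `SL₄(ℤ)`. -/
def mt (A : SL4) : Matrix (Fin 4) (Fin 4) ℤ := A.1

lemma mt_ext {A B : SL4} (h : mt A = mt B) : A = B := Subtype.ext h

lemma mt_mul (A B : SL4) : mt (A * B) = mt A * mt B := rfl

lemma mt_one : mt 1 = 1 := rfl

/-- Elementary matrices as elements of the elementary subgroup. -/
def el (i j : Fin 4) (t : ℤ) : EG := ⟨elm i j t, Subgroup.subset_closure ⟨i, j, t, rfl⟩⟩

lemma elm_mt {i j : Fin 4} (h : i ≠ j) (t : ℤ) : mt (elm i j t) = 1 + single i j t := by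
  simp [mt, elm, h, SpecialLinearGroup.transvection_coe]

/-- The matrix of an element of `EG`. -/
def em (A : EG) : Matrix (Fin 4) (Fin 4) ℤ := mt A.1

lemma em_ext {A B : EG} (h : em A = em B) : A = B := Subtype.ext (mt_ext h)

lemma em_mul (A B : EG) : em (A * B) = em A * em B := rfl

lemma em_one : em 1 = 1 := rfl

lemma em_el {i j : Fin 4} (h : i ≠ j) (t : ℤ) : em (el i j t) = 1 + single i j t := elm_mt h t

lemma el_self (i : Fin 4) (t : ℤ) : el i i t = 1 := by
  apply Subtype.ext; simp [el, elm]

lemma el_add (i j : Fin 4) (s t : ℤ) : el i j (s + t) = el i j s * el i j t := by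
  apply Subtype.ext
  by_cases h : i ≠ j
  · simp [el, elm, h, SpecialLinearGroup.transvection_add]
  · simp [el, elm, h]

lemma el_zero (i j : Fin 4) : el i j 0 = 1 := by
  have := el_add i j 0 0
  simpa using this

lemma el_neg (i j : Fin 4) (t : ℤ) : el i j (-t) = (el i j t)⁻¹ := by
  rw [eq_inv_iff_mul_eq_one, ← el_add]; simp [el_zero]

lemma el_pow (i j : Fin 4) (t : ℤ) (n : ℕ) : el i j t ^ n = el i j (n * t) := by
  induction n with
  | zero => simp [el_zero]
  | succ n ih => rw [pow_succ, ih, ← el_add]; congr 1; push_cast; ring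

lemma el_rel {i j k : Fin 4} (hij : i ≠ j) (hjk : j ≠ k) (hik : i ≠ k) (s t : ℤ) :
    el i j s * el j k t = el i k (s * t) * el j k t * el i j s := by
  apply em_ext
  simp only [em_mul, em_el hij, em_el hjk, em_el hik]
  simp [mul_add, add_mul, single_mul_single_of_ne, hij, hjk, hik, hij.symm, hjk.symm, hik.symm]
  abel

lemma el_comm {i j k l : Fin 4} (hjk : j ≠ k) (hil : i ≠ l) (s t : ℤ) :
    el i j s * el k l t = el k l t * el i j s := by
  by_cases hij : i = j
  · subst hij; simp [el_self]
  by_cases hkl : k = l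
  · subst hkl; simp [el_self]
  apply em_ext
  simp only [em_mul, em_el hij, em_el hkl]
  simp [mul_add, add_mul, single_mul_single_of_ne, hjk, hil.symm]
  abel

lemma EG_induction {p : EG → Prop} (h1 : p 1) (hel : ∀ i j t, p (el i j t))
    (hmul : ∀ a b, p a → p b → p (a * b)) (hinv : ∀ a, p a → p a⁻¹) (g : EG) : p g := by
  obtain ⟨g, hg⟩ := g
  induction hg using Subgroup.closure_induction with
  | mem x hx => obtain ⟨i, j, t, rfl⟩ := hx; exact hel i j t
  | one => exact h1
  | mul x y hx hy h h' => exact hmul ⟨x, hx⟩ ⟨y, hy⟩ h h'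
  | inv x hx h => exact hinv ⟨x, hx⟩ h

/-- Entries of an `SL₂` matrix. -/
def m2 (A : SL2) (i j : Fin 2) : ℤ := A.1 i j

lemma m2_ext {A B : SL2} (h00 : m2 A 0 0 = m2 B 0 0) (h01 : m2 A 0 1 = m2 B 0 1)
    (h10 : m2 A 1 0 = m2 B 1 0) (h11 : m2 A 1 1 = m2 B 1 1) : A = B := by
  apply Subtype.ext
  ext i j
  fin_cases i <;> fin_cases j <;> assumption

lemma m2_mul (A B : SL2) (i j : Fin 2) :
    m2 (A * B) i j = m2 A i 0 * m2 B 0 j + m2 A i 1 * m2 B 1 j := by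
  have : m2 (A * B) i j = (A.1 * B.1) i j := rfl
  rw [this, Matrix.mul_apply, Fin.sum_univ_two]; rfl

lemma m2_det (A : SL2) : m2 A 0 0 * m2 A 1 1 - m2 A 0 1 * m2 A 1 0 = 1 := by
  have := A.2
  rwa [Matrix.det_fin_two] at this

/-- Constructor for `SL₂` matrices. -/
def mk2 (a b c d : ℤ) (h : a * d - b * c = 1) : SL2 :=
  ⟨!![a, b; c, d], by rw [Matrix.det_fin_two_of]; exact h⟩

section
variable (a b c d : ℤ) (h : a * d - b * c = 1)
@[simp] lemma mk2_00 : m2 (mk2 a b c d h) 0 0 = a := rfl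
@[simp] lemma mk2_01 : m2 (mk2 a b c d h) 0 1 = b := rfl
@[simp] lemma mk2_10 : m2 (mk2 a b c d h) 1 0 = c := rfl
@[simp] lemma mk2_11 : m2 (mk2 a b c d h) 1 1 = d := rfl
end

@[simp] lemma m2_one_00 : m2 1 0 0 = 1 := rfl
@[simp] lemma m2_one_01 : m2 1 0 1 = 0 := rfl
@[simp] lemma m2_one_10 : m2 1 1 0 = 0 := rfl
@[simp] lemma m2_one_11 : m2 1 1 1 = 1 := rfl

lemma m2_inv_00 (A : SL2) : m2 A⁻¹ 0 0 = m2 A 1 1 := by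
  have : m2 A⁻¹ 0 0 = (adjugate A.1) 0 0 := rfl
  rw [this, adjugate_fin_two]; rfl
lemma m2_inv_01 (A : SL2) : m2 A⁻¹ 0 1 = - m2 A 0 1 := by
  have : m2 A⁻¹ 0 1 = (adjugate A.1) 0 1 := rfl
  rw [this, adjugate_fin_two]; rfl
lemma m2_inv_10 (A : SL2) : m2 A⁻¹ 1 0 = - m2 A 1 0 := by
  have : m2 A⁻¹ 1 0 = (adjugate A.1) 1 0 := rfl
  rw [this, adjugate_fin_two]; rfl
lemma m2_inv_11 (A : SL2) : m2 A⁻¹ 1 1 = m2 A 0 0 := by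
  have : m2 A⁻¹ 1 1 = (adjugate A.1) 1 1 := rfl
  rw [this, adjugate_fin_two]; rfl

lemma iota_mt (A : SL2) : mt (iota A) =
    !![m2 A 0 0, m2 A 0 1, 0, 0; m2 A 1 0, m2 A 1 1, 0, 0; 0, 0, 1, 0; 0, 0, 0, 1] := by
  ext a b
  fin_cases a <;> fin_cases b <;> rfl

/-- The top-left embedding as a homomorphism. -/
def iotaHom : SL2 →* SL4 :=
  MonoidHom.mk' (fun A => iota A) (by
    intro A B
    apply mt_ext
    rw [mt_mul, iota_mt, iota_mt, iota_mt]
    simp only [m2_mul]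
    ext a b; fin_cases a <;> fin_cases b <;> simp [Matrix.mul_apply, Fin.sum_univ_four])

lemma em_entry {i j : Fin 4} (h : i ≠ j) (t : ℤ) (a b : Fin 4) :
    em (el i j t) a b =
      (if a = b then 1 else 0) + (if i = a ∧ j = b then t else 0) := by
  rw [em_el h, Matrix.add_apply, Matrix.one_apply, Matrix.single_apply]

lemma em01 (t : ℤ) : em (el 0 1 t) =
    !![1, t, 0, 0; 0, 1, 0, 0; 0, 0, 1, 0; 0, 0, 0, 1] := by
  ext a b; rw [em_entry (by decide)]; fin_cases a <;> fin_cases b <;> simp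
lemma em02 (t : ℤ) : em (el 0 2 t) =
    !![1, 0, t, 0; 0, 1, 0, 0; 0, 0, 1, 0; 0, 0, 0, 1] := by
  ext a b; rw [em_entry (by decide)]; fin_cases a <;> fin_cases b <;> simp
lemma em10 (t : ℤ) : em (el 1 0 t) =
    !![1, 0, 0, 0; t, 1, 0, 0; 0, 0, 1, 0; 0, 0, 0, 1] := by
  ext a b; rw [em_entry (by decide)]; fin_cases a <;> fin_cases b <;> simp
lemma em12 (t : ℤ) : em (el 1 2 t) =
    !![1, 0, 0, 0; 0, 1, t, 0; 0, 0, 1, 0; 0, 0, 0, 1] := by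
  ext a b; rw [em_entry (by decide)]; fin_cases a <;> fin_cases b <;> simp
lemma em20 (t : ℤ) : em (el 2 0 t) =
    !![1, 0, 0, 0; 0, 1, 0, 0; t, 0, 1, 0; 0, 0, 0, 1] := by
  ext a b; rw [em_entry (by decide)]; fin_cases a <;> fin_cases b <;> simp
lemma em21 (t : ℤ) : em (el 2 1 t) =
    !![1, 0, 0, 0; 0, 1, 0, 0; 0, t, 1, 0; 0, 0, 0, 1] := by
  ext a b; rw [em_entry (by decide)]; fin_cases a <;> fin_cases b <;> simp
lemma em03 (t : ℤ) : em (el 0 3 t) =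
    !![1, 0, 0, t; 0, 1, 0, 0; 0, 0, 1, 0; 0, 0, 0, 1] := by
  ext a b; rw [em_entry (by decide)]; fin_cases a <;> fin_cases b <;> simp
lemma em13 (t : ℤ) : em (el 1 3 t) =
    !![1, 0, 0, 0; 0, 1, 0, t; 0, 0, 1, 0; 0, 0, 0, 1] := by
  ext a b; rw [em_entry (by decide)]; fin_cases a <;> fin_cases b <;> simp
lemma em30 (t : ℤ) : em (el 3 0 t) =
    !![1, 0, 0, 0; 0, 1, 0, 0; 0, 0, 1, 0; t, 0, 0, 1] := by
  ext a b; rw [em_entry (by decide)]; fin_cases a <;> fin_cases b <;> simp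
lemma em31 (t : ℤ) : em (el 3 1 t) =
    !![1, 0, 0, 0; 0, 1, 0, 0; 0, 0, 1, 0; 0, t, 0, 1] := by
  ext a b; rw [em_entry (by decide)]; fin_cases a <;> fin_cases b <;> simp

lemma iota_T : iota T = elm 0 1 1 := by
  apply mt_ext
  have : mt (elm 0 1 1) = em (el 0 1 1) := rfl
  rw [iota_mt, this, em01]; rfl

lemma iota_S : iota S = elm 0 1 (-1) * elm 1 0 1 * elm 0 1 (-1) := by
  apply mt_ext
  have : mt (elm 0 1 (-1) * elm 1 0 1 * elm 0 1 (-1)) = em (el 0 1 (-1) * el 1 0 1 * el 0 1 (-1)) := rfl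
  rw [iota_mt, this, em_mul, em_mul, em01, em10]
  have h0 : m2 S 0 0 = 0 := rfl
  have h1 : m2 S 0 1 = -1 := rfl
  have h2 : m2 S 1 0 = 1 := rfl
  have h3 : m2 S 1 1 = 0 := rfl
  rw [h0, h1, h2, h3]
  decide

lemma SL2_induction {p : SL2 → Prop} (hS : p S) (hT : p T) (h1 : p 1)
    (hmul : ∀ a b, p a → p b → p (a * b)) (hinv : ∀ a, p a → p a⁻¹) (g : SL2) : p g := by
  have hg : g ∈ Subgroup.closure {ModularGroup.S, ModularGroup.T} := by
    rw [SpecialLinearGroup.SL2Z_generators]; trivial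
  induction hg using Subgroup.closure_induction with
  | mem x hx =>
    rcases hx with rfl | rfl
    · exact hS
    · exact hT
  | one => exact h1
  | mul x y hx hy h h' => exact hmul _ _ h h'
  | inv x hx h => exact hinv _ h

lemma iota_mem (A : SL2) : iotaHom A ∈ EG := by
  induction A using SL2_induction with
  | hS =>
    change iota S ∈ EG
    rw [iota_S]
    exact EG.mul_mem (EG.mul_mem (el 0 1 (-1)).2 (el 1 0 1).2) (el 0 1 (-1)).2
  | hT =>
    change iota T ∈ EG
    rw [iota_T]; exact (el 0 1 1).2
  | h1 => rw [map_one]; exact EG.one_mem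
  | hmul a b ha hb => rw [map_mul]; exact EG.mul_mem ha hb
  | hinv a ha => rw [map_inv]; exact EG.inv_mem ha

/-- The top-left embedding into the elementary subgroup. -/
def io : SL2 →* EG := iotaHom.codRestrict EG iota_mem

lemma em_io (A : SL2) : em (io A) =
    !![m2 A 0 0, m2 A 0 1, 0, 0; m2 A 1 0, m2 A 1 1, 0, 0; 0, 0, 1, 0; 0, 0, 0, 1] := iota_mt A

/-- Conjugating column transvections by the embedded `SL₂`. -/
lemma io_col2 (A : SL2) (s t : ℤ) : io A * (el 0 2 s * el 1 2 t) =
    el 0 2 (m2 A 0 0 * s + m2 A 0 1 * t) * el 1 2 (m2 A 1 0 * s + m2 A 1 1 * t) * io A := by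
  apply em_ext
  simp only [em_mul, em_io, em02, em12]
  ext a b; fin_cases a <;> fin_cases b <;> simp [Matrix.mul_apply, Fin.sum_univ_four]

lemma io_row2 (A : SL2) (s t : ℤ) : (el 2 0 s * el 2 1 t) * io A =
    io A * (el 2 0 (s * m2 A 0 0 + t * m2 A 1 0) * el 2 1 (s * m2 A 0 1 + t * m2 A 1 1)) := by
  apply em_ext
  simp only [em_mul, em_io, em20, em21]
  ext a b; fin_cases a <;> fin_cases b <;> simp [Matrix.mul_apply, Fin.sum_univ_four]

lemma io_col3 (A : SL2) (s t : ℤ) : io A * (el 0 3 s * el 1 3 t) =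
    el 0 3 (m2 A 0 0 * s + m2 A 0 1 * t) * el 1 3 (m2 A 1 0 * s + m2 A 1 1 * t) * io A := by
  apply em_ext
  simp only [em_mul, em_io, em03, em13]
  ext a b; fin_cases a <;> fin_cases b <;> simp [Matrix.mul_apply, Fin.sum_univ_four]

lemma io_row3 (A : SL2) (s t : ℤ) : (el 3 0 s * el 3 1 t) * io A =
    io A * (el 3 0 (s * m2 A 0 0 + t * m2 A 1 0) * el 3 1 (s * m2 A 0 1 + t * m2 A 1 1)) := by
  apply em_ext
  simp only [em_mul, em_io, em30, em31]
  ext a b; fin_cases a <;> fin_cases b <;> simp [Matrix.mul_apply, Fin.sum_univ_four]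


/-- The principal congruence condition on `SL₂(ℤ)`. -/
def IsG (N : ℤ) (A : SL2) : Prop :=
  N ∣ m2 A 0 0 - 1 ∧ N ∣ m2 A 0 1 ∧ N ∣ m2 A 1 0 ∧ N ∣ m2 A 1 1 - 1

/-- `[[1,t],[0,1]]`. -/
def up (t : ℤ) : SL2 := mk2 1 t 0 1 (by ring)
/-- `[[1,0],[t,1]]`. -/
def lo (t : ℤ) : SL2 := mk2 1 0 t 1 (by ring)

@[simp] lemma up_00 (t : ℤ) : m2 (up t) 0 0 = 1 := rfl
@[simp] lemma up_01 (t : ℤ) : m2 (up t) 0 1 = t := rfl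
@[simp] lemma up_10 (t : ℤ) : m2 (up t) 1 0 = 0 := rfl
@[simp] lemma up_11 (t : ℤ) : m2 (up t) 1 1 = 1 := rfl
@[simp] lemma lo_00 (t : ℤ) : m2 (lo t) 0 0 = 1 := rfl
@[simp] lemma lo_01 (t : ℤ) : m2 (lo t) 0 1 = 0 := rfl
@[simp] lemma lo_10 (t : ℤ) : m2 (lo t) 1 0 = t := rfl
@[simp] lemma lo_11 (t : ℤ) : m2 (lo t) 1 1 = 1 := rfl

lemma io_up (t : ℤ) : io (up t) = el 0 1 t := by
  apply em_ext; rw [em_io, em01]; simp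

lemma io_lo (t : ℤ) : io (lo t) = el 1 0 t := by
  apply em_ext; rw [em_io, em10]; simp

/-- Signed permutation `e₁ → e₂ → -e₁`. -/
def wq : EG := el 2 1 1 * el 1 2 (-1) * el 2 1 1
def wqi : EG := el 2 1 (-1) * el 1 2 1 * el 2 1 (-1)
/-- Signed permutation `e₀ → -e₂`, `e₂ → e₀`. -/
def wv : EG := el 0 2 1 * el 2 0 (-1) * el 0 2 1
def wvi : EG := el 0 2 (-1) * el 2 0 1 * el 0 2 (-1)

lemma em_wq : em wq = !![1,0,0,0; 0,0,-1,0; 0,1,0,0; 0,0,0,1] := by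
  simp only [wq, em_mul, em21, em12]; decide
lemma em_wqi : em wqi = !![1,0,0,0; 0,0,1,0; 0,-1,0,0; 0,0,0,1] := by
  simp only [wqi, em_mul, em21, em12]; decide
lemma em_wv : em wv = !![0,0,1,0; 0,1,0,0; -1,0,0,0; 0,0,0,1] := by
  simp only [wv, em_mul, em02, em20]; decide
lemma em_wvi : em wvi = !![0,0,-1,0; 0,1,0,0; 1,0,0,0; 0,0,0,1] := by
  simp only [wvi, em_mul, em02, em20]; decide
lemma wq_inv : wq * wqi = 1 := by
  apply em_ext; rw [em_mul, em_wq, em_wqi, em_one]; decide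
lemma wv_inv : wv * wvi = 1 := by
  apply em_ext; rw [em_mul, em_wv, em_wvi, em_one]; decide

lemma em_io13 (A : SL2) : em (wq * io A * wqi) =
    !![m2 A 0 0, 0, m2 A 0 1, 0; 0, 1, 0, 0; m2 A 1 0, 0, m2 A 1 1, 0; 0, 0, 0, 1] := by
  simp only [em_mul, em_wq, em_wqi, em_io]
  ext a b; fin_cases a <;> fin_cases b <;> simp [Matrix.mul_apply, Fin.sum_univ_four]

lemma em_io23 (A : SL2) : em (wq * wv * io A * (wvi * wqi)) =
    !![1, 0, 0, 0; 0, m2 A 0 0, m2 A 0 1, 0; 0, m2 A 1 0, m2 A 1 1, 0; 0, 0, 0, 1] := by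
  simp only [em_mul, em_wq, em_wqi, em_wv, em_wvi, em_io]
  ext a b; fin_cases a <;> fin_cases b <;> simp [Matrix.mul_apply, Fin.sum_univ_four]

/-- The key matrix identity behind multiplicativity of Mennicke symbols. -/
lemma mennicke_identity (A1 A2 D M : SL2) (a1 b c1 d1 a2 c2 d2 c d : ℤ)
    (h100 : m2 A1 0 0 = a1) (h101 : m2 A1 0 1 = b) (h110 : m2 A1 1 0 = c1) (h111 : m2 A1 1 1 = d1)
    (h200 : m2 A2 0 0 = a2) (h201 : m2 A2 0 1 = b) (h210 : m2 A2 1 0 = c2) (h211 : m2 A2 1 1 = d2)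
    (hD00 : m2 D 0 0 = a1 * a2) (hD01 : m2 D 0 1 = b) (hD10 : m2 D 1 0 = c) (hD11 : m2 D 1 1 = d)
    (hM00 : m2 M 0 0 = a2 - a1 * c2 * b) (hM01 : m2 M 0 1 = a1 * d2 - 1)
    (hM10 : m2 M 1 0 = - c2 * b) (hM11 : m2 M 1 1 = d2) :
    el 1 2 a1 * io A1 * (wq * io A2 * wqi) =
      el 1 0 ((c1 * a2 + a1 * c2) * d - d1 * c) * el 2 0 (c2 * d) *
        (wq * wv * io M * (wvi * wqi)) * io D * el 1 2 a1 := by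
  have e1 := m2_det A1
  have e2 := m2_det A2
  have e3 := m2_det D
  rw [h100, h101, h110, h111] at e1
  rw [h200, h201, h210, h211] at e2
  rw [hD00, hD01, hD10, hD11] at e3
  have f2 := em_io13 A2
  have f3 := em_io23 M
  generalize wq * io A2 * wqi = X at f2 ⊢
  generalize wq * wv * io M * (wvi * wqi) = Y at f3 ⊢
  apply em_ext
  rw [em_mul, em_mul, em_mul, em_mul, em_mul, em_mul, f2, f3, em12, em10, em20, em_io, em_io,
    h100, h101, h110, h111, h200, h201, h210, h211, hD00, hD01, hD10, hD11, hM00, hM01, hM10, hM11]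
  ext i j; fin_cases i <;> fin_cases j <;> simp [Matrix.mul_apply, Fin.sum_univ_four]
  · ring
  · linear_combination -(c1*a2+a1*c2)*e3 + a2*c*e1
  · linear_combination a2*d*e1 - d1*e3
  · linear_combination a1*(a2*d*e1 - d1*e3) - e1
  · linear_combination -c2*e3
  · ring
  · left; ring


section CSP
variable {Q : Type*} [Group Q] {φ : EG →* Q} {N : ℤ}

lemma phi_congr (hφ : ∀ i j t, φ (el i j (N * t)) = 1) {i j : Fin 4} {s t : ℤ} (h : N ∣ s - t) :
    φ (el i j s) = φ (el i j t) := by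
  obtain ⟨k, hk⟩ := h
  have : s = N * k + t := by linarith
  rw [this, el_add, map_mul, hφ, one_mul]

lemma phi_one (hφ : ∀ i j t, φ (el i j (N * t)) = 1) {i j : Fin 4} {s : ℤ} (h : N ∣ s) :
    φ (el i j s) = 1 := by
  obtain ⟨k, rfl⟩ := h
  exact hφ i j k

lemma commute_rel {z : Q} {i j k : Fin 4} (hij : i ≠ j) (hjk : j ≠ k) (hik : i ≠ k)
    (h1 : ∀ s, Commute z (φ (el i j s))) (h2 : ∀ s, Commute z (φ (el j k s))) (s : ℤ) :
    Commute z (φ (el i k s)) := by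
  have h := el_rel hij hjk hik s 1
  have h' : el i k s = el i j s * el j k 1 * (el i j s)⁻¹ * (el j k 1)⁻¹ := by
    rw [h]; simp [mul_assoc]
  rw [h', map_mul, map_mul, map_mul, map_inv, map_inv]
  exact (((h1 s).mul_right (h2 1)).mul_right (h1 s).inv_right).mul_right (h2 1).inv_right

lemma central (hφ : ∀ i j t, φ (el i j (N * t)) = 1) {A : SL2} (hA : IsG N A) (g : EG) :
    Commute (φ (io A)) (φ g) := by
  obtain ⟨h00, h01, h10, h11⟩ := hA
  have c02 : ∀ s, Commute (φ (io A)) (φ (el 0 2 s)) := by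
    intro s
    have h := congrArg φ (io_col2 A s 0)
    rw [el_zero, mul_one, map_mul, map_mul, map_mul,
      phi_congr hφ (i := 0) (j := 2) (s := m2 A 0 0 * s + m2 A 0 1 * 0) (t := s) (by
        obtain ⟨k, hk⟩ := h00; exact ⟨k * s, by linear_combination s * hk⟩),
      phi_one hφ (i := 1) (j := 2) (by simpa using Dvd.dvd.mul_right h10 s), mul_one] at h
    exact h
  have c12 : ∀ s, Commute (φ (io A)) (φ (el 1 2 s)) := by
    intro s
    have h := congrArg φ (io_col2 A 0 s)
    rw [el_zero, one_mul, map_mul, map_mul, map_mul,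
      phi_congr hφ (i := 1) (j := 2) (s := m2 A 1 0 * 0 + m2 A 1 1 * s) (t := s) (by
        obtain ⟨k, hk⟩ := h11; exact ⟨k * s, by linear_combination s * hk⟩),
      phi_one hφ (i := 0) (j := 2) (by simpa using Dvd.dvd.mul_right h01 s), one_mul] at h
    exact h
  have c03 : ∀ s, Commute (φ (io A)) (φ (el 0 3 s)) := by
    intro s
    have h := congrArg φ (io_col3 A s 0)
    rw [el_zero, mul_one, map_mul, map_mul, map_mul,
      phi_congr hφ (i := 0) (j := 3) (s := m2 A 0 0 * s + m2 A 0 1 * 0) (t := s) (by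
        obtain ⟨k, hk⟩ := h00; exact ⟨k * s, by linear_combination s * hk⟩),
      phi_one hφ (i := 1) (j := 3) (by simpa using Dvd.dvd.mul_right h10 s), mul_one] at h
    exact h
  have c13 : ∀ s, Commute (φ (io A)) (φ (el 1 3 s)) := by
    intro s
    have h := congrArg φ (io_col3 A 0 s)
    rw [el_zero, one_mul, map_mul, map_mul, map_mul,
      phi_congr hφ (i := 1) (j := 3) (s := m2 A 1 0 * 0 + m2 A 1 1 * s) (t := s) (by
        obtain ⟨k, hk⟩ := h11; exact ⟨k * s, by linear_combination s * hk⟩),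
      phi_one hφ (i := 0) (j := 3) (by simpa using Dvd.dvd.mul_right h01 s), one_mul] at h
    exact h
  have c20 : ∀ s, Commute (φ (io A)) (φ (el 2 0 s)) := by
    intro s
    have h := congrArg φ (io_row2 A s 0)
    rw [el_zero, mul_one, map_mul, map_mul, map_mul,
      phi_congr hφ (i := 2) (j := 0) (s := s * m2 A 0 0 + 0 * m2 A 1 0) (t := s) (by
        obtain ⟨k, hk⟩ := h00; exact ⟨k * s, by linear_combination s * hk⟩),
      phi_one hφ (i := 2) (j := 1) (by simpa using Dvd.dvd.mul_left h01 s), mul_one] at h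
    exact h.symm
  have c21 : ∀ s, Commute (φ (io A)) (φ (el 2 1 s)) := by
    intro s
    have h := congrArg φ (io_row2 A 0 s)
    rw [el_zero, one_mul, map_mul, map_mul, map_mul,
      phi_congr hφ (i := 2) (j := 1) (s := 0 * m2 A 0 1 + s * m2 A 1 1) (t := s) (by
        obtain ⟨k, hk⟩ := h11; exact ⟨k * s, by linear_combination s * hk⟩),
      phi_one hφ (i := 2) (j := 0) (by simpa using Dvd.dvd.mul_left h10 s), one_mul] at h
    exact h.symm
  have c30 : ∀ s, Commute (φ (io A)) (φ (el 3 0 s)) := by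
    intro s
    have h := congrArg φ (io_row3 A s 0)
    rw [el_zero, mul_one, map_mul, map_mul, map_mul,
      phi_congr hφ (i := 3) (j := 0) (s := s * m2 A 0 0 + 0 * m2 A 1 0) (t := s) (by
        obtain ⟨k, hk⟩ := h00; exact ⟨k * s, by linear_combination s * hk⟩),
      phi_one hφ (i := 3) (j := 1) (by simpa using Dvd.dvd.mul_left h01 s), mul_one] at h
    exact h.symm
  have c31 : ∀ s, Commute (φ (io A)) (φ (el 3 1 s)) := by
    intro s
    have h := congrArg φ (io_row3 A 0 s)
    rw [el_zero, one_mul, map_mul, map_mul, map_mul,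
      phi_congr hφ (i := 3) (j := 1) (s := 0 * m2 A 0 1 + s * m2 A 1 1) (t := s) (by
        obtain ⟨k, hk⟩ := h11; exact ⟨k * s, by linear_combination s * hk⟩),
      phi_one hφ (i := 3) (j := 0) (by simpa using Dvd.dvd.mul_left h10 s), one_mul] at h
    exact h.symm
  have cs : ∀ i s, Commute (φ (io A)) (φ (el i i s)) := by
    intro i s; rw [el_self, map_one]; exact Commute.one_right _
  have c01 := commute_rel (by decide) (by decide) (by decide) c02 c21
  have c10 := commute_rel (by decide) (by decide) (by decide) c12 c20
  have c23 := commute_rel (by decide) (by decide) (by decide) c20 c03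
  have c32 := commute_rel (by decide) (by decide) (by decide) c30 c02
  induction g using EG_induction with
  | h1 => rw [map_one]; exact Commute.one_right _
  | hel i j t =>
    fin_cases i <;> fin_cases j <;> first | exact cs _ t | exact c01 t | exact c02 t | exact c03 t | exact c10 t | exact c12 t | exact c13 t | exact c20 t | exact c21 t | exact c23 t | exact c30 t | exact c31 t | exact c32 t
  | hmul a b ha hb => rw [map_mul]; exact ha.mul_right hb
  | hinv a ha => rw [map_inv]; exact ha.inv_right

lemma central_conj (hφ : ∀ i j t, φ (el i j (N * t)) = 1) {A : SL2} (hA : IsG N A) {g h : EG}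
    (hgh : g * h = 1) : φ (g * io A * h) = φ (io A) := by
  have := central hφ hA g
  rw [map_mul, map_mul, ← this.eq, mul_assoc, ← map_mul, hgh, map_one, mul_one]

lemma z_up (hφ : ∀ i j t, φ (el i j (N * t)) = 1) {t : ℤ} (h : N ∣ t) : φ (io (up t)) = 1 := by
  rw [io_up, phi_one hφ h]

lemma z_lo (hφ : ∀ i j t, φ (el i j (N * t)) = 1) {t : ℤ} (h : N ∣ t) : φ (io (lo t)) = 1 := by
  rw [io_lo, phi_one hφ h]

/-- `z(A)` depends only on the top row of `A`. -/
lemma z_top (hφ : ∀ i j t, φ (el i j (N * t)) = 1) {A B : SL2} (hA : IsG N A) (hB : IsG N B)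
    (h0 : m2 A 0 0 = m2 B 0 0) (h1 : m2 A 0 1 = m2 B 0 1) : φ (io A) = φ (io B) := by
  have dA := m2_det A
  have dB := m2_det B
  have : A = lo (m2 A 1 0 * m2 B 1 1 - m2 A 1 1 * m2 B 1 0) * B := by
    apply m2_ext <;> simp [m2_mul, h0, h1]
    · rw [h0, h1] at dA
      linear_combination m2 B 1 0 * dA - m2 A 1 0 * dB
    · rw [h0, h1] at dA
      linear_combination m2 B 1 1 * dA - m2 A 1 1 * dB
  rw [this, map_mul, map_mul, z_lo hφ, one_mul]
  exact dvd_sub (Dvd.dvd.mul_right hA.2.2.1 _) (Dvd.dvd.mul_left hB.2.2.1 _)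

lemma exists_top (a b : ℤ) (ha : N ∣ a - 1) (hb : N ∣ b) (hab : IsCoprime a b) :
    ∃ A : SL2, IsG N A ∧ m2 A 0 0 = a ∧ m2 A 0 1 = b := by
  obtain ⟨u, v, huv⟩ := hab
  -- `u a + v b = 1`; want `d = u + k b`, `c = -v + k a` with `c ≡ 0`
  refine ⟨mk2 a b (-v + v * a) (u + v * b) (by linear_combination huv), ⟨ha, hb, ?_, ?_⟩, rfl, rfl⟩
  · simp only [mk2_10]
    obtain ⟨k, hk⟩ := ha
    exact ⟨k * v, by linear_combination v * hk⟩
  · simp only [mk2_11]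
    obtain ⟨k, hk⟩ := ha
    exact ⟨- k * u, by linear_combination -u * hk + huv⟩

open Classical in
/-- The Mennicke symbol. -/
noncomputable def ms (φ : EG →* Q) (N a b : ℤ) : Q :=
  if h : ∃ A : SL2, IsG N A ∧ m2 A 0 0 = a ∧ m2 A 0 1 = b then φ (io h.choose) else 1

lemma ms_eq (hφ : ∀ i j t, φ (el i j (N * t)) = 1) {A : SL2} (hA : IsG N A) {a b : ℤ}
    (ha : m2 A 0 0 = a) (hb : m2 A 0 1 = b) : ms φ N a b = φ (io A) := by
  have h : ∃ A : SL2, IsG N A ∧ m2 A 0 0 = a ∧ m2 A 0 1 = b := ⟨A, hA, ha, hb⟩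
  rw [ms, dif_pos h]
  obtain ⟨h1, h2, h3⟩ := h.choose_spec
  exact z_top hφ h1 hA (h2.trans ha.symm) (h3.trans hb.symm)

lemma ms_one (hφ : ∀ i j t, φ (el i j (N * t)) = 1) {b : ℤ} (hb : N ∣ b) : ms φ N 1 b = 1 := by
  rw [ms_eq hφ (A := up b) (a := 1) (b := b) (by simp [IsG, hb]) rfl rfl, z_up hφ hb]

lemma IsG.mul {A B : SL2} (hA : IsG N A) (hB : IsG N B) : IsG N (A * B) := by
  obtain ⟨⟨a, ha⟩, ⟨b, hb⟩, ⟨c, hc⟩, ⟨d, hd⟩⟩ := hA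
  obtain ⟨⟨a', ha'⟩, ⟨b', hb'⟩, ⟨c', hc'⟩, ⟨d', hd'⟩⟩ := hB
  have e1 : m2 A 0 0 = N * a + 1 := by linarith
  have e2 : m2 B 0 0 = N * a' + 1 := by linarith
  have e3 : m2 A 1 1 = N * d + 1 := by linarith
  have e4 : m2 B 1 1 = N * d' + 1 := by linarith
  simp only [IsG, m2_mul, e1, e2, e3, e4, hb, hb', hc, hc']
  exact ⟨⟨N * a * a' + a + a' + N * b * c', by ring⟩, ⟨N * a * b' + b' + N * b * d' + b, by ring⟩,
    ⟨N * c * a' + c + N * d * c' + c', by ring⟩, ⟨N * c * b' + N * d * d' + d + d', by ring⟩⟩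

lemma IsG_conj {A : SL2} (hA : IsG N A) (B C : SL2) (h : B * C = 1) : IsG N (B * A * C) := by
  obtain ⟨⟨a, ha⟩, ⟨b, hb⟩, ⟨c, hc⟩, ⟨d, hd⟩⟩ := hA
  have e1 : m2 A 0 0 = N * a + 1 := by linarith
  have e3 : m2 A 1 1 = N * d + 1 := by linarith
  have f00 := congrArg (fun X => m2 X 0 0) h
  have f01 := congrArg (fun X => m2 X 0 1) h
  have f10 := congrArg (fun X => m2 X 1 0) h
  have f11 := congrArg (fun X => m2 X 1 1) h
  simp only [m2_mul, m2_one_00, m2_one_01, m2_one_10, m2_one_11] at f00 f01 f10 f11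
  simp only [IsG, m2_mul, e1, e3, hb, hc]
  refine ⟨⟨(m2 B 0 0 * a + m2 B 0 1 * c) * m2 C 0 0 + (m2 B 0 0 * b + m2 B 0 1 * d) * m2 C 1 0, ?_⟩,
    ⟨(m2 B 0 0 * a + m2 B 0 1 * c) * m2 C 0 1 + (m2 B 0 0 * b + m2 B 0 1 * d) * m2 C 1 1, ?_⟩,
    ⟨(m2 B 1 0 * a + m2 B 1 1 * c) * m2 C 0 0 + (m2 B 1 0 * b + m2 B 1 1 * d) * m2 C 1 0, ?_⟩,
    ⟨(m2 B 1 0 * a + m2 B 1 1 * c) * m2 C 0 1 + (m2 B 1 0 * b + m2 B 1 1 * d) * m2 C 1 1, ?_⟩⟩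
  · linear_combination f00
  · linear_combination f01
  · linear_combination f10
  · linear_combination f11

lemma lo_inv (t : ℤ) : lo (-t) * lo t = 1 := by
  apply m2_ext <;> simp [m2_mul]

lemma up_inv (t : ℤ) : up (-t) * up t = 1 := by
  apply m2_ext <;> simp [m2_mul]

lemma ms_add_a (hφ : ∀ i j t, φ (el i j (N * t)) = 1) {a b : ℤ} (ha : N ∣ a - 1) (hb : N ∣ b)
    (hab : IsCoprime a b) (t : ℤ) : ms φ N (a + t * b) b = ms φ N a b := by
  obtain ⟨A, hA, rfl, rfl⟩ := exists_top a b ha hb hab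
  rw [ms_eq hφ hA rfl rfl, ms_eq hφ (IsG_conj hA _ _ (lo_inv t)) (by simp [m2_mul]; ring)
    (by simp [m2_mul]), map_mul io, map_mul io, central_conj hφ hA]
  rw [← map_mul, lo_inv, map_one]

lemma ms_add_b (hφ : ∀ i j t, φ (el i j (N * t)) = 1) {a b : ℤ} (ha : N ∣ a - 1) (hb : N ∣ b)
    (hab : IsCoprime a b) (t : ℤ) : ms φ N a (b + N * t * a) = ms φ N a b := by
  obtain ⟨A, hA, rfl, rfl⟩ := exists_top a b ha hb hab
  have hu : IsG N (up (N * t)) := by simp [IsG]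
  rw [ms_eq hφ hA rfl rfl, ms_eq hφ (hA.mul hu) (by simp [m2_mul])
    (by simp [m2_mul]; ring), map_mul, map_mul, z_up hφ (Dvd.intro _ rfl), mul_one]

lemma ms_neg (hφ : ∀ i j t, φ (el i j (N * t)) = 1) {a b : ℤ} (ha : N ∣ a - 1) (hb : N ∣ b)
    (hab : IsCoprime a b) : ms φ N a (-b) = ms φ N a b := by
  obtain ⟨A, hA, rfl, rfl⟩ := exists_top a b ha hb hab
  have hd := m2_det A
  have hB : IsG N (mk2 (m2 A 0 0) (-m2 A 0 1) (-m2 A 1 0) (m2 A 1 1) (by linarith)) := by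
    obtain ⟨h1, h2, h3, h4⟩ := hA
    exact ⟨h1, by simpa using h2, by simpa using h3, h4⟩
  rw [ms_eq hφ hA rfl rfl, ms_eq hφ hB (a := m2 A 0 0) (b := -m2 A 0 1) rfl rfl, ← central_conj hφ hA (g := wq * wq) (h := wqi * wqi)]
  · congr 1
    apply em_ext
    simp only [em_mul, em_wq, em_wqi, em_io]
    ext a b; fin_cases a <;> fin_cases b <;> simp [Matrix.mul_apply, Fin.sum_univ_four]
  · have := wq_inv
    calc wq * wq * (wqi * wqi) = wq * (wq * wqi) * wqi := by simp only [mul_assoc]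
      _ = 1 := by rw [this, mul_one, this]

lemma ms_mul (hφ : ∀ i j t, φ (el i j (N * t)) = 1) {a1 a2 b : ℤ} (ha1 : N ∣ a1 - 1)
    (ha2 : N ∣ a2 - 1) (hb : N ∣ b) (h1 : IsCoprime a1 b) (h2 : IsCoprime a2 b) :
    ms φ N (a1 * a2) b = ms φ N a1 b * ms φ N a2 b := by
  have ha12 : N ∣ a1 * a2 - 1 := by
    obtain ⟨k, hk⟩ := ha1
    obtain ⟨l, hl⟩ := ha2
    exact ⟨k * a2 + l, by linear_combination a2 * hk + hl⟩
  obtain ⟨A1, hA1, g00, g01⟩ := exists_top a1 b ha1 hb h1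
  obtain ⟨A2, hA2, k00, k01⟩ := exists_top a2 b ha2 hb h2
  obtain ⟨D, hD, l00, l01⟩ := exists_top (a1 * a2) b ha12 hb (h1.mul_left h2)
  have e1 := m2_det A1
  have e2 := m2_det A2
  rw [ms_eq hφ hA1 g00 g01, ms_eq hφ hA2 k00 k01, ms_eq hφ hD l00 l01]
  obtain ⟨p00, p01, p10, p11⟩ := hA1
  obtain ⟨q00, q01, q10, q11⟩ := hA2
  set c1 := m2 A1 1 0 with hc1
  set d1 := m2 A1 1 1 with hd1
  set c2 := m2 A2 1 0 with hc2
  set d2 := m2 A2 1 1 with hd2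
  rw [g00, g01] at e1
  rw [k00, k01] at e2
  have hMd : (a2 - a1 * c2 * b) * d2 - (a1 * d2 - 1) * (-c2 * b) = 1 := by
    linear_combination e2
  have hM : IsG N (mk2 _ _ _ _ hMd) := by
    refine ⟨?_, ?_, ?_, q11⟩
    · simp only [mk2_00]
      obtain ⟨k, hk⟩ := ha2
      obtain ⟨l, hl⟩ := hb
      exact ⟨k - a1 * c2 * l, by rw [hl]; linear_combination hk⟩
    · simp only [mk2_01]
      obtain ⟨k, hk⟩ := ha1
      obtain ⟨l, hl⟩ := q11
      exact ⟨k * d2 + l, by linear_combination d2 * hk + hl⟩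
    · simp only [mk2_10]
      exact Dvd.dvd.mul_left hb _
  have id := mennicke_identity A1 A2 D (mk2 _ _ _ _ hMd) a1 b c1 d1 a2 c2 d2 (m2 D 1 0) (m2 D 1 1)
    g00 g01 rfl rfl k00 k01 rfl rfl l00 l01 rfl rfl rfl rfl rfl rfl
  have zM : φ (io (mk2 _ _ _ _ hMd)) = 1 := by
    set M := mk2 _ _ _ _ hMd with hMdef
    have hlo : IsG N (lo (a2 - 1)) := by simp [IsG, ha2]
    have hM1 := hM.mul hlo
    have hM2 := IsG_conj hM1 _ _ (up_inv 1)
    have hlo' : IsG N (lo (d2 - 1)) := by simp [IsG, q11]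
    have hM3 := hM2.mul hlo'
    have z1 : φ (io (M * lo (a2 - 1))) = φ (io M) := by
      rw [map_mul, map_mul, z_lo hφ ha2, mul_one]
    have z2 : φ (io (up (-1) * (M * lo (a2 - 1)) * up 1)) = φ (io (M * lo (a2 - 1))) := by
      rw [map_mul io, map_mul io (up (-1)), central_conj hφ hM1]
      rw [← map_mul, up_inv, map_one]
    have z3 : φ (io (up (-1) * (M * lo (a2 - 1)) * up 1 * lo (d2 - 1))) =
        φ (io (up (-1) * (M * lo (a2 - 1)) * up 1)) := by
      rw [map_mul io, map_mul φ, z_lo hφ q11, mul_one]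
    rw [← z1, ← z2, ← z3]
    generalize hM3' : up (-1) * (M * lo (a2 - 1)) * up 1 * lo (d2 - 1) = M3 at hM3 ⊢
    have b0 : m2 M3 1 0 = 0 := by
      rw [← hM3']; simp [m2_mul, hMdef]; linear_combination d2 * e2
    have b1 : m2 M3 1 1 = 1 := by
      rw [← hM3']; simp [m2_mul, hMdef]; linear_combination e2
    have b2 : m2 M3 0 0 = 1 := by
      have := m2_det M3
      rw [b0, b1] at this; linarith
    have : M3 = up (m2 M3 0 1) := by
      apply m2_ext <;> simp [b0, b1, b2]
    rw [this, z_up hφ hM3.2.1]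
  have id' := congrArg φ id
  rw [map_mul φ _ (wq * io A2 * wqi), central_conj hφ ⟨q00, q01, q10, q11⟩ wq_inv, map_mul φ (el 1 2 a1)] at id'
  have y1 : φ (el 2 0 (c2 * m2 D 1 1)) = 1 := phi_one hφ (Dvd.dvd.mul_right q10 _)
  have y2 : φ (el 1 0 ((c1 * a2 + a1 * c2) * m2 D 1 1 - d1 * m2 D 1 0)) = 1 := by
    apply phi_one hφ
    obtain ⟨k, hk⟩ := p10
    obtain ⟨l, hl⟩ := q10
    obtain ⟨m, hm⟩ := hD.2.2.1
    exact ⟨(k * a2 + a1 * l) * m2 D 1 1 - d1 * m, by rw [hk, hl, hm]; ring⟩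
  have y3 : wq * wv * (wvi * wqi) = 1 := by
    calc wq * wv * (wvi * wqi) = wq * (wv * wvi) * wqi := by simp only [mul_assoc]
      _ = 1 := by rw [wv_inv, mul_one, wq_inv]
  have y4 := central_conj hφ hM y3
  rw [zM] at y4
  generalize wq * wv * io _ * (wvi * wqi) = Y at y4 id'
  rw [map_mul, map_mul, map_mul, map_mul, y1, y2, y4, one_mul, one_mul, one_mul,
    (central hφ hD (el 1 2 a1)).eq, mul_assoc] at id'
  exact (mul_left_cancel id').symm

lemma ms_pow (hφ : ∀ i j t, φ (el i j (N * t)) = 1) {a b : ℤ} (ha : N ∣ a - 1)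
    (hb : N ∣ b) (h : IsCoprime a b) (r : ℕ) : ms φ N (a ^ r) b = ms φ N a b ^ r := by
  induction r with
  | zero => simp [ms_one hφ hb]
  | succ r ih =>
    rw [pow_succ, ms_mul hφ _ ha hb h.pow_left h, ih, pow_succ]
    have := sub_dvd_pow_sub_pow a 1 r
    rw [one_pow] at this
    exact ha.trans this

end CSP

section Vanishing
variable {Q : Type*} [Group Q] {φ : EG →* Q} {N : ℤ}

lemma crt2 {m n a b : ℤ} (h : IsCoprime m n) (ha : IsCoprime a m) (hb : IsCoprime b n) :
    ∃ x, m ∣ x - a ∧ n ∣ x - b ∧ IsCoprime x (m * n) := by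
  obtain ⟨u, v, huv⟩ := h
  have h1 : a * (v * n) + b * (u * m) = a + m * (u * (b - a)) := by linear_combination a * huv
  have h2 : a * (v * n) + b * (u * m) = b + n * (v * (a - b)) := by linear_combination b * huv
  refine ⟨a * (v * n) + b * (u * m), ⟨u * (b - a), by rw [h1]; ring⟩, ⟨v * (a - b), by rw [h2]; ring⟩, ?_⟩
  apply IsCoprime.mul_right
  · rw [h1]; exact ha.add_mul_left_left _
  · rw [h2]; exact hb.add_mul_left_left _

lemma exists_prime_zmod (B : ℕ) {n a : ℤ} (hn : n ≠ 0) (h : IsCoprime a n) :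
    ∃ p : ℕ, B < p ∧ p.Prime ∧ n ∣ (p : ℤ) - a := by
  have h' : IsCoprime a (n.natAbs : ℤ) := by
    rw [Int.isCoprime_iff_gcd_eq_one] at h ⊢
    rwa [Int.gcd_def, Int.natAbs_natCast, ← Int.gcd_def]
  obtain ⟨p, h1, h2, h3⟩ := Nat.forall_exists_prime_gt_and_zmodEq B (Int.natAbs_ne_zero.mpr hn) h'
  refine ⟨p, h1, h2, ?_⟩
  have := h3.symm.dvd
  rwa [Int.natAbs_dvd] at this

/-- If `a` is a square mod `q`, the symbol `ms a (N q)` has odd order dividing `(q-1)/2`. -/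
lemma ms_prime_pow (hφ : ∀ i j t, φ (el i j (N * t)) = 1) {a : ℤ} (ha : N ∣ a - 1) {q : ℕ}
    [Fact q.Prime] (hqN : IsCoprime N q) (haq : legendreSym q a = 1) :
    ms φ N a (N * q) ^ (q / 2) = 1 := by
  have hcop : IsCoprime a q := by
    have h0 : ((a : ℤ) : ZMod q) ≠ 0 := by
      intro h
      rw [(legendreSym.eq_zero_iff q a).2 h] at haq
      exact absurd haq (by norm_num)
    rw [ne_eq, ZMod.intCast_zmod_eq_zero_iff_dvd] at h0
    exact ((Nat.prime_iff_prime_int.1 Fact.out).coprime_iff_not_dvd.2 h0).symm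
  have haN : IsCoprime a N := by
    obtain ⟨k, hk⟩ := ha
    exact ⟨1, -k, by linarith⟩
  have hpow : (q : ℤ) ∣ a ^ (q / 2) - 1 := by
    have := legendreSym.eq_pow q a
    rw [haq] at this
    rw [← ZMod.intCast_zmod_eq_zero_iff_dvd]
    push_cast at this ⊢
    rw [← this]; ring
  have hpowN : N ∣ a ^ (q / 2) - 1 := by
    have := sub_dvd_pow_sub_pow a 1 (q / 2)
    rw [one_pow] at this
    exact ha.trans this
  obtain ⟨k, hk⟩ := hqN.mul_dvd hpowN hpow
  rw [← ms_pow hφ ha (Dvd.intro _ rfl) (haN.mul_right hcop)]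
  have : a ^ (q / 2) = 1 + k * (N * q) := by linarith
  rw [this, ms_add_a hφ (by simp) (Dvd.intro _ rfl) isCoprime_one_left, ms_one hφ (Dvd.intro _ rfl)]

lemma legendre_calc {P q : ℕ} [Fact P.Prime] [Fact q.Prime] (hP : P % 4 = 3) (hq : q % 4 = 3)
    (hPq : P ≠ q) {σ ε b' : ℤ} (hσ : σ = 1 ∨ σ = -1) (hb : ¬ (P : ℤ) ∣ b')
    (hε : ε = -σ * legendreSym P b') (h : (P : ℤ) ∣ q - ε * b') : legendreSym q (σ * P) = 1 := by
  have m1P : legendreSym P (-1) = -1 := by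
    rw [legendreSym.at_neg_one (by omega), ZMod.χ₄_nat_three_mod_four hP]
  have m1q : legendreSym q (-1) = -1 := by
    rw [legendreSym.at_neg_one (by omega), ZMod.χ₄_nat_three_mod_four hq]
  have hbP : legendreSym P b' = 1 ∨ legendreSym P b' = -1 := by
    apply legendreSym.eq_one_or_neg_one
    rwa [ne_eq, ZMod.intCast_zmod_eq_zero_iff_dvd]
  have hq' : legendreSym P q = legendreSym P (ε * b') := by
    unfold legendreSym
    congr 1
    rw [← sub_eq_zero, ← Int.cast_sub, ZMod.intCast_zmod_eq_zero_iff_dvd]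
    exact h
  have hrecip : legendreSym q P = - legendreSym P q := by
    exact legendreSym.quadratic_reciprocity_three_mod_four hP hq
  rw [legendreSym.mul, hrecip, hq', legendreSym.mul]
  have one1 : legendreSym P 1 = 1 := legendreSym.at_one P
  have one2 : legendreSym q 1 = 1 := legendreSym.at_one q
  rcases hσ with rfl | rfl <;> rcases hbP with hb' | hb' <;> rw [hb'] at hε ⊢ <;> subst hε <;>
    norm_num [m1P, m1q, one1, one2]

/-- The symbols vanish, main case. -/
lemma ms_vanish_main (hφ : ∀ i j t, φ (el i j (N * t)) = 1) (hN : N ≠ 0) {a b' : ℤ} (ha : N ∣ a - 1)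
    (hb' : 2 ≤ |b'|) (hab : IsCoprime a (N * b')) (hodd : a % 2 = 1) : ms φ N a (N * b') = 1 := by
  have hb0 : b' ≠ 0 := by rintro rfl; norm_num at hb'
  obtain ⟨σ, hσ, hσa⟩ : ∃ σ : ℤ, (σ = 1 ∨ σ = -1) ∧ (σ * a) % 4 = 3 := by
    have : a % 4 = 1 ∨ a % 4 = 3 := by omega
    rcases this with h | h
    · exact ⟨-1, Or.inr rfl, by omega⟩
    · exact ⟨1, Or.inl rfl, by omega⟩
  have hσσ : σ * σ = 1 := by rcases hσ with rfl | rfl <;> norm_num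
  have hσu : IsCoprime σ 4 := ⟨σ, 0, by linarith⟩
  obtain ⟨P, hPB, hPp, hPd⟩ := exists_prime_zmod (b'.natAbs + 1) (n := 4 * (N * b')) (a := σ * a)
    (by simp [hN, hb0]) (by
      have ha4 : IsCoprime a 4 := by
        have : a % 4 = 1 ∨ a % 4 = 3 := by omega
        rcases this with h | h
        · exact ⟨1, -(a / 4), by omega⟩
        · exact ⟨-1, a / 4 + 1, by omega⟩
      have hσ' : ∀ m, IsCoprime σ m := fun m => ⟨σ, 0, by linarith⟩
      exact IsCoprime.mul_left (hσ' _) (ha4.mul_right hab))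
  have : Fact P.Prime := ⟨hPp⟩
  have hP4 : P % 4 = 3 := by
    obtain ⟨k, hk⟩ := hPd
    have : (P : ℤ) = σ * a + 4 * (N * b' * k) := by linarith
    omega
  -- replace `a` by `σ P`
  obtain ⟨k, hk⟩ := hPd
  have hA : σ * P = a + (σ * 4 * k) * (N * b') := by
    linear_combination σ * hk + a * hσσ
  have haNb : IsCoprime (σ * P) (N * b') := by
    rw [hA]; exact hab.add_mul_right_left _
  have haN : N ∣ σ * P - 1 := by
    obtain ⟨l, hl⟩ := ha
    exact ⟨l + σ * 4 * k * b', by rw [hA]; linear_combination hl⟩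
  rw [← ms_add_a hφ ha (Dvd.intro _ rfl) hab (σ * 4 * k), ← hA]
  have hPb : ¬ (P : ℤ) ∣ b' := by
    intro h
    have := Nat.le_of_dvd (Int.natAbs_pos.2 hb0) (Int.natCast_dvd.1 h)
    omega
  obtain ⟨ε, hε⟩ : ∃ ε, ε = -σ * legendreSym P b' := ⟨_, rfl⟩
  have hε1 : ε = 1 ∨ ε = -1 := by
    have : legendreSym P b' = 1 ∨ legendreSym P b' = -1 := by
      apply legendreSym.eq_one_or_neg_one
      rwa [ne_eq, ZMod.intCast_zmod_eq_zero_iff_dvd]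
    rcases hσ with rfl | rfl <;> rcases this with h | h <;> rw [h] at hε <;> simp [hε]
  have hεε : ε * ε = 1 := by rcases hε1 with h | h <;> rw [h] <;> norm_num
  have hPnat := Nat.prime_iff_prime_int.1 hPp
  -- what a good prime gives
  have key : ∀ q : ℕ, q.Prime → q % 4 = 3 → N.natAbs < q → P < q → (P : ℤ) ∣ q - ε * b' →
      ms φ N (σ * P) (N * b') ^ (q / 2) = 1 := by
    intro q hq hq4 hqN hqP hqd
    have : Fact q.Prime := ⟨hq⟩
    have h1 := legendre_calc hP4 hq4 hqP.ne hσ hPb hε hqd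
    have h2 : IsCoprime N q := by
      refine ((Nat.prime_iff_prime_int.1 hq).coprime_iff_not_dvd.2 ?_).symm
      intro h
      have := Nat.le_of_dvd (Int.natAbs_pos.2 hN) (Int.natCast_dvd.1 h)
      omega
    have h3 := ms_prime_pow hφ haN h2 h1
    have h4 : ms φ N (σ * P) (ε * (N * b')) = ms φ N (σ * P) (N * b') := by
      rcases hε1 with h | h
      · rw [h, one_mul]
      · rw [h, neg_one_mul, ms_neg hφ haN (Dvd.intro _ rfl) haNb]
    obtain ⟨l, hl⟩ := hqd
    have h5 : N * (q : ℤ) = ε * (N * b') + N * (σ * l) * (σ * P) := by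
      linear_combination N * hl - N * P * l * hσσ
    rw [h5, ms_add_b hφ haN (Dvd.dvd.mul_left (Dvd.intro _ rfl) _) _, h4] at h3
    · exact h3
    · exact IsCoprime.mul_right ⟨0, ε, by linarith⟩ haNb
  have hcopP : IsCoprime (ε * b') (P : ℤ) := by
    refine IsCoprime.mul_left ⟨ε, 0, by linarith⟩ (hPnat.coprime_iff_not_dvd.2 hPb).symm
  have h4P : IsCoprime (4 : ℤ) P := ⟨(P : ℤ) / 4 + 1, -1, by omega⟩
  obtain ⟨x, hx4, hxP, hx⟩ := crt2 h4P (a := 3) (b := ε * b') ⟨-1, 1, by norm_num⟩ hcopP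
  obtain ⟨q1, hq1B, hq1, hq1d⟩ := exists_prime_zmod (N.natAbs + P) (mul_ne_zero (by norm_num)
    hPnat.ne_zero) hx
  have hq14 : q1 % 4 = 3 := by
    have h1 : (4 : ℤ) ∣ q1 - x := (Dvd.intro _ rfl).trans hq1d
    omega
  have hq1P : (P : ℤ) ∣ q1 - ε * b' := by
    have h1 : (P : ℤ) ∣ q1 - x := (Dvd.intro_left _ rfl).trans hq1d
    have := dvd_add h1 hxP
    simpa using this
  have k1 := key q1 hq1 hq14 (by omega) (by omega) hq1P
  -- second prime
  have hr1P : ¬ (P : ℤ) ∣ ((q1 / 2 : ℕ) : ℤ) := by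
    intro h
    have h1 : (P : ℤ) ∣ q1 - 1 := by
      have : (q1 : ℤ) - 1 = 2 * ((q1 / 2 : ℕ) : ℤ) := by omega
      rw [this]; exact Dvd.dvd.mul_left h _
    have h2 : (P : ℤ) ∣ ε * b' - 1 := by
      have := dvd_sub h1 hq1P
      have e : (q1 : ℤ) - 1 - (q1 - ε * b') = ε * b' - 1 := by ring
      rwa [e] at this
    have h3 : ε * b' - 1 ≠ 0 := by
      intro h
      rcases hε1 with h' | h' <;> rw [h'] at h
      · have : b' = 1 := by linarith
        rw [this] at hb'; norm_num at hb'
      · have : b' = -1 := by linarith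
        rw [this] at hb'; norm_num at hb'
    have h4 := Nat.le_of_dvd (Int.natAbs_pos.2 h3) (Int.natCast_dvd.1 h2)
    rcases hε1 with h' | h' <;> rw [h'] at h4 <;> omega
  have hr1 : IsCoprime (4 * (P : ℤ)) ((q1 / 2 : ℕ) : ℤ) := by
    apply IsCoprime.mul_left
    · have : (((q1 / 2 : ℕ) : ℤ)) % 4 = 1 ∨ (((q1 / 2 : ℕ) : ℤ)) % 4 = 3 := by omega
      rcases this with h | h
      · exact ⟨-(((q1 / 2 : ℕ) : ℤ) / 4), 1, by omega⟩
      · exact ⟨(((q1 / 2 : ℕ) : ℤ)) / 4 + 1, -1, by omega⟩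
    · exact hPnat.coprime_iff_not_dvd.2 hr1P
  obtain ⟨y, hy1, hy2, hy⟩ := crt2 hr1 (a := x) (b := 2) hx
    ⟨-(((q1 / 2 : ℕ) : ℤ) / 2), 1, by omega⟩
  obtain ⟨q2, hq2B, hq2, hq2d⟩ := exists_prime_zmod (N.natAbs + P) (mul_ne_zero (mul_ne_zero (by norm_num)
    hPnat.ne_zero) (by have := hq1.two_le; omega)) hy
  have hq2x : 4 * (P : ℤ) ∣ q2 - x := by
    have h1 : 4 * (P : ℤ) ∣ q2 - y := (Dvd.intro _ rfl).trans hq2d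
    have := dvd_add h1 hy1
    simpa using this
  have hq24 : q2 % 4 = 3 := by
    have h1 : (4 : ℤ) ∣ q2 - x := (Dvd.intro _ rfl).trans hq2x
    omega
  have hq2P : (P : ℤ) ∣ q2 - ε * b' := by
    have h1 : (P : ℤ) ∣ q2 - x := (Dvd.intro_left _ rfl).trans hq2x
    have := dvd_add h1 hxP
    simpa using this
  have k2 := key q2 hq2 hq24 (by omega) (by omega) hq2P
  have hco : Nat.Coprime (q1 / 2) (q2 / 2) := by
    rw [← Nat.isCoprime_iff_coprime]
    have h1 : ((q1 / 2 : ℕ) : ℤ) ∣ q2 - y := (Dvd.intro_left _ rfl).trans hq2d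
    have h2 := dvd_add h1 hy2
    obtain ⟨l, hl⟩ := h2
    refine ⟨-l, 2, ?_⟩
    have e : 2 * ((q2 / 2 : ℕ) : ℤ) = q2 - 1 := by omega
    linear_combination e + hl
  have o1 := orderOf_dvd_of_pow_eq_one k1
  have o2 := orderOf_dvd_of_pow_eq_one k2
  rw [← orderOf_eq_one_iff]
  exact Nat.eq_one_of_dvd_coprimes hco o1 o2

lemma ms_vanish_ne (hφ : ∀ i j t, φ (el i j (N * t)) = 1) (hN : N ≠ 0) {a b' : ℤ} (ha : N ∣ a - 1)
    (hb0 : b' ≠ 0) (hab : IsCoprime a (N * b')) : ms φ N a (N * b') = 1 := by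
  by_cases hb : 2 ≤ |b'|
  · by_cases hodd : a % 2 = 1
    · exact ms_vanish_main hφ hN ha hb hab hodd
    · rw [← ms_add_a hφ ha (Dvd.intro _ rfl) hab 1]
      apply ms_vanish_main hφ hN _ hb (hab.add_mul_right_left _)
      · have : (N * b') % 2 = 1 := by
          by_contra h
          have h1 : (2 : ℤ) ∣ a := by omega
          have h2 : (2 : ℤ) ∣ N * b' := by omega
          have := hab.isUnit_of_dvd' h1 h2
          rw [Int.isUnit_iff] at this
          omega
        omega
      · obtain ⟨l, hl⟩ := ha
        exact ⟨l + b', by linear_combination hl⟩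
  · have : b' = 1 ∨ b' = -1 := by
      have := abs_pos.2 hb0
      have h1 : |b'| = 1 := by omega
      exact (abs_eq (by norm_num)).1 h1
    obtain ⟨l, hl⟩ := ha
    have h1 : a = 1 + (l * b') * (N * b') := by
      rcases this with h | h <;> rw [h] <;> linear_combination hl
    rw [h1, ms_add_a hφ (by simp) (Dvd.intro _ rfl) isCoprime_one_left, ms_one hφ (Dvd.intro _ rfl)]

/-- The congruence subgroup property for the embedded `SL₂`. -/
theorem csp (hφ : ∀ i j t, φ (el i j (N * t)) = 1) (hN : N ≠ 0) {A : SL2} (hA : IsG N A) :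
    φ (io A) = 1 := by
  have hd := m2_det A
  rw [← ms_eq hφ hA rfl rfl]
  obtain ⟨h00, h01, -, -⟩ := hA
  have hab : IsCoprime (m2 A 0 0) (m2 A 0 1) := ⟨m2 A 1 1, - m2 A 1 0, by linarith⟩
  generalize m2 A 0 0 = a at *
  generalize m2 A 0 1 = b at *
  obtain ⟨b', rfl⟩ := h01
  by_cases hb : b' = 0
  · subst hb
    rw [← ms_add_b hφ h00 (by simp) hab 1]
    have ha0 : a ≠ 0 := by rintro rfl; simp at hd
    have e : N * 0 + N * 1 * a = N * a := by ring
    have hab' := hab.add_mul_right_right (N * 1)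
    rw [e] at hab' ⊢
    exact ms_vanish_ne hφ hN h00 ha0 hab'
  · exact ms_vanish_ne hφ hN h00 hb hab

end Vanishing

section Lin
variable {W : Type*} [NormedAddCommGroup W] [NormedSpace ℂ W]

/-- A norm preserving linear map has no nontrivial unipotent blocks. -/
lemma isometry_unip {y : Module.End ℂ W} (hy : ∀ v, ‖y v‖ = ‖v‖) {u w : W} (hw : y w = w)
    (hu : y u = u + w) : w = 0 := by
  have h : ∀ n : ℕ, (y ^ n) u = u + (n : ℂ) • w ∧ ‖(y ^ n) u‖ = ‖u‖ := by
    intro n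
    induction n with
    | zero => simp
    | succ n ih =>
      constructor
      · rw [pow_succ', Module.End.mul_apply, ih.1, map_add, hu, map_smul, hw]
        push_cast
        rw [add_smul, one_smul]; abel
      · rw [pow_succ', Module.End.mul_apply, hy, ih.2]
  by_contra hne
  have hpos : 0 < ‖w‖ := norm_pos_iff.2 hne
  obtain ⟨n, hn⟩ := exists_nat_gt (2 * ‖u‖ / ‖w‖)
  rw [div_lt_iff₀ hpos] at hn
  have h1 : (n : ℂ) • w = (y ^ n) u - u := by rw [(h n).1]; abel
  have h2 : ‖(n : ℂ) • w‖ ≤ 2 * ‖u‖ := by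
    rw [h1]
    refine (norm_sub_le _ _).trans ?_
    rw [(h n).2]; linarith
  rw [norm_smul, Complex.norm_natCast] at h2
  linarith

variable [FiniteDimensional ℂ W]

lemma exists_eig (Z : Submodule ℂ W) (hZ : Z ≠ ⊥) (f : Module.End ℂ W) (hf : ∀ v ∈ Z, f v ∈ Z) :
    ∃ v ∈ Z, v ≠ 0 ∧ ∃ μ : ℂ, f v = μ • v := by
  have : Nontrivial Z := Submodule.nontrivial_iff_ne_bot.2 hZ
  obtain ⟨μ, hμ⟩ := Module.End.exists_eigenvalue (f.restrict hf)
  obtain ⟨v, hv⟩ := hμ.exists_hasEigenvector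
  refine ⟨v, v.2, ?_, μ, ?_⟩
  · intro h; exact hv.2 (Subtype.ext h)
  · have := congrArg Subtype.val hv.apply_eq_smul
    simpa using this

lemma exists_eig2 (Z : Submodule ℂ W) (hZ : Z ≠ ⊥) (f g : Module.End ℂ W) (hf : ∀ v ∈ Z, f v ∈ Z)
    (hg : ∀ v ∈ Z, g v ∈ Z) (hfg : f * g = g * f) :
    ∃ v ∈ Z, v ≠ 0 ∧ ∃ μ ν : ℂ, f v = μ • v ∧ g v = ν • v := by
  obtain ⟨v, hv, hv0, μ, hμ⟩ := exists_eig Z hZ f hf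
  have hfg' : ∀ v, f (g v) = g (f v) := fun v => congrArg (fun h => h v) hfg
  let Y : Submodule ℂ W := Z ⊓ LinearMap.ker (f - μ • 1)
  have hY : ∀ w, w ∈ Y ↔ w ∈ Z ∧ f w = μ • w := by
    intro w; simp [Y, sub_eq_zero]
  obtain ⟨w, hw, hw0, ν, hν⟩ := exists_eig Y (by
    intro h
    have : v ∈ Y := (hY v).2 ⟨hv, hμ⟩
    rw [h, Submodule.mem_bot] at this
    exact hv0 this) g (by
    intro w hw
    obtain ⟨h1, h2⟩ := (hY w).1 hw
    exact (hY _).2 ⟨hg w h1, by rw [hfg', h2, map_smul]⟩)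
  exact ⟨w, ((hY w).1 hw).1, hw0, μ, ν, ((hY w).1 hw).2, hν⟩

/-- Extracting a common eigenvector on which `f ^ q` acts nontrivially. -/
lemma exists_eig_nonunip (Z : Submodule ℂ W) (f g : Module.End ℂ W) (hf : ∀ v ∈ Z, f v ∈ Z)
    (hg : ∀ v ∈ Z, g v ∈ Z) (hfg : f * g = g * f) (hiso : ∀ v, ‖f v‖ = ‖v‖) (q : ℕ)
    (hu : ∃ u ∈ Z, (f ^ q) u ≠ u) :
    ∃ v ∈ Z, v ≠ 0 ∧ ∃ μ ν : ℂ, f v = μ • v ∧ g v = ν • v ∧ μ ^ q ≠ 1 := by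
  obtain ⟨u, huZ, hu⟩ := hu
  have hfq : ∀ n : ℕ, ∀ v ∈ Z, (f ^ n) v ∈ Z := by
    intro n
    induction n with
    | zero => simp
    | succ n ih => intro v hv; rw [pow_succ', Module.End.mul_apply]; exact hf _ (ih v hv)
  have hisoq : ∀ n : ℕ, ∀ v, ‖(f ^ n) v‖ = ‖v‖ := by
    intro n
    induction n with
    | zero => simp
    | succ n ih => intro v; rw [pow_succ', Module.End.mul_apply, hiso, ih v]
  have cf : f * f ^ q = f ^ q * f := (Commute.refl f).pow_right q
  have cg : g * f ^ q = f ^ q * g := (show Commute g f from hfg.symm).pow_right q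
  have cf' : ∀ v, f ((f ^ q) v) = (f ^ q) (f v) := fun v => congrArg (fun h => h v) cf
  have cg' : ∀ v, g ((f ^ q) v) = (f ^ q) (g v) := fun v => congrArg (fun h => h v) cg
  have hR : ∀ w, w ∈ Z.map (f ^ q - 1) ↔ ∃ u ∈ Z, (f ^ q) u - u = w := by
    intro w; rw [Submodule.mem_map]; rfl
  obtain ⟨v, hv, hv0, μ, ν, hμ, hν⟩ := exists_eig2 (Z.map (f ^ q - 1)) (by
    intro h
    have : (f ^ q) u - u ∈ Z.map (f ^ q - 1) := (hR _).2 ⟨u, huZ, rfl⟩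
    rw [h, Submodule.mem_bot, sub_eq_zero] at this
    exact hu this) f g (by
    intro w hw
    obtain ⟨x, hx, rfl⟩ := (hR w).1 hw
    exact (hR _).2 ⟨f x, hf x hx, by rw [map_sub, cf']⟩) (by
    intro w hw
    obtain ⟨x, hx, rfl⟩ := (hR w).1 hw
    exact (hR _).2 ⟨g x, hg x hx, by rw [map_sub, cg']⟩) hfg
  obtain ⟨x, hx, hxv⟩ := (hR v).1 hv
  refine ⟨v, ?_, hv0, μ, ν, hμ, hν, ?_⟩
  · rw [← hxv]; exact Z.sub_mem (hfq q x hx) hx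
  · intro h1
    have h2 : ∀ n : ℕ, (f ^ n) v = μ ^ n • v := by
      intro n
      induction n with
      | zero => simp
      | succ n ih => rw [pow_succ', Module.End.mul_apply, ih, map_smul, hμ, smul_smul, pow_succ]
    apply hv0
    apply isometry_unip (hisoq q) (u := x)
    · rw [h2 q, h1, one_smul]
    · rw [← hxv]; abel

end Lin

lemma roots_comparable {p k : ℕ} (hp : p.Prime) {a b : ℂ} (ha : a ^ p ^ k = 1) (hb : b ^ p ^ k = 1) :
    (∃ s : ℕ, a ^ s = b) ∨ ∃ s : ℕ, b ^ s = a := by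
  obtain ⟨i, hi, hai⟩ := (Nat.dvd_prime_pow hp).1 (orderOf_dvd_of_pow_eq_one ha)
  obtain ⟨j, hj, hbj⟩ := (Nat.dvd_prime_pow hp).1 (orderOf_dvd_of_pow_eq_one hb)
  have hgen : ∀ {a b : ℂ} {i j : ℕ}, orderOf a = p ^ i → orderOf b = p ^ j → j ≤ i →
      ∃ s : ℕ, a ^ s = b := by
    intro a b i j h1 h2 h
    have hprim := IsPrimitiveRoot.orderOf a
    rw [h1] at hprim
    have hb1 : b ^ p ^ i = 1 := by
      rw [← orderOf_dvd_iff_pow_eq_one, h2]; exact pow_dvd_pow p h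
    have : NeZero (p ^ i) := ⟨pow_ne_zero _ hp.ne_zero⟩
    obtain ⟨s, -, hs⟩ := hprim.eq_pow_of_pow_eq_one hb1
    exact ⟨s, hs⟩
  rcases le_total j i with h | h
  · exact Or.inl (hgen hai hbj h)
  · exact Or.inr (hgen hbj hai h)

/-- A representation of the Steinberg-type relations on `W`. -/
structure ESys (W : Type*) [NormedAddCommGroup W] [NormedSpace ℂ W] where
  /-- the operators -/
  Y : Fin 4 → Fin 4 → ℤ → Module.End ℂ W
  zero : ∀ i j, Y i j 0 = 1
  add : ∀ i j s t, Y i j (s + t) = Y i j s * Y i j t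
  rel : ∀ i j k, i ≠ j → j ≠ k → i ≠ k → ∀ s t, Y i j s * Y j k t = Y i k (s * t) * Y j k t * Y i j s
  comm : ∀ i j k l, j ≠ k → i ≠ l → ∀ s t, Y i j s * Y k l t = Y k l t * Y i j s
  iso : ∀ i j t v, ‖Y i j t v‖ = ‖v‖

namespace ESys
variable {W : Type*} [NormedAddCommGroup W] [NormedSpace ℂ W] (E : ESys W)

lemma rel' {i j k : Fin 4} (hij : i ≠ j) (hjk : j ≠ k) (hik : i ≠ k) (s t : ℤ) (v : W) :
    E.Y i j s (E.Y j k t v) = E.Y i k (s * t) (E.Y j k t (E.Y i j s v)) :=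
  congrArg (fun f => f v) (E.rel i j k hij hjk hik s t)

lemma comm' {i j k l : Fin 4} (hjk : j ≠ k) (hil : i ≠ l) (s t : ℤ) (v : W) :
    E.Y i j s (E.Y k l t v) = E.Y k l t (E.Y i j s v) :=
  congrArg (fun f => f v) (E.comm i j k l hjk hil s t)

lemma add' (i j : Fin 4) (s t : ℤ) (v : W) : E.Y i j s (E.Y i j t v) = E.Y i j (s + t) v := by
  rw [E.add]; rfl

lemma pow (i j : Fin 4) (n : ℕ) : E.Y i j n = E.Y i j 1 ^ n := by
  induction n with
  | zero => simpa using E.zero i j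
  | succ n ih => push_cast; rw [E.add, ih, pow_succ]

lemma neg_cancel (i j : Fin 4) (t : ℤ) (v : W) : E.Y i j (-t) (E.Y i j t v) = v := by
  rw [E.add', neg_add_cancel, E.zero]; rfl

lemma cancel_neg (i j : Fin 4) (t : ℤ) (v : W) : E.Y i j t (E.Y i j (-t) v) = v := by
  rw [E.add', add_neg_cancel, E.zero]; rfl

lemma ne_zero (i j : Fin 4) (t : ℤ) {v : W} (hv : v ≠ 0) : E.Y i j t v ≠ 0 := by
  rw [← norm_ne_zero_iff, E.iso]; exact norm_ne_zero_iff.2 hv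

lemma eig_pow {i j : Fin 4} {v : W} {μ : ℂ} (h : E.Y i j 1 v = μ • v) (n : ℕ) :
    E.Y i j n v = μ ^ n • v := by
  induction n with
  | zero => simp [E.zero]
  | succ n ih =>
    push_cast; rw [add_comm, ← E.add', ih, map_smul, h, smul_smul, pow_succ]

lemma eig_neg {i j : Fin 4} {v : W} {μ : ℂ} {n : ℤ} (h : E.Y i j n v = μ • v) :
    μ • E.Y i j (-n) v = v := by
  rw [← map_smul, ← h, E.neg_cancel]

lemma fix_mul {i j : Fin 4} {v : W} {n : ℤ} (h : E.Y i j n v = v) (t : ℤ) :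
    E.Y i j (t * n) v = v := by
  have hneg : E.Y i j (-n) v = v := by
    conv_lhs => rw [← h]
    exact E.neg_cancel _ _ _ _
  induction t using Int.induction_on with
  | zero => simp [E.zero]
  | succ m ih => rw [add_mul, one_mul, ← E.add', h, ih]
  | pred m ih => rw [sub_mul, one_mul, sub_eq_add_neg, ← E.add', hneg, ih]

variable [FiniteDimensional ℂ W]

theorem key {p k : ℕ} (hp : p.Prime) (hper : ∀ i j, E.Y i j ((p ^ (k + 1) : ℕ) : ℤ) = 1)
    (hne : E.Y 1 2 ((p ^ k : ℕ) : ℤ) ≠ 1) :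
    ∃ v : W, v ≠ 0 ∧ E.Y 0 1 1 v = v ∧ E.Y 0 2 1 v = v ∧ ∃ ζ : ℂ, E.Y 1 2 1 v = ζ • v ∧
      orderOf ζ = p ^ (k + 1) := by
  have : Fact p.Prime := ⟨hp⟩
  set q : ℕ := p ^ k with hq
  have root : ∀ {i j v} {μ : ℂ}, v ≠ 0 → E.Y i j 1 v = μ • v → μ ^ p ^ (k + 1) = 1 := by
    intro i j v μ hv h
    have h1 := E.eig_pow h (p ^ (k + 1))
    rw [hper] at h1
    by_contra h2
    have : (μ ^ p ^ (k + 1) - 1) • v = 0 := by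
      rw [sub_smul, ← h1]; simp
    rcases smul_eq_zero.1 this with h3 | h3
    · exact h2 (sub_eq_zero.1 h3)
    · exact hv h3
  -- it suffices to find a vector moved by `Y 1 2 q`
  have fin : (∃ u, E.Y 0 1 1 u = u ∧ E.Y 0 2 1 u = u ∧ E.Y 1 2 q u ≠ u) →
      ∃ v : W, v ≠ 0 ∧ E.Y 0 1 1 v = v ∧ E.Y 0 2 1 v = v ∧ ∃ ζ : ℂ, E.Y 1 2 1 v = ζ • v ∧
      orderOf ζ = p ^ (k + 1) := by
    rintro ⟨u, hu1, hu2, hu3⟩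
    let Z : Submodule ℂ W := LinearMap.ker (E.Y 0 1 1 - 1) ⊓ LinearMap.ker (E.Y 0 2 1 - 1)
    have hZ : ∀ w, w ∈ Z ↔ E.Y 0 1 1 w = w ∧ E.Y 0 2 1 w = w := by
      intro w; simp [Z, sub_eq_zero]
    obtain ⟨v, hv, hv0, μ, ν, hμ, -, hμq⟩ := exists_eig_nonunip Z (E.Y 1 2 1) 1 (by
      intro w hw
      obtain ⟨h1, h2⟩ := (hZ w).1 hw
      refine (hZ _).2 ⟨?_, ?_⟩
      · rw [E.rel' (by decide) (by decide) (by decide), h1, mul_one, E.comm' (by decide) (by decide), h2]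
      · rw [E.comm' (by decide) (by decide), h2]) (by intro w hw; exact hw) (by simp) (E.iso _ _ _) q
      ⟨u, (hZ u).2 ⟨hu1, hu2⟩, by rw [← E.pow]; exact hu3⟩
    obtain ⟨h1, h2⟩ := (hZ v).1 hv
    exact ⟨v, hv0, h1, h2, μ, hμ, orderOf_eq_prime_pow hμq (root hv0 hμ)⟩
  -- step 1
  obtain ⟨v1, -, hv1, β, α, hβ, hα, hβq⟩ := exists_eig_nonunip ⊤ (E.Y 1 2 1) (E.Y 0 2 1)
    (by simp) (by simp) (E.comm _ _ _ _ (by decide) (by decide) _ _) (E.iso _ _ _) q (by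
      by_contra hcon
      push Not at hcon
      apply hne
      ext w
      rw [E.pow]
      exact hcon w trivial)
  have hβo : orderOf β = p ^ (k + 1) := orderOf_eq_prime_pow hβq (root hv1 hβ)
  obtain ⟨s, hs⟩ : ∃ s : ℕ, β ^ s = α := by
    have hprim := IsPrimitiveRoot.orderOf β
    rw [hβo] at hprim
    have : NeZero (p ^ (k + 1)) := ⟨pow_ne_zero _ hp.ne_zero⟩
    obtain ⟨s, -, hs⟩ := hprim.eq_pow_of_pow_eq_one (root hv1 hα)
    exact ⟨s, hs⟩
  have hv2a : E.Y 0 2 1 (E.Y 1 0 s v1) = E.Y 1 0 s v1 := by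
    have h1 := E.rel' (i := 1) (j := 0) (k := 2) (by decide) (by decide) (by decide) s 1 v1
    have h2 : E.Y 1 2 (-(s : ℤ)) (E.Y 1 0 s (E.Y 0 2 1 v1)) = E.Y 0 2 1 (E.Y 1 0 s v1) := by
      rw [h1, mul_one, E.neg_cancel]
    have h3 := E.eig_pow hβ s
    rw [hs] at h3
    rw [← h2, hα, map_smul, map_smul, E.comm' (by decide) (by decide), ← map_smul, E.eig_neg h3]
  have hv2b : E.Y 1 2 1 (E.Y 1 0 s v1) = β • E.Y 1 0 s v1 := by
    rw [E.comm' (by decide) (by decide), hβ, map_smul]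
  -- step 2
  let Z : Submodule ℂ W := LinearMap.ker (E.Y 0 2 1 - 1) ⊓ LinearMap.ker (E.Y 1 2 1 - β • 1)
  have hZ : ∀ w, w ∈ Z ↔ E.Y 0 2 1 w = w ∧ E.Y 1 2 1 w = β • w := by
    intro w; simp [Z, sub_eq_zero]
  obtain ⟨v3, hv3Z, hv3, lam, ν, hlam, hν⟩ := exists_eig2 Z (by
    intro h
    have : E.Y 1 0 s v1 ∈ Z := (hZ _).2 ⟨hv2a, hv2b⟩
    rw [h, Submodule.mem_bot] at this
    exact E.ne_zero _ _ _ hv1 this) (E.Y 0 1 1) (E.Y 0 3 1) (by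
    intro w hw
    obtain ⟨h1, h2⟩ := (hZ w).1 hw
    refine (hZ _).2 ⟨by rw [E.comm' (by decide) (by decide), h1], ?_⟩
    have h3 := E.rel' (i := 0) (j := 1) (k := 2) (by decide) (by decide) (by decide) 1 1 w
    have h4 : E.Y 0 2 (-1) (E.Y 0 1 1 (E.Y 1 2 1 w)) = E.Y 1 2 1 (E.Y 0 1 1 w) := by
      rw [h3, mul_one, E.neg_cancel]
    have h5 : E.Y 0 2 (-1) w = w := by
      conv_lhs => rw [← h1]
      rw [E.neg_cancel]
    rw [← h4, h2, map_smul, map_smul, E.comm' (by decide) (by decide), h5]) (by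
    intro w hw
    obtain ⟨h1, h2⟩ := (hZ w).1 hw
    refine (hZ _).2 ⟨by rw [E.comm' (by decide) (by decide), h1], ?_⟩
    rw [E.comm' (by decide) (by decide), h2, map_smul]) (E.comm _ _ _ _ (by decide) (by decide) _ _)
  obtain ⟨h02, h12⟩ := (hZ v3).1 hv3Z
  rcases roots_comparable hp (root hv3 hν) (root hv3 hlam) with ⟨s, hs⟩ | ⟨s, hs⟩
  · -- `lam = ν ^ s`
    refine ⟨E.Y 1 3 (-(s : ℤ)) v3, E.ne_zero _ _ _ hv3, ?_, ?_, β, ?_, hβo⟩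
    · have h3 := E.eig_pow hν s
      rw [hs] at h3
      rw [E.rel' (by decide) (by decide) (by decide), one_mul, hlam, map_smul, map_smul,
        E.comm' (by decide) (by decide), ← map_smul, E.eig_neg h3]
    · rw [E.comm' (by decide) (by decide), h02]
    · rw [E.comm' (by decide) (by decide), h12, map_smul]
  · -- `ν = lam ^ s`
    obtain ⟨v4, hv4⟩ : ∃ v4, v4 = E.Y 3 1 (-(s : ℤ)) v3 := ⟨_, rfl⟩
    have hv40 : v4 ≠ 0 := by rw [hv4]; exact E.ne_zero _ _ _ hv3
    have w03 : E.Y 0 3 1 v4 = v4 := by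
      have h3 := E.eig_pow hlam s
      rw [hs] at h3
      rw [hv4, E.rel' (by decide) (by decide) (by decide), one_mul, hν, map_smul, map_smul,
        E.comm' (by decide) (by decide), ← map_smul, E.eig_neg h3]
    have w01 : E.Y 0 1 1 v4 = lam • v4 := by
      rw [hv4, E.comm' (by decide) (by decide), hlam, map_smul]
    have w02 : E.Y 0 2 1 v4 = v4 := by
      rw [hv4, E.comm' (by decide) (by decide), h02]
    obtain ⟨u, hu02, hu03, hu⟩ : ∃ u, E.Y 0 2 1 u = u ∧ E.Y 0 3 1 u = u ∧ E.Y 3 2 q u ≠ u := by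
      by_contra hcon
      push Not at hcon
      -- `u = Y 1 3 (-1) v4`
      have g1 : E.Y 3 2 q (E.Y 1 3 (-1) v4) = E.Y 1 3 (-1) v4 := by
        apply hcon
        · rw [E.comm' (by decide) (by decide), w02]
        · rw [E.comm' (by decide) (by decide), w03]
      have g2 : E.Y 3 2 q v4 = v4 := hcon _ w02 w03
      have g3 := E.rel' (i := 1) (j := 3) (k := 2) (by decide) (by decide) (by decide) 1 q (E.Y 1 3 (-1) v4)
      rw [g1, E.cancel_neg, g2, one_mul] at g3
      have g4 := E.rel' (i := 3) (j := 1) (k := 2) (by decide) (by decide) (by decide) (-(s : ℤ)) q v3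
      rw [E.eig_pow h12, map_smul, ← hv4, ← g3, E.fix_mul g2] at g4
      have : (β ^ q - 1) • v4 = 0 := by rw [sub_smul, g4]; simp
      rcases smul_eq_zero.1 this with h3 | h3
      · exact hβq (sub_eq_zero.1 h3)
      · exact hv40 h3
    apply fin
    refine ⟨E.Y 1 3 1 (E.Y 3 1 (-1) (E.Y 1 3 1 u)), ?_, ?_, ?_⟩
    · have a1 : E.Y 0 1 1 (E.Y 1 3 1 u) = E.Y 1 3 1 (E.Y 0 1 1 u) := by
        rw [E.rel' (by decide) (by decide) (by decide), one_mul, E.comm' (by decide) (by decide),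
          E.comm' (i := 0) (j := 3) (by decide) (by decide), hu03]
      rw [E.rel' (by decide) (by decide) (by decide), one_mul, E.comm' (i := 0) (j := 3) (by decide) (by decide),
        E.comm' (i := 0) (j := 1) (by decide) (by decide),
        E.rel' (i := 0) (j := 3) (by decide) (by decide) (by decide), E.comm' (i := 0) (j := 3) (k := 0) (by decide) (by decide),
        E.comm' (i := 0) (j := 3) (k := 1) (by decide) (by decide), hu03,
        E.comm' (i := 3) (j := 1) (k := 0) (l := 1) (by decide) (by decide), one_mul, E.neg_cancel]
    · rw [E.comm' (by decide) (by decide), E.comm' (i := 0) (j := 2) (by decide) (by decide),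
        E.comm' (i := 0) (j := 2) (by decide) (by decide), hu02]
    · intro hcon
      apply hu
      have c1 : E.Y 1 3 1 (E.Y 3 1 (-1) (E.Y 1 3 1 (E.Y 3 2 q u))) =
          E.Y 1 3 1 (E.Y 3 1 (-1) (E.Y 1 3 1 u)) := by
        rw [E.rel' (i := 1) (j := 3) (k := 2) (by decide) (by decide) (by decide) 1 q, one_mul,
          E.rel' (i := 3) (j := 1) (k := 2) (by decide) (by decide) (by decide) (-1) q,
          E.comm' (i := 3) (j := 1) (k := 3) (l := 2) (by decide) (by decide),
          E.comm' (i := 1) (j := 2) (k := 3) (l := 2) (by decide) (by decide), neg_one_mul,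
          E.neg_cancel, E.comm' (i := 1) (j := 3) (k := 1) (l := 2) (by decide) (by decide)]
        exact hcon
      have c2 := congrArg (E.Y 1 3 (-1)) c1
      rw [E.neg_cancel, E.neg_cancel] at c2
      have c3 := congrArg (E.Y 3 1 (- -1)) c2
      rw [E.neg_cancel, E.neg_cancel] at c3
      have c4 := congrArg (E.Y 1 3 (-1)) c3
      rwa [E.neg_cancel, E.neg_cancel] at c4
end ESys

section FiniteOrder
variable {W : Type*} [NormedAddCommGroup W] [NormedSpace ℂ W] [FiniteDimensional ℂ W]

/-- In a Heisenberg-type triple of isometries the central element has finite order. -/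
lemma heis_finite {X a b : Module.End ℂ W} (hX : ∀ v, ‖X v‖ = ‖v‖) (ha : ∀ v, ‖a v‖ = ‖v‖)
    (hb : ∀ v, ‖b v‖ = ‖v‖) (hab : a * b = X * b * a) (hXa : X * a = a * X) (hXb : X * b = b * X) :
    ∃ m : ℕ, 0 < m ∧ X ^ m = 1 := by
  have hab' : ∀ v, a (b v) = X (b (a v)) := fun v => congrArg (fun f => f v) hab
  have hXa' : ∀ v, X (a v) = a (X v) := fun v => congrArg (fun f => f v) hXa
  have hXb' : ∀ v, X (b v) = b (X v) := fun v => congrArg (fun f => f v) hXb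
  have unit_ne : ∀ {f : Module.End ℂ W} {v : W} {μ : ℂ}, (∀ v, ‖f v‖ = ‖v‖) → v ≠ 0 → f v = μ • v →
      μ ≠ 0 := by
    rintro f v μ hf hv h rfl
    rw [zero_smul] at h
    have := hf v
    rw [h, norm_zero] at this
    exact hv (norm_eq_zero.1 this.symm)
  have hroot : ∀ μ : ℂ, X.HasEigenvalue μ → ∃ m : ℕ, 0 < m ∧ μ ^ m = 1 := by
    intro μ hμ
    obtain ⟨v0, hv0⟩ := hμ.exists_hasEigenvector
    let Z : Submodule ℂ W := LinearMap.ker (X - μ • 1)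
    have hZ : ∀ w, w ∈ Z ↔ X w = μ • w := by
      intro w; simp [Z, sub_eq_zero]
    obtain ⟨v, hvZ, hv, lam, hlam⟩ := exists_eig Z (by
      intro h
      have : v0 ∈ Z := (hZ _).2 hv0.apply_eq_smul
      rw [h, Submodule.mem_bot] at this
      exact hv0.2 this) a (by
      intro w hw
      rw [hZ] at hw ⊢
      rw [hXa', hw, map_smul])
    rw [hZ] at hvZ
    have hn : ∀ n : ℕ, (b ^ n) v ≠ 0 ∧ X ((b ^ n) v) = μ • (b ^ n) v ∧
        a ((b ^ n) v) = (μ ^ n * lam) • (b ^ n) v := by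
      intro n
      induction n with
      | zero => exact ⟨by simpa using hv, by simpa using hvZ, by simpa using hlam⟩
      | succ n ih =>
        obtain ⟨h1, h2, h3⟩ := ih
        rw [pow_succ', Module.End.mul_apply]
        refine ⟨?_, ?_, ?_⟩
        · rw [← norm_ne_zero_iff, hb]; exact norm_ne_zero_iff.2 h1
        · rw [hXb', h2, map_smul]
        · rw [hab', h3, map_smul, map_smul, hXb', h2, map_smul, smul_smul]
          congr 1; ring
    have hμ0 : μ ≠ 0 := unit_ne hX hv hvZ
    have hlam0 : lam ≠ 0 := unit_ne ha hv hlam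
    have hfin : Set.Finite {c : ℂ | a.HasEigenvalue c} := Module.End.finite_hasEigenvalue a
    obtain ⟨n, -, n', -, hnn, heq⟩ := Set.infinite_univ.exists_ne_map_eq_of_mapsTo
      (f := fun n : ℕ => μ ^ n * lam) (t := {c : ℂ | a.HasEigenvalue c}) (by
        intro n _
        exact Module.End.hasEigenvalue_of_hasEigenvector
          ⟨Module.End.mem_eigenspace_iff.2 (hn n).2.2, (hn n).1⟩) hfin
    have heq' : μ ^ n = μ ^ n' := mul_right_cancel₀ hlam0 heq
    have hlt : ∀ {n n' : ℕ}, n < n' → μ ^ n = μ ^ n' → ∃ m : ℕ, 0 < m ∧ μ ^ m = 1 := by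
      intro n n' h h'
      refine ⟨n' - n, by omega, ?_⟩
      have h2 : n' = n + (n' - n) := by omega
      rw [h2, pow_add] at h'
      have h3 : μ ^ n * 1 = μ ^ n * μ ^ (n' - n) := by rw [mul_one]; exact h'
      exact (mul_left_cancel₀ (pow_ne_zero n hμ0) h3).symm
    rcases lt_or_gt_of_ne hnn with h | h
    · exact hlt h heq'
    · exact hlt h heq'.symm
  have hfin : Set.Finite {c : ℂ | X.HasEigenvalue c} := Module.End.finite_hasEigenvalue X
  choose! m hm using hroot
  have hmem : ∀ μ, μ ∈ hfin.toFinset ↔ X.HasEigenvalue μ := by intro μ; simp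
  refine ⟨∏ μ ∈ hfin.toFinset, m μ, Finset.prod_pos fun μ h => (hm μ ((hmem μ).1 h)).1, ?_⟩
  by_contra hcon
  obtain ⟨v, -, hv, μ, ν, hμ, -, hne⟩ := exists_eig_nonunip ⊤ X 1 (by simp) (by simp) (by simp) hX
    (∏ μ ∈ hfin.toFinset, m μ) (by
      by_contra h
      push Not at h
      exact hcon (LinearMap.ext fun w => h w trivial))
  have hev : X.HasEigenvalue μ := Module.End.hasEigenvalue_of_hasEigenvector
          ⟨Module.End.mem_eigenspace_iff.2 hμ, hv⟩
  obtain ⟨c, hc⟩ := Finset.dvd_prod_of_mem m ((hmem μ).2 hev)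
  rw [hc, pow_mul, (hm μ hev).2, one_pow] at hne
  exact hne rfl

lemma one_of_one_mul {Q : Type*} [Monoid Q] (ρ : EG →* Q) {i j : Fin 4} {n : ℤ}
    (h : ρ (el i j n) = 1) (t : ℤ) : ρ (el i j (n * t)) = 1 := by
  have hneg : ρ (el i j (-n)) = 1 := by
    have : ρ (el i j (-n)) * ρ (el i j n) = 1 := by
      rw [← map_mul, ← el_add, neg_add_cancel, el_zero, map_one]
    rwa [h, mul_one] at this
  induction t using Int.induction_on with
  | zero => simp [el_zero]
  | succ m ih => rw [mul_add, mul_one, el_add, map_mul, h, ih, mul_one]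
  | pred m ih => rw [mul_sub, mul_one, sub_eq_add_neg, el_add, map_mul, hneg, ih, mul_one]

lemma exists_third (i j : Fin 4) : ∃ k : Fin 4, k ≠ i ∧ k ≠ j := by
  revert i j; decide

lemma finite_order (ρ : EG →* Module.End ℂ W) (hρ : ∀ g v, ‖ρ g v‖ = ‖v‖) :
    ∃ M : ℕ, 0 < M ∧ ∀ i j t, ρ (el i j (M * t)) = 1 := by
  have h1 : ∀ i j, ∃ m : ℕ, 0 < m ∧ ρ (el i j m) = 1 := by
    intro i j
    by_cases hij : i = j
    · subst hij; exact ⟨1, one_pos, by rw [el_self, map_one]⟩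
    obtain ⟨k, hki, hkj⟩ := exists_third i j
    obtain ⟨m, hm, h⟩ := heis_finite (X := ρ (el i j 1)) (a := ρ (el i k 1)) (b := ρ (el k j 1))
      (hρ _) (hρ _) (hρ _)
      (by rw [← map_mul, el_rel hki.symm hkj hij, map_mul, map_mul, one_mul])
      (by rw [← map_mul, el_comm (Ne.symm hij) hki.symm, map_mul])
      (by rw [← map_mul, el_comm hkj.symm hij, map_mul])
    refine ⟨m, hm, ?_⟩
    rw [← map_pow, el_pow, mul_one] at h
    exact h
  choose m hm h using h1
  refine ⟨∏ i, ∏ j, m i j, Finset.prod_pos fun i _ => Finset.prod_pos fun j _ => hm i j, ?_⟩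
  intro i j t
  have hd : m i j ∣ ∏ i, ∏ j, m i j :=
    (Finset.dvd_prod_of_mem (m i) (Finset.mem_univ j)).trans
      (Finset.dvd_prod_of_mem (fun i => ∏ j, m i j) (Finset.mem_univ i))
  obtain ⟨c, hc⟩ := hd
  rw [hc]
  push_cast
  rw [mul_assoc]
  exact one_of_one_mul ρ (h i j) _

end FiniteOrder

section Commuting
variable {Q : Type*} [Group Q] {φ : EG →* Q} {N : ℤ}

lemma per_eq {Q : Type*} [Monoid Q] {φ : EG →* Q} {N : ℤ} (hφ : ∀ i j t, φ (el i j (N * t)) = 1)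
    {s t : ℤ} (h : N ∣ s - t) (i j : Fin 4) : φ (el i j s) = φ (el i j t) := by
  obtain ⟨c, hc⟩ := h
  have : s = N * c + t := by linarith
  rw [this, el_add, map_mul, hφ, one_mul]

lemma per_one {Q : Type*} [Monoid Q] {φ : EG →* Q} {N : ℤ} (hφ : ∀ i j t, φ (el i j (N * t)) = 1)
    {s : ℤ} (h : N ∣ s) (i j : Fin 4) : φ (el i j s) = 1 := by
  obtain ⟨c, rfl⟩ := h
  exact hφ i j c

lemma comm_orth (hφ : ∀ i j t, φ (el i j (N * t)) = 1) {e f : ℤ} (he : N ∣ e * e - e)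
    (hef : N ∣ e * f) (i j k l : Fin 4) (s t : ℤ) :
    Commute (φ (el i j (f * s))) (φ (el k l (e * t))) := by
  by_cases hij : i = j
  · subst hij; rw [el_self, map_one]; exact Commute.one_left _
  have h1 : ∀ (k l : Fin 4) (t : ℤ), ¬ (j = k ∧ i = l) →
      Commute (φ (el i j (f * s))) (φ (el k l (e * t))) := by
    intro k l t hne
    by_cases hkl : k = l
    · subst hkl; rw [el_self, map_one]; exact Commute.one_right _
    unfold Commute SemiconjBy
    by_cases hjk : j = k
    · have hil : i ≠ l := fun h => hne ⟨hjk, h⟩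
      subst hjk
      rw [← map_mul, el_rel hij hkl hil, map_mul, map_mul, per_one hφ, one_mul]
      have : f * s * (e * t) = e * f * (s * t) := by ring
      rw [this]; exact Dvd.dvd.mul_right hef _
    · by_cases hil : i = l
      · subst hil
        rw [← map_mul φ (el k i _), el_rel hkl hij (Ne.symm hjk), map_mul, map_mul,
          per_one hφ (s := e * t * (f * s)), one_mul]
        have : e * t * (f * s) = e * f * (s * t) := by ring
        rw [this]; exact Dvd.dvd.mul_right hef _
      · rw [← map_mul, el_comm hjk hil, map_mul]
  by_cases hopp : j = k ∧ i = l
  · obtain ⟨rfl, rfl⟩ := hopp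
    obtain ⟨m, hmi, hmj⟩ := exists_third i j
    have h2 := congrArg φ (el_rel hmj.symm hmi (Ne.symm hij) (e * t) (e * 1))
    rw [map_mul, map_mul, map_mul] at h2
    have h3 : φ (el j i (e * t * (e * 1))) = φ (el j i (e * t)) := by
      apply per_eq hφ
      have : e * t * (e * 1) - e * t = (e * e - e) * t := by ring
      rw [this]; exact Dvd.dvd.mul_right he _
    rw [h3] at h2
    have h4 : φ (el j i (e * t)) = φ (el j m (e * t)) * φ (el m i (e * 1)) * (φ (el j m (e * t)))⁻¹ *
        (φ (el m i (e * 1)))⁻¹ := by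
      rw [h2]; group
    have c1 := h1 j m t (fun h => hmi h.2.symm)
    have c2 := h1 m i 1 (fun h => hmj h.1.symm)
    rw [h4]
    exact ((c1.mul_right c2).mul_right c1.inv_right).mul_right c2.inv_right
  · exact h1 k l t hopp

end Commuting

section EHelper
namespace ESys
variable {W : Type*} [NormedAddCommGroup W] [NormedSpace ℂ W] (E : ESys W)

lemma mul_inv (i j : Fin 4) (t : ℤ) : E.Y i j t * E.Y i j (-t) = 1 := by
  rw [← E.add, add_neg_cancel, E.zero]

lemma move_left {q : ℤ} {i j k : Fin 4} (hjk : j ≠ k) (hik : i ≠ k) (h : E.Y j k q = 1) :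
    E.Y i k q = 1 := by
  by_cases hij : i = j
  · subst hij; exact h
  have h1 := E.rel i j k hij hjk hik 1 q
  rw [h, mul_one, mul_one, one_mul] at h1
  have h2 := congrArg (fun f => f * E.Y i j (-1)) h1
  simp only [mul_assoc, E.mul_inv, mul_one] at h2
  exact h2.symm

lemma move_right {q : ℤ} {i j k : Fin 4} (hij : i ≠ j) (hik : i ≠ k) (h : E.Y i j q = 1) :
    E.Y i k q = 1 := by
  by_cases hjk : j = k
  · subst hjk; exact h
  have h1 := E.rel i j k hij hjk hik q 1
  rw [h, mul_one, one_mul, mul_one] at h1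
  have h2 := congrArg (fun f => f * E.Y j k (-1)) h1
  simp only [mul_assoc, E.mul_inv, mul_one] at h2
  exact h2.symm

lemma all_one {q : ℤ} (h : E.Y 1 2 q = 1) {i j : Fin 4} (hij : i ≠ j) : E.Y i j q = 1 := by
  by_cases hi : i = 2
  · subst hi
    by_cases hj : j = 1
    · subst hj
      have h1 : E.Y 3 2 q = 1 := E.move_left (by decide) (by decide) h
      have h2 : E.Y 3 1 q = 1 := E.move_right (by decide) (by decide) h1
      exact E.move_left (by decide) (by decide) h2
    · have h1 : E.Y 1 j q = 1 := E.move_right (by decide) (Ne.symm hj) h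
      exact E.move_left (Ne.symm hj) hij h1
  · have h1 : E.Y i 2 q = 1 := E.move_left (by decide) hi h
    exact E.move_right hi hij h1

end ESys
end EHelper

section Rep
variable {V : Type*} [NormedAddCommGroup V] [NormedSpace ℂ V]

/-- The restriction of a representation to an `e`-invariant subspace. -/
def restSys (σ : EG →* Module.End ℂ V) (hσ : ∀ g v, ‖σ g v‖ = ‖v‖) {N : ℤ}
    (hN : ∀ i j t, σ (el i j (N * t)) = 1) {e : ℤ} (he : N ∣ e * e - e) (W : Submodule ℂ V)
    (hW : ∀ i j t, ∀ w ∈ W, σ (el i j (e * t)) w ∈ W) : ESys W where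
  Y i j t := (σ (el i j (e * t))).restrict (hW i j t)
  zero i j := by
    ext w; simp [el_zero]
  add i j s t := by
    ext w; simp [mul_add, el_add]
  rel i j k hij hjk hik s t := by
    ext w
    have h1 := congrArg σ (el_rel hij hjk hik (e * s) (e * t))
    have h2 : σ (el i k (e * s * (e * t))) = σ (el i k (e * (s * t))) := by
      apply per_eq hN
      have : e * s * (e * t) - e * (s * t) = (e * e - e) * (s * t) := by ring
      rw [this]; exact Dvd.dvd.mul_right he _
    rw [map_mul, map_mul, map_mul, h2] at h1
    exact congrArg (fun f => f (w : V)) h1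
  comm i j k l hjk hil s t := by
    ext w
    have h1 := congrArg σ (el_comm hjk hil (e * s) (e * t))
    rw [map_mul, map_mul] at h1
    exact congrArg (fun f => f (w : V)) h1
  iso i j t v := hσ _ _

variable (σ : EG →* Module.End ℂ V)

lemma units_ext_apply (g h : EG) (hc : Commute (σ.toHomUnits g) (σ.toHomUnits h)) (v : V) :
    σ g (σ h v) = σ h (σ g v) := by
  have h1 := congrArg Units.val hc.eq
  rw [Units.val_mul, Units.val_mul] at h1
  exact congrArg (fun f => f v) h1

lemma units_per {N : ℤ} (hN : ∀ i j t, σ (el i j (N * t)) = 1) (i j : Fin 4) (t : ℤ) :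
    σ.toHomUnits (el i j (N * t)) = 1 := Units.ext (hN i j t)

lemma inv_closure {e : ℤ} (W : Submodule ℂ V) (hW : ∀ i j t, ∀ w ∈ W, σ (el i j (e * t)) w ∈ W)
    {h : EG} (hh : h ∈ Subgroup.closure {g : EG | ∃ i j t, g = el i j (e * t)}) :
    (∀ w ∈ W, σ h w ∈ W) ∧ (∀ w ∈ W, σ h⁻¹ w ∈ W) := by
  induction hh using Subgroup.closure_induction with
  | mem x hx =>
    obtain ⟨i, j, t, rfl⟩ := hx
    refine ⟨hW i j t, ?_⟩
    rw [← el_neg, ← mul_neg]; exact hW i j (-t)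
  | one => simp
  | mul x y hx hy h1 h2 =>
    refine ⟨fun w hw => ?_, fun w hw => ?_⟩
    · rw [map_mul]; exact h1.1 _ (h2.1 _ hw)
    · rw [_root_.mul_inv_rev, map_mul]; exact h2.2 _ (h1.2 _ hw)
  | inv x hx h1 => rw [inv_inv]; exact ⟨h1.2, h1.1⟩

lemma decomp {Q : Type*} [Group Q] {φ : EG →* Q} {N : ℤ} (hφ : ∀ i j t, φ (el i j (N * t)) = 1)
    {e : ℤ} (he : N ∣ e * e - e) (g : EG) :
    ∃ h ∈ Subgroup.closure {g : EG | ∃ i j t, g = el i j (e * t)}, ∃ c : EG,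
      (∀ h ∈ Subgroup.closure {g : EG | ∃ i j t, g = el i j (e * t)}, Commute (φ c) (φ h)) ∧
      φ g = φ c * φ h := by
  induction g using EG_induction with
  | h1 => exact ⟨1, one_mem _, 1, by simp, by simp⟩
  | hel i j t =>
    refine ⟨el i j (e * t), Subgroup.subset_closure ⟨i, j, t, rfl⟩, el i j ((1 - e) * t), ?_, ?_⟩
    · intro h hh
      induction hh using Subgroup.closure_induction with
      | mem x hx =>
        obtain ⟨k, l, s, rfl⟩ := hx
        apply comm_orth hφ he
        have : e * (1 - e) = - (e * e - e) := by ring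
        rw [this]; exact (dvd_neg).2 he
      | one => rw [map_one]; exact Commute.one_right _
      | mul x y hx hy h1 h2 => rw [map_mul]; exact h1.mul_right h2
      | inv x hx h1 => rw [map_inv]; exact h1.inv_right
    · rw [← map_mul, ← el_add]; congr 2; ring
  | hmul a b ha hb =>
    obtain ⟨h, hh, c, hc, h1⟩ := ha
    obtain ⟨h', hh', c', hc', h1'⟩ := hb
    refine ⟨h * h', mul_mem hh hh', c * c', ?_, ?_⟩
    · intro k hk; rw [map_mul]; exact (hc k hk).mul_left (hc' k hk)
    · rw [map_mul, map_mul, map_mul, h1, h1']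
      have := (hc' h hh).eq
      calc φ c * φ h * (φ c' * φ h') = φ c * (φ h * φ c') * φ h' := by group
        _ = φ c * (φ c' * φ h) * φ h' := by rw [this]
        _ = _ := by group
  | hinv a ha =>
    obtain ⟨h, hh, c, hc, h1⟩ := ha
    refine ⟨h⁻¹, inv_mem hh, c⁻¹, ?_, ?_⟩
    · intro k hk; rw [map_inv]; exact (hc k hk).inv_left
    · rw [map_inv, map_inv, map_inv, h1, _root_.mul_inv_rev]
      exact ((hc h hh).inv_left.inv_right).eq.symm

lemma fix_mult {i j : Fin 4} {n : ℤ} {v : V} (h : σ (el i j n) v = v) (t : ℤ) :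
    σ (el i j (n * t)) v = v := by
  have hneg : σ (el i j (-n)) v = v := by
    have : σ (el i j (-n)) (σ (el i j n) v) = v := by
      rw [← Module.End.mul_apply, ← map_mul, ← el_add, neg_add_cancel, el_zero, map_one]; rfl
    rwa [h] at this
  induction t using Int.induction_on with
  | zero => simp [el_zero]
  | succ m ih => rw [mul_add, mul_one, el_add, map_mul, Module.End.mul_apply, h, ih]
  | pred m ih =>
    rw [mul_sub, mul_one, sub_eq_add_neg, el_add, map_mul, Module.End.mul_apply, hneg, ih]

/-- Minimality forces nontriviality of the `p`-part. -/
lemma nontriv {N : ℕ} (hN : ∀ i j t, σ (el i j ((N : ℤ) * t)) = 1)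
    (hmin : ∀ n : ℕ, 0 < n → n < N → ∀ v : V,
      (∀ g i j t, σ (el i j ((n : ℤ) * t)) (σ g v) = σ g v) → v = 0)
    {p k M : ℕ} (hp : p.Prime) (hM : 0 < M) (hNp : N = p ^ (k + 1) * M) {e : ℤ} (he1 : ((p ^ (k + 1) : ℕ) : ℤ) ∣ e - 1)
    (he0 : (M : ℤ) ∣ e) {W : Submodule ℂ V} (hW0 : W ≠ ⊥)
    (hW : ∀ i j t, ∀ w ∈ W, σ (el i j (e * t)) w ∈ W)
    (htriv : ∀ i j, i ≠ j → ∀ w ∈ W, σ (el i j (e * ((p ^ k : ℕ) : ℤ))) w = w) : False := by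
  apply hW0
  rw [Submodule.eq_bot_iff]
  intro w hw
  have he : (N : ℤ) ∣ e * e - e := by
    have : e * e - e = (e - 1) * e := by ring
    rw [this, hNp]; push_cast
    exact mul_dvd_mul (by exact_mod_cast he1) he0
  apply hmin (p ^ k * M) (Nat.mul_pos (pow_pos hp.pos _) hM) _ w
  · intro g i j t
    by_cases hij : i = j
    · subst hij; rw [el_self, map_one]; rfl
    obtain ⟨h, hh, c, hc, hg⟩ := decomp (units_per σ hN) he g
    have hg' : σ g w = σ c (σ h w) := by
      have := congrArg Units.val hg
      rw [Units.val_mul] at this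
      exact congrArg (fun f => f w) this
    have h1 : σ (el i j (e * ((p ^ k : ℕ) : ℤ))) (σ g w) = σ g w := by
      rw [hg', ← units_ext_apply σ c _ (hc _ (Subgroup.subset_closure ⟨i, j, _, rfl⟩)),
        htriv i j hij _ ((inv_closure σ W hW hh).1 w hw)]
    have h2 := fix_mult σ h1 (M * t)
    rw [per_eq hN (t := e * ((p ^ k : ℕ) : ℤ) * (M * t))]
    · exact h2
    · have h3 : (p : ℤ) ∣ e - 1 := dvd_trans (by push_cast; exact dvd_pow_self _ (by omega)) he1
      obtain ⟨c, hc⟩ := h3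
      refine ⟨-c * t, ?_⟩
      have : e = p * c + 1 := by linarith
      rw [hNp, this]; push_cast; ring
  · rw [hNp, pow_succ]
    have : 0 < p ^ k * M := Nat.mul_pos (pow_pos hp.pos _) hM
    nlinarith [hp.two_le]

variable [FiniteDimensional ℂ V]

theorem coprime_step (hσ : ∀ g v, ‖σ g v‖ = ‖v‖) {N : ℕ} (hNpos : 0 < N)
    (hN : ∀ i j t, σ (el i j ((N : ℤ) * t)) = 1)
    (hmin : ∀ n : ℕ, 0 < n → n < N → ∀ v : V,
      (∀ g i j t, σ (el i j ((n : ℤ) * t)) (σ g v) = σ g v) → v = 0) (d : ℕ) :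
    ∀ (d' : ℕ) (e : ℤ), N = d * d' → (d : ℤ) ∣ e - 1 → (d' : ℤ) ∣ e → ∀ W : Submodule ℂ V, W ≠ ⊥ →
      (∀ i j t, ∀ w ∈ W, σ (el i j (e * t)) w ∈ W) →
      ∃ v ∈ W, v ≠ 0 ∧ ∃ ζ : ℂ, σ (el 0 1 e) v = v ∧ σ (el 0 2 e) v = v ∧ σ (el 1 2 e) v = ζ • v ∧
        orderOf ζ = d := by
  induction d using Nat.recOnPosPrimePosCoprime with
  | zero => intro d' e h; omega
  | one =>
    intro d' e h _ h0 W hW0 hW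
    rw [one_mul] at h
    obtain ⟨v, hv, hv0⟩ := Submodule.exists_mem_ne_zero_of_ne_bot hW0
    subst h
    refine ⟨v, hv, hv0, 1, ?_, ?_, ?_, orderOf_one⟩ <;> rw [per_one hN h0] <;> simp
  | prime_pow p n hp hn =>
    obtain ⟨k, rfl⟩ : ∃ k, n = k + 1 := ⟨n - 1, by omega⟩
    intro d' e h h1 h0 W hW0 hW
    have he : (N : ℤ) ∣ e * e - e := by
      have : e * e - e = (e - 1) * e := by ring
      rw [this, h, Nat.cast_mul]
      exact mul_dvd_mul h1 h0
    have hd' : 0 < d' := Nat.pos_of_ne_zero (by rintro rfl; omega)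
    let E := restSys σ hσ hN he W hW
    have hE : ∀ i j t (w : W), ((E.Y i j t w : W) : V) = σ (el i j (e * t)) w := fun _ _ _ _ => rfl
    obtain ⟨v, hv0, a1, a2, ζ, a3, a4⟩ := E.key hp (k := k) (by
      intro i j
      ext w
      rw [hE, per_one hN]
      · rfl
      · rw [h, Nat.cast_mul, mul_comm]; exact mul_dvd_mul h0 dvd_rfl) (by
      intro hcon
      refine nontriv σ hN hmin hp hd' h h1 h0 hW0 hW ?_
      intro i j hij w hw
      have := E.all_one hcon hij
      have := congrArg (fun f => ((f ⟨w, hw⟩ : W) : V)) this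
      exact this)
    refine ⟨v, v.2, fun h => hv0 (Subtype.ext h), ζ, ?_, ?_, ?_, a4⟩
    · have := congrArg Subtype.val a1; rwa [hE, mul_one] at this
    · have := congrArg Subtype.val a2; rwa [hE, mul_one] at this
    · have := congrArg Subtype.val a3; rwa [hE, mul_one] at this
  | coprime a b ha hb hab iha ihb =>
    intro d' e h h1 h0 W hW0 hW
    obtain ⟨r, s, hrs⟩ := (Nat.isCoprime_iff_coprime.2 hab)
    -- r * a + s * b = 1
    obtain ⟨x, hx⟩ := h1
    obtain ⟨y, hy⟩ := h0
    push_cast at hx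
    have hxe : e = a * b * x + 1 := by linarith
    obtain ⟨v1, hv1, hv10, ζ, a1, a2, a3, a4⟩ := iha (b * d') (e * (s * b)) (by rw [h]; ring)
      ⟨b * x * (s * b) - r, by rw [hxe]; linear_combination hrs⟩
      ⟨y * s, by rw [hy]; push_cast; ring⟩ W hW0 (by
        intro i j t w hw; rw [mul_assoc e]; exact hW i j _ w hw)
    let W' : Submodule ℂ V := W ⊓ LinearMap.ker (σ (el 0 1 (e * (s * b))) - 1) ⊓
      LinearMap.ker (σ (el 0 2 (e * (s * b))) - 1) ⊓ LinearMap.ker (σ (el 1 2 (e * (s * b))) - ζ • 1)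
    have hW' : ∀ w, w ∈ W' ↔ w ∈ W ∧ σ (el 0 1 (e * (s * b))) w = w ∧ σ (el 0 2 (e * (s * b))) w = w ∧
        σ (el 1 2 (e * (s * b))) w = ζ • w := by
      intro w; simp [W', sub_eq_zero, and_assoc]
    have hidem : (N : ℤ) ∣ (e * (s * b)) * (e * (s * b)) - e * (s * b) := by
      refine ⟨y * s * (b * x * (s * b) - r), ?_⟩
      have h3 : e * (s * b) - 1 = a * (b * x * (s * b) - r) := by rw [hxe]; linear_combination hrs
      calc _ = (e * (s * b)) * (e * (s * b) - 1) := by ring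
        _ = (e * (s * b)) * (a * (b * x * (s * b) - r)) := by rw [h3]
        _ = (d' * y * (s * b)) * (a * (b * x * (s * b) - r)) := by rw [hy]
        _ = _ := by rw [h]; push_cast; ring
    have horth : (N : ℤ) ∣ (e * (s * b)) * (e * (r * a)) :=
      ⟨y * s * e * r, by rw [h]; push_cast; nth_rewrite 1 [hy]; ring⟩
    have hcomm : ∀ i j k l t w, σ (el i j (e * (r * a) * t)) (σ (el k l (e * (s * b))) w) =
        σ (el k l (e * (s * b))) (σ (el i j (e * (r * a) * t)) w) := by
      intro i j k l t w
      apply units_ext_apply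
      have := comm_orth (units_per σ hN) hidem horth i j k l t 1
      rwa [mul_one] at this
    obtain ⟨v, hv, hv0, ξ, b1, b2, b3, b4⟩ := ihb (a * d') (e * (r * a)) (by rw [h]; ring)
      ⟨a * x * (r * a) - s, by rw [hxe]; linear_combination hrs⟩
      ⟨y * r, by rw [hy]; push_cast; ring⟩ W' (by
        intro hbot
        have : v1 ∈ W' := (hW' _).2 ⟨hv1, a1, a2, a3⟩
        rw [hbot, Submodule.mem_bot] at this
        exact hv10 this) (by
        intro i j t w hw
        obtain ⟨c0, c1, c2, c3⟩ := (hW' w).1 hw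
        refine (hW' _).2 ⟨?_, ?_, ?_, ?_⟩
        · rw [mul_assoc e]; exact hW i j _ w c0
        · rw [← hcomm, c1]
        · rw [← hcomm, c2]
        · rw [← hcomm, c3, map_smul])
    obtain ⟨c0, c1, c2, c3⟩ := (hW' v).1 hv
    have hsum : e = e * (s * b) + e * (r * a) := by linear_combination -e * hrs
    refine ⟨v, c0, hv0, ζ * ξ, ?_, ?_, ?_, ?_⟩
    · rw [hsum, el_add, map_mul, Module.End.mul_apply, b1, c1]
    · rw [hsum, el_add, map_mul, Module.End.mul_apply, b2, c2]
    · rw [hsum, el_add, map_mul, Module.End.mul_apply, b3, map_smul, c3, smul_smul, mul_comm]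
    · rw [(Commute.all ζ ξ).orderOf_mul_eq_mul_orderOf_of_coprime (by rw [a4, b4]; exact hab), a4, b4]

end Rep

section Final
variable {V : Type*} [NormedAddCommGroup V] [InnerProductSpace ℂ V]

lemma eig_zpow (σ : EG →* Module.End ℂ V) {i j : Fin 4} {v : V} {ζ : ℂ} (hζ : ζ ≠ 0)
    (h : σ (el i j 1) v = ζ • v) (t : ℤ) : σ (el i j t) v = ζ ^ t • v := by
  have hneg : σ (el i j (-1)) v = ζ⁻¹ • v := by
    have h1 : σ (el i j (-1)) (σ (el i j 1) v) = v := by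
      rw [← Module.End.mul_apply, ← map_mul, ← el_add, neg_add_cancel, el_zero, map_one]; rfl
    rw [h, map_smul] at h1
    rw [← h1, smul_smul, inv_mul_cancel₀ hζ, one_smul, h1]
  induction t using Int.induction_on with
  | zero => simp [el_zero]
  | succ m ih =>
    rw [el_add, map_mul, Module.End.mul_apply, h, map_smul, ih, smul_smul, zpow_add_one₀ hζ, mul_comm]
  | pred m ih =>
    rw [sub_eq_add_neg, el_add, map_mul, Module.End.mul_apply, hneg, map_smul, ih, smul_smul,
      ← sub_eq_add_neg, zpow_sub_one₀ hζ, mul_comm]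

lemma invariant_of_vec (σ : EG →* Module.End ℂ V) (hσ : ∀ g u v, inner ℂ (σ g u) (σ g v) = inner ℂ u v)
    {N : ℕ} (hNpos : 0 < N) (hN : ∀ i j t, σ (el i j ((N : ℤ) * t)) = 1) {v : V} (hv : v ≠ 0) {ζ : ℂ}
    (h01 : σ (el 0 1 1) v = v) (h02 : σ (el 0 2 1) v = v) (h12 : σ (el 1 2 1) v = ζ • v)
    (hζ : orderOf ζ = N) : ∃ w : V, w ≠ 0 ∧ ∀ A : SL2, σ (io A) w = w := by
  have : NeZero N := ⟨hNpos.ne'⟩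
  have hζN : ζ ^ N = 1 := by rw [← hζ]; exact pow_orderOf_eq_one ζ
  have hζ0 : ζ ≠ 0 := by
    rintro rfl
    rw [zero_pow hNpos.ne'] at hζN
    exact zero_ne_one hζN
  have hζdvd : ∀ t : ℤ, ζ ^ t = 1 → (N : ℤ) ∣ t := by
    intro t ht
    rw [← hζ]
    have h := (IsPrimitiveRoot.orderOf ζ).zpow_eq_one_iff_dvd t
    exact h.1 ht
  have hnorm : (starRingEnd ℂ) ζ * ζ = 1 := by
    have h1 : ‖ζ‖ = 1 := Complex.norm_eq_one_of_pow_eq_one hζN hNpos.ne'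
    rw [mul_comm, Complex.mul_conj, Complex.normSq_eq_norm_sq, h1]; simp
  have hcsp : ∀ A : SL2, IsG N A → σ (io A) = 1 := by
    intro A hA
    have := csp (units_per σ hN) (by exact_mod_cast hNpos.ne') hA
    exact congrArg Units.val this
  -- the orbit is finite
  have hfac : ∀ A B : SL2, (∀ i j, ((m2 A i j : ℤ) : ZMod N) = ((m2 B i j : ℤ) : ZMod N)) →
      σ (io A) v = σ (io B) v := by
    intro A B hAB
    have hd : ∀ i j, (N : ℤ) ∣ m2 A i j - m2 B i j := by
      intro i j
      rw [← ZMod.intCast_zmod_eq_zero_iff_dvd, Int.cast_sub, hAB, sub_self]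
    have hG : IsG N (B⁻¹ * A) := by
      have hdet := m2_det B
      obtain ⟨x, hx⟩ := hd 0 0
      obtain ⟨y, hy⟩ := hd 0 1
      obtain ⟨z, hz⟩ := hd 1 0
      obtain ⟨t, ht⟩ := hd 1 1
      refine ⟨⟨m2 B 1 1 * x - m2 B 0 1 * z, ?_⟩, ⟨m2 B 1 1 * y - m2 B 0 1 * t, ?_⟩,
        ⟨- m2 B 1 0 * x + m2 B 0 0 * z, ?_⟩, ⟨- m2 B 1 0 * y + m2 B 0 0 * t, ?_⟩⟩ <;>
        simp only [m2_mul, m2_inv_00, m2_inv_01, m2_inv_10, m2_inv_11]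
      · linear_combination m2 B 1 1 * hx - m2 B 0 1 * hz + hdet
      · linear_combination m2 B 1 1 * hy - m2 B 0 1 * ht
      · linear_combination - m2 B 1 0 * hx + m2 B 0 0 * hz
      · linear_combination - m2 B 1 0 * hy + m2 B 0 0 * ht + hdet
    have h1 : A = B * (B⁻¹ * A) := by group
    rw [h1, map_mul, map_mul, hcsp _ hG, mul_one]
  have hfin : (Set.range fun A : SL2 => σ (io A) v).Finite := by
    let red : SL2 → (Fin 2 → Fin 2 → ZMod N) := fun A i j => ((m2 A i j : ℤ) : ZMod N)
    have hft : Function.FactorsThrough (fun A : SL2 => σ (io A) v) red := by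
      intro A B hAB
      exact hfac A B fun i j => congrFun (congrFun hAB i) j
    obtain ⟨f, hf⟩ := (Function.factorsThrough_iff _).1 hft
    rw [hf]
    exact (Set.finite_range f).subset (Set.range_comp_subset_range _ _)
  have hmem : ∀ u, u ∈ hfin.toFinset ↔ ∃ A : SL2, σ (io A) v = u := by intro u; simp
  have hinj : ∀ g, Function.Injective (σ g) := by
    intro g x y hxy
    have h1 : ∀ z, σ g⁻¹ (σ g z) = z := by
      intro z
      rw [← Module.End.mul_apply, ← map_mul, inv_mul_cancel, map_one]; rfl
    rw [← h1 x, hxy, h1]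
  refine ⟨∑ u ∈ hfin.toFinset, u, ?_, ?_⟩
  · intro hzero
    have h1 : inner ℂ (∑ u ∈ hfin.toFinset, u) v = inner ℂ v v := by
      rw [sum_inner]
      apply Finset.sum_eq_single v
      · intro u hu hne
        obtain ⟨A, rfl⟩ := (hmem u).1 hu
        by_contra hin
        apply hne
        have hcol : ∀ s t : ℤ, σ (el 0 2 (m2 A 0 0 * s + m2 A 0 1 * t))
            (σ (el 1 2 (m2 A 1 0 * s + m2 A 1 1 * t)) (σ (io A) v)) = ζ ^ t • σ (io A) v := by
          intro s t
          have h1 := congrArg (fun g => σ g v) (io_col2 A s t)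
          simp only [map_mul, Module.End.mul_apply] at h1
          rw [← h1, eig_zpow σ hζ0 h12, map_smul]
          have h2 := fix_mult σ h02 s
          rw [one_mul] at h2
          rw [h2, map_smul]
        have hdet := m2_det A
        have hc : (N : ℤ) ∣ m2 A 1 0 := by
          have h1 := hcol (m2 A 1 1) (- m2 A 1 0)
          have e1 : m2 A 0 0 * m2 A 1 1 + m2 A 0 1 * -m2 A 1 0 = 1 := by linarith
          have e2 : m2 A 1 0 * m2 A 1 1 + m2 A 1 1 * -m2 A 1 0 = 0 := by ring
          rw [e1, e2, el_zero, map_one, Module.End.one_apply] at h1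
          have h2 := hσ (el 0 2 1) (σ (io A) v) v
          rw [h1, h02, inner_smul_left] at h2
          have h3 := mul_right_cancel₀ hin (h2.trans (one_mul _).symm)
          have h4 := (map_eq_one_iff (starRingEnd ℂ) (starRingEnd ℂ).injective).1 h3
          exact (dvd_neg).1 (hζdvd _ h4)
        have ha : (N : ℤ) ∣ m2 A 0 0 - 1 := by
          have h1 := hcol (- m2 A 0 1) (m2 A 0 0)
          have e1 : m2 A 0 0 * -m2 A 0 1 + m2 A 0 1 * m2 A 0 0 = 0 := by ring
          have e2 : m2 A 1 0 * -m2 A 0 1 + m2 A 1 1 * m2 A 0 0 = 1 := by linarith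
          rw [e1, e2, el_zero, map_one, Module.End.one_apply] at h1
          have h2 := hσ (el 1 2 1) (σ (io A) v) v
          rw [h1, h12, inner_smul_left, inner_smul_right, ← mul_assoc] at h2
          have h3 := mul_right_cancel₀ hin (h2.trans (one_mul _).symm)
          apply hζdvd
          have h5 : (starRingEnd ℂ) (ζ ^ m2 A 0 0) = (starRingEnd ℂ) ζ :=
            mul_right_cancel₀ hζ0 (h3.trans hnorm.symm)
          rw [zpow_sub_one₀ hζ0, (starRingEnd ℂ).injective h5, mul_inv_cancel₀ hζ0]
        have hG : IsG N (A * up (- m2 A 0 1)) := by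
          obtain ⟨x, hx⟩ := ha
          obtain ⟨y, hy⟩ := hc
          refine ⟨⟨x, ?_⟩, ⟨- m2 A 0 1 * x, ?_⟩, ⟨y, ?_⟩, ⟨- m2 A 1 1 * x, ?_⟩⟩ <;>
            simp only [m2_mul, up, mk2_00, mk2_01, mk2_10, mk2_11]
          · linear_combination hx
          · linear_combination - m2 A 0 1 * hx
          · linear_combination hy
          · linear_combination - m2 A 1 1 * hx + hdet
        have h6 : σ (io (up (- m2 A 0 1))) v = v := by
          rw [io_up]
          have := fix_mult σ h01 (- m2 A 0 1)
          rwa [one_mul] at this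
        have h7 := congrArg (fun f => f v) (hcsp _ hG)
        simp only [map_mul, Module.End.mul_apply, h6, Module.End.one_apply] at h7
        exact h7
      · intro h
        exact absurd ((hmem v).2 ⟨1, by simp⟩) h
    rw [hzero, inner_zero_left] at h1
    exact hv (inner_self_eq_zero.1 h1.symm)
  · intro B
    rw [map_sum]
    apply Finset.sum_bij (fun u _ => σ (io B) u)
    · intro u hu
      obtain ⟨A, rfl⟩ := (hmem u).1 hu
      exact (hmem _).2 ⟨B * A, by rw [map_mul, map_mul]; rfl⟩
    · intro u _ u' _ h
      exact hinj _ h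
    · intro u hu
      obtain ⟨A, rfl⟩ := (hmem u).1 hu
      refine ⟨σ (io (B⁻¹ * A)) v, (hmem _).2 ⟨_, rfl⟩, ?_⟩
      rw [← Module.End.mul_apply, ← map_mul, ← map_mul, mul_inv_cancel_left]
    · intro u _; rfl

variable [FiniteDimensional ℂ V] [Nontrivial V]

theorem exists_invariant (ρ : EG →* Module.End ℂ V)
    (hρ : ∀ g u v, inner ℂ (ρ g u) (ρ g v) = inner ℂ u v) :
    ∃ w : V, w ≠ 0 ∧ ∀ A : SL2, ρ (io A) w = w := by
  classical
  have hiso : ∀ g v, ‖ρ g v‖ = ‖v‖ := by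
    intro g v
    rw [@norm_eq_sqrt_re_inner ℂ, @norm_eq_sqrt_re_inner ℂ _ _ _ _ v, hρ]
  obtain ⟨M, hM, hMt⟩ := finite_order ρ hiso
  let P : ℕ → Prop := fun n => 0 < n ∧ ∃ v : V, v ≠ 0 ∧
    ∀ g i j t, ρ (el i j ((n : ℤ) * t)) (ρ g v) = ρ g v
  have hex : ∃ n, P n := by
    obtain ⟨v, hv⟩ := exists_ne (0 : V)
    exact ⟨M, hM, v, hv, by intro g i j t; rw [hMt]; rfl⟩
  obtain ⟨N, ⟨hNpos, v0, hv0, hv0N⟩, hmin⟩ : ∃ N, P N ∧ ∀ n < N, ¬ P n :=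
    ⟨Nat.find hex, Nat.find_spec hex, fun n h => Nat.find_min hex h⟩
  let U : Submodule ℂ V :=
    { carrier := {v | ∀ g i j t, ρ (el i j ((N : ℤ) * t)) (ρ g v) = ρ g v}
      add_mem' := by
        intro a b ha hb g i j t
        rw [map_add, map_add, ha, hb]
      zero_mem' := by intro g i j t; simp
      smul_mem' := by
        intro c a ha g i j t
        rw [map_smul, map_smul, ha] }
  have hU : ∀ v, v ∈ U ↔ ∀ g i j t, ρ (el i j ((N : ℤ) * t)) (ρ g v) = ρ g v := fun v => Iff.rfl
  have hUinv : ∀ g, ∀ v ∈ U, ρ g v ∈ U := by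
    intro g v hv h i j t
    have := hv (h * g) i j t
    rwa [map_mul, Module.End.mul_apply] at this
  let σ : EG →* Module.End ℂ U :=
    { toFun := fun g => (ρ g).restrict (hUinv g)
      map_one' := by ext w; simp
      map_mul' := by intro a b; ext w; simp }
  have hσ : ∀ g (u : U), ((σ g u : U) : V) = ρ g u := fun _ _ => rfl
  have hσN : ∀ i j t, σ (el i j ((N : ℤ) * t)) = 1 := by
    intro i j t
    ext w
    rw [hσ]
    have := w.2 1 i j t
    rwa [map_one, Module.End.one_apply] at this
  obtain ⟨v, -, hv, ζ, h1, h2, h3, h4⟩ := coprime_step σ (fun g v => hiso g v) hNpos hσN (by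
    intro n hn hnN v hv
    by_contra hne
    refine hmin n hnN ⟨hn, v, fun h => hne (Subtype.ext h), ?_⟩
    intro g i j t
    exact congrArg Subtype.val (hv g i j t)) N 1 1 (by simp) (by simp) (by simp) ⊤ (by
      intro htop
      have : (⟨v0, hv0N⟩ : U) ∈ (⊤ : Submodule ℂ U) := trivial
      rw [htop, Submodule.mem_bot] at this
      exact hv0 (congrArg Subtype.val this)) (by simp)
  obtain ⟨w, hw, hwA⟩ := invariant_of_vec σ (fun g u v => hρ g u v) hNpos hσN hv h1 h2 h3 h4
  exact ⟨w, fun h => hw (Subtype.ext h), fun A => congrArg Subtype.val (hwA A)⟩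

end Final

theorem main_thm {V : Type*} [NormedAddCommGroup V] [InnerProductSpace ℂ V]
    [FiniteDimensional ℂ V] [Nontrivial V]
    (ρ : Matrix.SpecialLinearGroup (Fin 4) ℤ →* unitary (V →L[ℂ] V)) :
    ‖((ρ (iota S) : unitary (V →L[ℂ] V)) : V →L[ℂ] V)
      + (((ρ (iota S))⁻¹ : unitary (V →L[ℂ] V)) : V →L[ℂ] V)
      + ((ρ (iota T) : unitary (V →L[ℂ] V)) : V →L[ℂ] V)
      + (((ρ (iota T))⁻¹ : unitary (V →L[ℂ] V)) : V →L[ℂ] V)‖ = 4 := by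
  have hadj : ∀ x : unitary (V →L[ℂ] V), ∀ v, (x⁻¹ : unitary (V →L[ℂ] V)).1 (x.1 v) = v := by
    intro x v
    have h := congrArg (fun y : unitary (V →L[ℂ] V) => y.1 v) (inv_mul_cancel x)
    exact h
  have hinner : ∀ x : unitary (V →L[ℂ] V), ∀ u v, inner ℂ (x.1 u) (x.1 v) = inner ℂ u v := by
    intro x u v
    rw [← ContinuousLinearMap.adjoint_inner_right]
    congr 1
    have h := congrArg (fun y : V →L[ℂ] V => y v) (Unitary.star_mul_self_of_mem x.2)
    exact h
  have hnle : ∀ x : unitary (V →L[ℂ] V), ‖x.1‖ ≤ 1 := by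
    intro x
    refine ContinuousLinearMap.opNorm_le_bound _ zero_le_one fun v => ?_
    rw [one_mul, @norm_eq_sqrt_re_inner ℂ, hinner, ← @norm_eq_sqrt_re_inner ℂ]
  let ρ' : EG →* Module.End ℂ V :=
    { toFun := fun g => ((ρ g.1).1 : V →L[ℂ] V).toLinearMap
      map_one' := by ext v; simp
      map_mul' := by intro a b; ext v; simp }
  obtain ⟨w, hw, hA⟩ := exists_invariant ρ' (fun g u v => hinner (ρ g.1) u v)
  have hS : (ρ (iota S)).1 w = w := hA S
  have hT : (ρ (iota T)).1 w = w := hA T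
  have hS' : ((ρ (iota S))⁻¹ : unitary (V →L[ℂ] V)).1 w = w := by
    have := hadj (ρ (iota S)) w; rwa [hS] at this
  have hT' : ((ρ (iota T))⁻¹ : unitary (V →L[ℂ] V)).1 w = w := by
    have := hadj (ρ (iota T)) w; rwa [hT] at this
  apply le_antisymm
  · refine (norm_add_le _ _).trans ?_
    refine (add_le_add ((norm_add_le _ _).trans (add_le_add (norm_add_le _ _) le_rfl)) le_rfl).trans ?_
    linarith [hnle (ρ (iota S)), hnle (ρ (iota S))⁻¹, hnle (ρ (iota T)), hnle (ρ (iota T))⁻¹]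
  · have hpos : 0 < ‖w‖ := norm_pos_iff.2 hw
    refine le_of_mul_le_mul_right ?_ hpos
    refine le_trans (le_of_eq ?_) (ContinuousLinearMap.le_opNorm _ w)
    simp only [ContinuousLinearMap.add_apply]
    rw [hS, hT, hS', hT']
    have : w + w + w + w = (4 : ℂ) • w := by module
    rw [this, norm_smul]; simp

end SLProof

theorem stmt2 {V : Type*} [NormedAddCommGroup V] [InnerProductSpace ℂ V]
    [FiniteDimensional ℂ V] [Nontrivial V]
    (ρ : Matrix.SpecialLinearGroup (Fin 4) ℤ →* unitary (V →L[ℂ] V)) :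
    ‖((ρ (iota S) : unitary (V →L[ℂ] V)) : V →L[ℂ] V)
      + (((ρ (iota S))⁻¹ : unitary (V →L[ℂ] V)) : V →L[ℂ] V)
      + ((ρ (iota T) : unitary (V →L[ℂ] V)) : V →L[ℂ] V)
      + (((ρ (iota T))⁻¹ : unitary (V →L[ℂ] V)) : V →L[ℂ] V)‖ = 4 := by
  exact SLProof.main_thm ρ
end

section
/- For every N ≥ 1, every finite-dimensional complex representation φ of SL₄(ℤ/Nℤ) on a nonzero complex vector space contains a nonzero vector that is fixed by φ(ι_N(g)) for every g ∈ SL₂(ℤ/Nℤ). -/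
open Matrix

namespace S5

section Elem
variable {R : Type*} [CommRing R]

/-- elementary matrices in SL₄ (junk value 1 on the diagonal) -/
def el (i j : Fin 4) (x : R) : Matrix.SpecialLinearGroup (Fin 4) R :=
  if h : i ≠ j then ⟨transvection i j x, det_transvection_of_ne i j h x⟩ else 1

lemma el_coe {i j : Fin 4} (h : i ≠ j) (x : R) :
    ((el i j x : Matrix.SpecialLinearGroup (Fin 4) R) : Matrix (Fin 4) (Fin 4) R)
      = transvection i j x := by
  simp [el, h]

lemma el_add {i j : Fin 4} (h : i ≠ j) (x y : R) : el i j (x + y) = el i j x * el i j y := by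
  apply Subtype.ext
  simp only [Matrix.SpecialLinearGroup.coe_mul]
  rw [el_coe h, el_coe h, el_coe h, transvection_mul_transvection_same i j h]

lemma el_zero {i j : Fin 4} : el i j (0 : R) = 1 := by
  by_cases h : i = j
  · simp [el, h]
  · apply Subtype.ext
    rw [el_coe h]; simp

lemma el_comm {i j k l : Fin 4} (h : i ≠ j) (h' : k ≠ l) (h1 : j ≠ k) (h2 : l ≠ i) (x y : R) :
    el i j x * el k l y = el k l y * el i j x := by
  apply Subtype.ext
  simp only [Matrix.SpecialLinearGroup.coe_mul]
  rw [el_coe h, el_coe h']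
  simp [transvection, Matrix.add_mul, Matrix.mul_add, h1, h2]
  abel

lemma el_nat {i j : Fin 4} (h : i ≠ j) (x : R) (n : ℕ) : el i j (n * x) = el i j x ^ n := by
  induction n with
  | zero => simp [el_zero]
  | succ n ih => rw [Nat.cast_succ, add_mul, one_mul, el_add h, ih, pow_succ]

/-- e_ij(x) e_jk(y) = e_jk(y) e_ij(x) e_ik(xy) -/
lemma el_rel {i j k : Fin 4} (h1 : i ≠ j) (h2 : j ≠ k) (h3 : i ≠ k) (x y : R) :
    el i j x * el j k y = el j k y * (el i j x * el i k (x * y)) := by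
  apply Subtype.ext
  simp only [Matrix.SpecialLinearGroup.coe_mul]
  rw [el_coe h1, el_coe h2, el_coe h3]
  simp [transvection, Matrix.add_mul, Matrix.mul_add, h1.symm, h3.symm]
  abel

/-- e_jk(y) e_ij(x) = e_ij(x) e_jk(y) e_ik(-xy) -/
lemma el_rel' {i j k : Fin 4} (h1 : i ≠ j) (h2 : j ≠ k) (h3 : i ≠ k) (x y : R) :
    el j k y * el i j x = el i j x * (el j k y * el i k (-(x * y))) := by
  apply Subtype.ext
  simp only [Matrix.SpecialLinearGroup.coe_mul]
  rw [el_coe h1, el_coe h2, el_coe h3]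
  simp [transvection, Matrix.add_mul, Matrix.mul_add, h1.symm, h3.symm]
  abel_nf
  simp [← single_neg]

lemma iota_coe (A : Matrix.SpecialLinearGroup (Fin 2) R) :
    ((iota A : Matrix.SpecialLinearGroup (Fin 4) R) : Matrix (Fin 4) (Fin 4) R)
      = !![A.1 0 0, A.1 0 1, 0, 0; A.1 1 0, A.1 1 1, 0, 0; 0, 0, 1, 0; 0, 0, 0, 1] := by
  ext i j
  fin_cases i <;> fin_cases j <;> rfl

lemma tv (i j : Fin 4) (x : R) : transvection i j x
    = Matrix.of fun a b => (if a = b then 1 else 0) + (if i = a ∧ j = b then x else 0) := by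
  ext a b
  simp [transvection, Matrix.one_apply, Matrix.single_apply]

lemma iota_mul (A B : Matrix.SpecialLinearGroup (Fin 2) R) : iota (A * B) = iota A * iota B := by
  apply Subtype.ext
  simp only [Matrix.SpecialLinearGroup.coe_mul, iota_coe]
  ext i j
  fin_cases i <;> fin_cases j <;>
    simp [Matrix.mul_apply, Fin.sum_univ_succ]

lemma iota_one : iota (1 : Matrix.SpecialLinearGroup (Fin 2) R) = 1 := by
  apply Subtype.ext
  simp only [Matrix.SpecialLinearGroup.coe_one, iota_coe]
  ext i j
  fin_cases i <;> fin_cases j <;> simp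

lemma det2 (A : Matrix.SpecialLinearGroup (Fin 2) R) :
    A.1 0 0 * A.1 1 1 - A.1 0 1 * A.1 1 0 = 1 := by
  rw [← Matrix.det_fin_two]; exact A.2

/-- conjugation of first-row elements -/
lemma conj_row0 (A : Matrix.SpecialLinearGroup (Fin 2) R) (k : Fin 4) (hk : k = 2 ∨ k = 3) :
    el 0 k 1 * iota A = iota A * (el 0 k (A.1 1 1) * el 1 k (-A.1 1 0)) := by
  have h := det2 A
  apply Subtype.ext
  simp only [Matrix.SpecialLinearGroup.coe_mul, iota_coe]
  have h0 : (0 : Fin 4) ≠ k := by rcases hk with rfl | rfl <;> decide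
  have h1 : (1 : Fin 4) ≠ k := by rcases hk with rfl | rfl <;> decide
  rw [el_coe h0, el_coe h0, el_coe h1, tv, tv, tv]
  ext i j
  rcases hk with rfl | rfl <;>
  fin_cases i <;> fin_cases j <;>
    simp [Matrix.mul_apply, Fin.sum_univ_succ] <;>
    first | linear_combination -h | linear_combination (0 : R) * h

lemma conj_row1 (A : Matrix.SpecialLinearGroup (Fin 2) R) :
    el 1 2 1 * iota A = iota A * (el 0 2 (-A.1 0 1) * el 1 2 (A.1 0 0)) := by
  have h := det2 A
  apply Subtype.ext
  simp only [Matrix.SpecialLinearGroup.coe_mul, iota_coe]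
  rw [el_coe (by decide), el_coe (by decide), el_coe (by decide), tv, tv, tv]
  ext i j
  fin_cases i <;> fin_cases j <;>
    simp [Matrix.mul_apply, Fin.sum_univ_succ] <;>
    first | linear_combination -h | linear_combination (0 : R) * h

/-- decomposition of `iota A` when the lower right entry is a unit -/
lemma iota_decomp (A : Matrix.SpecialLinearGroup (Fin 2) R) (u : R) (hu : A.1 1 1 * u = 1) :
    iota A = el 0 1 ((A.1 0 1 + (A.1 1 1 - 1)) * u) * (el 0 1 (-1) * (el 1 0 (A.1 1 1 - 1) *
      (el 0 1 1 * (el 1 0 (-((A.1 1 1 - 1) * u)) * el 1 0 (A.1 1 0 * u))))) := by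
  have h := det2 A
  rw [← el_add (by decide)]
  apply Subtype.ext
  simp only [Matrix.SpecialLinearGroup.coe_mul, iota_coe]
  rw [el_coe (by decide), el_coe (by decide), el_coe (by decide), el_coe (by decide),
    el_coe (by decide), tv, tv, tv, tv, tv]
  ext i j
  fin_cases i <;> fin_cases j <;>
    simp [Matrix.mul_apply, Fin.sum_univ_succ] <;> 
    generalize A.1 0 0 = a at * <;> generalize A.1 0 1 = b at * <;>
    generalize A.1 1 0 = c at * <;> generalize A.1 1 1 = d at *
  all_goals grind

/-- upper unipotent element of SL₂ -/
def u2 (x : R) : Matrix.SpecialLinearGroup (Fin 2) R := ⟨!![1, x; 0, 1], by simp⟩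

lemma iota_u2 (x : R) : iota (u2 x) = el 0 1 x := by
  apply Subtype.ext
  rw [iota_coe, el_coe (by decide), tv]
  ext i j
  fin_cases i <;> fin_cases j <;> simp [u2]

/-- a signed transposition of coordinates 0 and 3 -/
def sg : Matrix.SpecialLinearGroup (Fin 4) R :=
  ⟨!![0, 0, 0, 1; 0, 1, 0, 0; 0, 0, 1, 0; -1, 0, 0, 0], by
    simp [Matrix.det_succ_row_zero, Fin.sum_univ_succ, Fin.succAbove]
    norm_num⟩

lemma sg_coe : ((sg : Matrix.SpecialLinearGroup (Fin 4) R) : Matrix (Fin 4) (Fin 4) R) =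
  !![0, 0, 0, 1; 0, 1, 0, 0; 0, 0, 1, 0; -1, 0, 0, 0] := rfl

lemma sg_rel : el 0 2 (1 : R) * sg = sg * el 3 2 1 ∧ el 1 3 (1 : R) * sg = sg * el 1 0 (-1) ∧
    el 0 3 (1 : R) * sg = sg * el 3 0 (-1) ∧ el 1 2 (1 : R) * sg = sg * el 1 2 1 := by
  refine ⟨?_, ?_, ?_, ?_⟩ <;>
  · apply Subtype.ext
    simp only [Matrix.SpecialLinearGroup.coe_mul, sg_coe]
    repeat rw [el_coe (by decide)]
    simp only [tv]
    ext i j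
    fin_cases i <;> fin_cases j <;>
      simp [Matrix.mul_apply, Fin.sum_univ_succ]

end Elem

section Eigen
variable {V : Type*} [AddCommGroup V] [Module ℂ V]

lemma eigen_exists [FiniteDimensional ℂ V] (X : Submodule ℂ V) (T : Module.End ℂ V) (hT : ∀ x ∈ X, T x ∈ X)
    (v : V) (hv : v ∈ X) (hv0 : v ≠ 0) : ∃ (ν : ℂ) (w : V), w ∈ X ∧ w ≠ 0 ∧ T w = ν • w := by
  have : Nontrivial X := ⟨⟨⟨v, hv⟩, 0, fun h => hv0 (congrArg Subtype.val h)⟩⟩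
  obtain ⟨ν, hν⟩ := Module.End.exists_eigenvalue (LinearMap.restrict T hT)
  obtain ⟨w, hw⟩ := hν.exists_hasEigenvector
  refine ⟨ν, w, w.2, fun h => hw.2 (Subtype.ext h), ?_⟩
  have := congrArg Subtype.val hw.apply_eq_smul
  simpa using this

lemma unip_trivial (U : Module.End ℂ V) (q : ℕ) (hq : q ≠ 0) (hU : U ^ q = 1) (x : V)
    (h : U (U x - x) = U x - x) : U x = x := by
  have key : ∀ j : ℕ, (U ^ j) x = x + (j : ℂ) • (U x - x) := by
    intro j
    induction j with
    | zero => simp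
    | succ j ih =>
      rw [pow_succ', Module.End.mul_apply, ih, map_add, map_smul, h]
      push_cast
      module
  have h1 := key q
  rw [hU] at h1
  have h2 : (q : ℂ) • (U x - x) = 0 := by simpa using h1
  rcases smul_eq_zero.1 h2 with h3 | h3
  · exact absurd (Nat.cast_eq_zero.1 h3) hq
  · exact sub_eq_zero.1 h3

lemma pow_eig (T : Module.End ℂ V) (ν : ℂ) (w : V) (h : T w = ν • w) (r : ℕ) :
    (T ^ r) w = ν ^ r • w := by
  induction r with
  | zero => simp
  | succ r ih => rw [pow_succ', Module.End.mul_apply, ih, map_smul, h, smul_smul, pow_succ]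

lemma eigen_ne [FiniteDimensional ℂ V] (X : Submodule ℂ V) (T : Module.End ℂ V) (hT : ∀ x ∈ X, T x ∈ X)
    (q r : ℕ) (hq : q ≠ 0) (hTq : T ^ q = 1)
    (v : V) (hv : v ∈ X) (hv0 : (T ^ r) v ≠ v) :
    ∃ (ν : ℂ) (w : V), w ∈ X ∧ w ≠ 0 ∧ T w = ν • w ∧ ν ^ r ≠ 1 := by
  have hTr : ∀ r : ℕ, ∀ x ∈ X, (T ^ r) x ∈ X := by
    intro r
    induction r with
    | zero => intro x hx; simpa using hx
    | succ r ih => intro x hx; rw [pow_succ', Module.End.mul_apply]; exact hT _ (ih x hx)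
  obtain ⟨ν, w, hw, hw0, hwν⟩ := eigen_exists (X.map (T ^ r - 1)) T (by
    rintro _ ⟨x, hx, rfl⟩
    refine ⟨T x, hT x hx, ?_⟩
    simp only [LinearMap.sub_apply, Module.End.one_apply, map_sub]
    rw [← Module.End.mul_apply, ← pow_succ, pow_succ', Module.End.mul_apply])
    ((T ^ r - 1) v) ⟨v, hv, rfl⟩ (by
      simpa [sub_eq_zero] using hv0)
  obtain ⟨x, hx, rfl⟩ := hw
  refine ⟨ν, _, ?_, hw0, hwν, ?_⟩
  · simp only [LinearMap.sub_apply, Module.End.one_apply]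
    exact X.sub_mem (hTr r x hx) hx
  · intro h1
    apply hw0
    have h2 := pow_eig T ν _ hwν r
    rw [h1, one_smul] at h2
    simp only [LinearMap.sub_apply, Module.End.one_apply] at h2 ⊢
    rw [sub_eq_zero]
    apply unip_trivial (T ^ r) q hq _ x h2
    rw [← pow_mul, mul_comm, pow_mul, hTq, one_pow]

/-- averaging operator -/
noncomputable def avg (q : ℕ) (l : ℂ) (T : Module.End ℂ V) : Module.End ℂ V :=
  ∑ i ∈ Finset.range q, (l⁻¹ • T) ^ i

lemma avg_eig (q : ℕ) (l ν : ℂ) (T : Module.End ℂ V) (hl : l ^ q = 1) (hν : ν ^ q = 1)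
    (f : V) (h : T f = ν • f) : avg q l T f = (if ν = l then (q : ℂ) else 0) • f := by
  have h1 : ∀ i, ((l⁻¹ • T) ^ i) f = (l⁻¹ * ν) ^ i • f := by
    intro i
    apply pow_eig
    rw [LinearMap.smul_apply, h, smul_smul]
  rcases Nat.eq_zero_or_pos q with rfl | hq
  · simp [avg]
  have hl0 : l ≠ 0 := by
    rintro rfl
    rw [zero_pow hq.ne'] at hl
    exact zero_ne_one hl
  rw [avg, LinearMap.sum_apply, Finset.sum_congr rfl (fun i _ => h1 i), ← Finset.sum_smul]
  congr 1
  split_ifs with h2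
  · subst h2
    simp [inv_mul_cancel₀ hl0]
  · have h3 : l⁻¹ * ν - 1 ≠ 0 := by
      intro h3
      apply h2
      field_simp at h3
      exact sub_eq_zero.1 (by simpa using h3)
    have h4 := geom_sum_mul (l⁻¹ * ν) q
    rw [mul_pow, inv_pow, hl, hν, inv_one, one_mul, sub_self] at h4
    exact (mul_eq_zero.1 h4).resolve_right h3

end Eigen

section Rep
variable {V : Type*} [AddCommGroup V] [Module ℂ V] 
variable {R : Type*} [CommRing R]
variable (ρ : Matrix.SpecialLinearGroup (Fin 4) R →* Module.End ℂ V)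

lemma rho_inj (g : Matrix.SpecialLinearGroup (Fin 4) R) (v w : V) (h : ρ g v = ρ g w) : v = w := by
  have := congrArg (ρ g⁻¹) h
  rwa [← Module.End.mul_apply, ← Module.End.mul_apply, ← map_mul, inv_mul_cancel, map_one] at this

lemma rho_mul (g h : Matrix.SpecialLinearGroup (Fin 4) R) (v : V) :
    ρ (g * h) v = ρ g (ρ h v) := by
  rw [map_mul, Module.End.mul_apply]

lemma rho_ne (g : Matrix.SpecialLinearGroup (Fin 4) R) (v : V) (h : v ≠ 0) : ρ g v ≠ 0 := by
  intro h1
  exact h (rho_inj ρ g v 0 (by rw [h1, map_zero]))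

/-- transport of an eigenvector equation through a conjugation relation -/
lemma tr_eig {g h h' : Matrix.SpecialLinearGroup (Fin 4) R} (hr : h * g = g * h') {v : V} {ν : ℂ}
    (hv : ρ h' v = ν • v) : ρ h (ρ g v) = ν • ρ g v := by
  rw [← rho_mul, hr, rho_mul, hv, map_smul]

lemma tr_fix {g h h' : Matrix.SpecialLinearGroup (Fin 4) R} (hr : h * g = g * h') {v : V}
    (hv : ρ h' v = v) : ρ h (ρ g v) = ρ g v := by
  rw [← rho_mul, hr, rho_mul, hv]

lemma el_eig {i j : Fin 4} (h : i ≠ j) (x : R) (n : ℕ) (v : V) (ν : ℂ)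
    (hv : ρ (el i j x) v = ν • v) : ρ (el i j (n * x)) v = ν ^ n • v := by
  rw [el_nat h, map_pow]; exact pow_eig _ _ _ hv n

lemma el_fix {i j : Fin 4} (h : i ≠ j) (x : R) (n : ℕ) (v : V) 
    (hv : ρ (el i j x) v = v) : ρ (el i j (n * x)) v = v := by
  have := el_eig ρ h x n v 1 (by rw [hv, one_smul])
  simpa using this

lemma el_neg_eig {i j : Fin 4} (h : i ≠ j) (x : R) (v : V) (ν : ℂ) (hv0 : v ≠ 0)
    (hv : ρ (el i j x) v = ν • v) : ν ≠ 0 ∧ ρ (el i j (-x)) v = ν⁻¹ • v := by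
  have h0 : ν ≠ 0 := by
    rintro rfl
    rw [zero_smul] at hv
    exact rho_ne ρ _ v hv0 hv
  refine ⟨h0, ?_⟩
  apply rho_inj ρ (el i j x)
  rw [← rho_mul, ← el_add h, map_smul, hv, smul_smul, inv_mul_cancel₀ h0, add_neg_cancel, el_zero,
    map_one, one_smul]
  rfl

lemma ker_step {i j k : Fin 4} (h1 : i ≠ j) (h2 : j ≠ k) (h3 : i ≠ k) (x : R) :
    (ρ (el i j x) = 1 → ρ (el i k x) = 1) ∧ (ρ (el j k x) = 1 → ρ (el i k x) = 1) := by
  constructor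
  · intro h
    have := el_rel h1 h2 h3 x 1
    ext v
    apply rho_inj ρ (el j k 1)
    have h4 := congrArg (fun g => ρ g v) this
    simp only [rho_mul, h, mul_one] at h4
    exact h4.symm
  · intro h
    have := el_rel h1 h2 h3 1 x
    ext v
    apply rho_inj ρ (el i j 1)
    have h4 := congrArg (fun g => ρ g v) this
    simp only [rho_mul, h, one_mul] at h4
    exact h4.symm

lemma ker_all (x : R) (h : ρ (el 0 2 x) = 1) : ρ (el 0 1 x) = 1 ∧ ρ (el 1 0 x) = 1 ∧
    ρ (el 0 3 x) = 1 ∧ ρ (el 1 2 x) = 1 ∧ ρ (el 3 2 x) = 1 ∧ ρ (el 3 0 x) = 1 := by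
  have h01 := (ker_step ρ (i := 0) (j := 2) (k := 1) (by decide) (by decide) (by decide) x).1 h
  have h03 := (ker_step ρ (i := 0) (j := 2) (k := 3) (by decide) (by decide) (by decide) x).1 h
  have h12 := (ker_step ρ (i := 1) (j := 0) (k := 2) (by decide) (by decide) (by decide) x).2 h
  have h32 := (ker_step ρ (i := 3) (j := 0) (k := 2) (by decide) (by decide) (by decide) x).2 h
  have h30 := (ker_step ρ (i := 3) (j := 2) (k := 0) (by decide) (by decide) (by decide) x).1 h32
  have h10 := (ker_step ρ (i := 1) (j := 3) (k := 0) (by decide) (by decide) (by decide) x).2 h30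
  exact ⟨h01, h10, h03, h12, h32, h30⟩

lemma ker_mul {i j : Fin 4} {N : ℕ} [NeZero N]
    (ρ : Matrix.SpecialLinearGroup (Fin 4) (ZMod N) →* Module.End ℂ V) (h : i ≠ j) (x y : ZMod N)
    (hx : ρ (el i j x) = 1) : ρ (el i j (x * y)) = 1 := by
  have : x * y = (y.val : ZMod N) * x := by rw [ZMod.natCast_zmod_val, mul_comm]
  rw [this, el_nat h, map_pow, hx, one_pow]

end Rep

section Local
variable {V : Type*} [AddCommGroup V] [Module ℂ V]
variable {N : ℕ} [NeZero N]
variable (ρ : Matrix.SpecialLinearGroup (Fin 4) (ZMod N) →* Module.End ℂ V)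

lemma el_pow_N {i j : Fin 4} (h : i ≠ j) (x : ZMod N) : ρ (el i j x) ^ N = 1 := by
  rw [← map_pow, ← el_nat h]
  simp [el_zero]

lemma root_of_ker {i j : Fin 4} (h : i ≠ j) (r : ℕ) (hr : ρ (el i j (r : ZMod N)) = 1)
    (v : V) (hv : v ≠ 0) (ν : ℂ) (hν : ρ (el i j 1) v = ν • v) : ν ^ r = 1 := by
  have h1 := el_eig ρ h 1 r v ν hν
  rw [mul_one, hr, Module.End.one_apply] at h1
  have h2 : (ν ^ r - 1) • v = 0 := by rw [sub_smul, one_smul, ← h1, sub_self]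
  exact sub_eq_zero.1 ((smul_eq_zero.1 h2).resolve_right hv)

lemma pow_of_root {p m : ℕ} (hp : p.Prime) (l ν : ℂ) (h1 : l ^ p ^ (m + 1) = 1)
    (h0 : l ^ p ^ m ≠ 1) (hν : ν ^ p ^ (m + 1) = 1) : ∃ s : ℕ, l ^ s = ν⁻¹ := by
  have := Fact.mk hp
  have ho : orderOf l = p ^ (m + 1) := orderOf_eq_prime_pow h0 h1
  have hpr : IsPrimitiveRoot l (p ^ (m + 1)) := ho ▸ IsPrimitiveRoot.orderOf l
  have : NeZero (p ^ (m + 1)) := ⟨pow_ne_zero _ hp.ne_zero⟩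
  obtain ⟨s, -, hs⟩ := hpr.eq_pow_of_pow_eq_one (ξ := ν⁻¹) (by rw [inv_pow, hν, inv_one])
  exact ⟨s, hs⟩

/-- `v` is a joint eigenvector of the standard block with diagonal character `(l, μ)` -/
def Occ (l μ : ℂ) (v : V) : Prop :=
  v ≠ 0 ∧ ρ (el 0 2 1) v = l • v ∧ ρ (el 0 3 1) v = v ∧ ρ (el 1 2 1) v = v ∧
    ρ (el 1 3 1) v = μ • v

lemma occ_init [FiniteDimensional ℂ V] {p m : ℕ} (hp : p.Prime)
    (h1 : ρ (el 0 2 ((p ^ (m + 1) : ℕ) : ZMod N)) = 1)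
    (h0 : ρ (el 0 2 ((p ^ m : ℕ) : ZMod N)) ≠ 1) :
    ∃ l μ v, Occ ρ l μ v ∧ l ^ p ^ m ≠ 1 := by
  obtain ⟨-, -, k03, k12, -, -⟩ := ker_all ρ _ h1
  obtain ⟨v, hv⟩ : ∃ v, (ρ (el 0 2 1) ^ (p ^ m)) v ≠ v := by
    by_contra! hcon
    apply h0
    ext v
    rw [← mul_one ((p ^ m : ℕ) : ZMod N), el_nat (by decide), map_pow]
    exact hcon v
  obtain ⟨l, v1, -, hv1, hl, hlne⟩ := eigen_ne ⊤ (ρ (el 0 2 1)) (by simp) N (p ^ m)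
    (NeZero.ne N) (el_pow_N ρ (by decide) 1) v (by simp) hv
  have hl1 := root_of_ker ρ (by decide) _ h1 v1 hv1 l hl
  -- joint eigenvectors
  obtain ⟨a, v2, hv2m, hv2, ha⟩ := eigen_exists (Module.End.eigenspace (ρ (el 0 2 1)) l)
    (ρ (el 0 3 1)) (by
      intro x hx
      rw [Module.End.mem_eigenspace_iff] at hx ⊢
      exact tr_eig ρ (el_comm (by decide) (by decide) (by decide) (by decide) _ _) hx) v1
    (Module.End.mem_eigenspace_iff.2 hl) hv1
  obtain ⟨b, v3, hv3m, hv3, hb⟩ := eigen_exists (Module.End.eigenspace (ρ (el 0 2 1)) l ⊓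
    Module.End.eigenspace (ρ (el 0 3 1)) a)
    (ρ (el 1 2 1)) (by
      intro x hx
      simp only [Submodule.mem_inf, Module.End.mem_eigenspace_iff] at hx ⊢
      exact ⟨tr_eig ρ (el_comm (by decide) (by decide) (by decide) (by decide) _ _) hx.1,
        tr_eig ρ (el_comm (by decide) (by decide) (by decide) (by decide) _ _) hx.2⟩) v2
    (by
      simp only [Submodule.mem_inf, Module.End.mem_eigenspace_iff] at hv2m ⊢
      exact ⟨hv2m, ha⟩) hv2
  obtain ⟨μ, v4, hv4m, hv4, hμ⟩ := eigen_exists (Module.End.eigenspace (ρ (el 0 2 1)) l ⊓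
    Module.End.eigenspace (ρ (el 0 3 1)) a ⊓ Module.End.eigenspace (ρ (el 1 2 1)) b)
    (ρ (el 1 3 1)) (by
      intro x hx
      simp only [Submodule.mem_inf, Module.End.mem_eigenspace_iff] at hx ⊢
      exact ⟨⟨tr_eig ρ (el_comm (by decide) (by decide) (by decide) (by decide) _ _) hx.1.1,
        tr_eig ρ (el_comm (by decide) (by decide) (by decide) (by decide) _ _) hx.1.2⟩,
        tr_eig ρ (el_comm (by decide) (by decide) (by decide) (by decide) _ _) hx.2⟩) v3
    (by
      simp only [Submodule.mem_inf, Module.End.mem_eigenspace_iff] at hv3m ⊢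
      exact ⟨hv3m, hb⟩) hv3
  simp only [Submodule.mem_inf, Module.End.mem_eigenspace_iff] at hv4m
  obtain ⟨⟨f02, f03⟩, f12⟩ := hv4m
  have ra := root_of_ker ρ (by decide) _ k03 v4 hv4 a f03
  have rb := root_of_ker ρ (by decide) _ k12 v4 hv4 b f12
  have ha0 : a ≠ 0 := by
    rintro rfl
    rw [zero_pow (pow_ne_zero _ hp.ne_zero)] at ra
    exact zero_ne_one ra
  have hb0 : b ≠ 0 := by
    rintro rfl
    rw [zero_pow (pow_ne_zero _ hp.ne_zero)] at rb
    exact zero_ne_one rb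
  obtain ⟨s, hs⟩ := pow_of_root hp l a hl1 hlne ra
  obtain ⟨t, ht⟩ := pow_of_root hp l b hl1 hlne rb
  -- clear the (0,3) entry, then the other one
  have g02 : ρ (el 0 2 1) (ρ (el 3 2 (s : ZMod N)) v4) = l • ρ (el 3 2 (s : ZMod N)) v4 :=
    tr_eig ρ (el_comm (by decide) (by decide) (by decide) (by decide) _ _) f02
  have g12 : ρ (el 1 2 1) (ρ (el 3 2 (s : ZMod N)) v4) = b • ρ (el 3 2 (s : ZMod N)) v4 :=
    tr_eig ρ (el_comm (by decide) (by decide) (by decide) (by decide) _ _) f12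
  have g03 : ρ (el 0 3 1) (ρ (el 3 2 (s : ZMod N)) v4) = ρ (el 3 2 (s : ZMod N)) v4 := by
    apply tr_fix ρ (el_rel (by decide) (by decide) (by decide) _ _)
    rw [rho_mul, one_mul, ← mul_one (s : ZMod N), el_eig ρ (by decide) 1 s v4 l f02, map_smul, f03,
      smul_smul, hs, inv_mul_cancel₀ ha0, one_smul]
  have g13 : ρ (el 1 3 1) (ρ (el 3 2 (s : ZMod N)) v4)
      = (μ * b ^ s) • ρ (el 3 2 (s : ZMod N)) v4 := by
    apply tr_eig ρ (el_rel (by decide) (by decide) (by decide) _ _)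
    rw [rho_mul, one_mul, ← mul_one (s : ZMod N), el_eig ρ (by decide) 1 s v4 b f12, map_smul, hμ,
      smul_smul, mul_comm]
  have hv5 := rho_ne ρ (el 3 2 (s : ZMod N)) v4 hv4
  generalize ρ (el 3 2 (s : ZMod N)) v4 = v5 at *
  refine ⟨l, μ * b ^ s, ρ (el 0 1 (-(t : ZMod N))) v5, ⟨rho_ne ρ _ _ hv5, ?_, ?_, ?_, ?_⟩, hlne⟩
  · exact tr_eig ρ (el_comm (by decide) (by decide) (by decide) (by decide) _ _) g02
  · exact tr_fix ρ (el_comm (by decide) (by decide) (by decide) (by decide) _ _) g03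
  · apply tr_fix ρ (el_rel' (by decide) (by decide) (by decide) _ _)
    rw [rho_mul, neg_mul, neg_neg, el_eig ρ (by decide) 1 t v5 l g02, map_smul, g12,
      smul_smul, ht, inv_mul_cancel₀ hb0, one_smul]
  · apply tr_eig ρ (el_rel' (by decide) (by decide) (by decide) _ _)
    rw [rho_mul, neg_mul, neg_neg, el_fix ρ (by decide) 1 t v5 g03, g13]

lemma occ_key [FiniteDimensional ℂ V] {p m n : ℕ} (hp : p.Prime)
    (h1 : ρ (el 0 2 ((p ^ (m + 1) : ℕ) : ZMod N)) = 1)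
    (hn : ∀ l μ v, Occ ρ l μ v → l ^ p ^ m ≠ 1 → μ ^ p ^ n = 1)
    (l μ : ℂ) (v : V) (hocc : Occ ρ l μ v) (hl : l ^ p ^ m ≠ 1) :
    ∃ w, Occ ρ l μ w ∧ ρ (el 1 0 ((p ^ n : ℕ) : ZMod N)) w = w := by
  have hμ := hn l μ v hocc hl
  obtain ⟨hv, f02, f03, f12, f13⟩ := hocc
  obtain ⟨-, -, -, -, k32, k30⟩ := ker_all ρ _ h1
  obtain ⟨γ, w, hwm, hw, hγ⟩ := eigen_exists (Module.End.eigenspace (ρ (el 0 2 1)) l ⊓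
    Module.End.eigenspace (ρ (el 0 3 1)) 1 ⊓ Module.End.eigenspace (ρ (el 1 2 1)) 1 ⊓
    Module.End.eigenspace (ρ (el 1 3 1)) μ)
    (ρ (el 1 0 ((p ^ n : ℕ) : ZMod N))) (by
      intro x hx
      simp only [Submodule.mem_inf, Module.End.mem_eigenspace_iff] at hx ⊢
      obtain ⟨⟨⟨x02, x03⟩, x12⟩, x13⟩ := hx
      simp only [one_smul] at x03 x12 ⊢
      refine ⟨⟨⟨?_, ?_⟩, ?_⟩, ?_⟩
      · apply tr_eig ρ (el_rel' (by decide) (by decide) (by decide) _ _)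
        rw [rho_mul, mul_one]
        have : -((p ^ n : ℕ) : ZMod N) = ((-((p ^ n : ℕ) : ZMod N)).val : ZMod N) * 1 := by
          rw [ZMod.natCast_zmod_val, mul_one]
        rw [this, el_fix ρ (by decide) 1 _ x x12, x02]
      · apply tr_fix ρ (el_rel' (by decide) (by decide) (by decide) _ _)
        rw [rho_mul, mul_one]
        by_cases hx0 : x = 0
        · simp [hx0]
        have h5 := el_eig ρ (by decide) 1 (p ^ n) x μ x13
        rw [hμ, mul_one] at h5
        have h6 := (el_neg_eig ρ (by decide) _ x 1 hx0 h5).2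
        rw [inv_one, one_smul] at h6
        rw [h6, x03]
      · exact tr_fix ρ (el_comm (by decide) (by decide) (by decide) (by decide) _ _) x12
      · exact tr_eig ρ (el_comm (by decide) (by decide) (by decide) (by decide) _ _) x13) v
    (by
      simp only [Submodule.mem_inf, Module.End.mem_eigenspace_iff, one_smul]
      exact ⟨⟨⟨f02, f03⟩, f12⟩, f13⟩) hv
  simp only [Submodule.mem_inf, Module.End.mem_eigenspace_iff, one_smul] at hwm
  obtain ⟨⟨⟨w02, w03⟩, w12⟩, w13⟩ := hwm
  refine ⟨w, ⟨hw, w02, w03, w12, w13⟩, ?_⟩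
  by_cases hγ1 : γ = 1
  · rw [hγ, hγ1, one_smul]
  exfalso
  -- `w` is not fixed by `e_32(p^m)`
  have hnf : (ρ (el 3 2 1) ^ (p ^ m)) w ≠ w := by
    intro hf
    rw [← map_pow, ← el_nat (by decide), mul_one] at hf
    have h5 := congrArg (fun g => ρ g w) (el_rel (i := 0) (j := 3) (k := 2) (by decide) (by decide)
      (by decide) 1 ((p ^ m : ℕ) : ZMod N))
    have h6 := el_eig ρ (by decide) 1 (p ^ m) w l w02
    rw [mul_one] at h6
    simp only [rho_mul, one_mul, hf, h6, map_smul, w03] at h5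
    apply hl
    have h7 : (l ^ p ^ m - 1) • w = 0 := by rw [sub_smul, one_smul, ← h5, sub_self]
    exact sub_eq_zero.1 ((smul_eq_zero.1 h7).resolve_right hw)
  obtain ⟨l', w1, hw1m, hw1, hl', hl'ne⟩ := eigen_ne (Module.End.eigenspace (ρ (el 1 2 1)) 1 ⊓
    Module.End.eigenspace (ρ (el 1 0 ((p ^ n : ℕ) : ZMod N))) γ) (ρ (el 3 2 1)) (by
      intro x hx
      simp only [Submodule.mem_inf, Module.End.mem_eigenspace_iff] at hx ⊢
      exact ⟨tr_eig ρ (el_comm (by decide) (by decide) (by decide) (by decide) _ _) hx.1,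
        tr_eig ρ (el_comm (by decide) (by decide) (by decide) (by decide) _ _) hx.2⟩)
    N (p ^ m) (NeZero.ne N) (el_pow_N ρ (by decide) 1) w (by
      simp only [Submodule.mem_inf, Module.End.mem_eigenspace_iff, one_smul]
      exact ⟨w12, hγ⟩) hnf
  simp only [Submodule.mem_inf, Module.End.mem_eigenspace_iff] at hw1m
  obtain ⟨c, w2, hw2m, hw2, hc⟩ := eigen_exists (Module.End.eigenspace (ρ (el 1 2 1)) 1 ⊓
    Module.End.eigenspace (ρ (el 1 0 ((p ^ n : ℕ) : ZMod N))) γ ⊓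
    Module.End.eigenspace (ρ (el 3 2 1)) l') (ρ (el 1 0 1)) (by
      intro x hx
      simp only [Submodule.mem_inf, Module.End.mem_eigenspace_iff] at hx ⊢
      exact ⟨⟨tr_eig ρ (el_comm (by decide) (by decide) (by decide) (by decide) _ _) hx.1.1,
        tr_eig ρ (el_comm (by decide) (by decide) (by decide) (by decide) _ _) hx.1.2⟩,
        tr_eig ρ (el_comm (by decide) (by decide) (by decide) (by decide) _ _) hx.2⟩) w1 (by
      simp only [Submodule.mem_inf, Module.End.mem_eigenspace_iff]
      exact ⟨hw1m, hl'⟩) hw1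
  simp only [Submodule.mem_inf, Module.End.mem_eigenspace_iff] at hw2m
  obtain ⟨ν, w3, hw3m, hw3, hν⟩ := eigen_exists (Module.End.eigenspace (ρ (el 1 2 1)) 1 ⊓
    Module.End.eigenspace (ρ (el 1 0 ((p ^ n : ℕ) : ZMod N))) γ ⊓
    Module.End.eigenspace (ρ (el 3 2 1)) l' ⊓ Module.End.eigenspace (ρ (el 1 0 1)) c)
    (ρ (el 3 0 1)) (by
      intro x hx
      simp only [Submodule.mem_inf, Module.End.mem_eigenspace_iff] at hx ⊢
      exact ⟨⟨⟨tr_eig ρ (el_comm (by decide) (by decide) (by decide) (by decide) _ _) hx.1.1.1,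
        tr_eig ρ (el_comm (by decide) (by decide) (by decide) (by decide) _ _) hx.1.1.2⟩,
        tr_eig ρ (el_comm (by decide) (by decide) (by decide) (by decide) _ _) hx.1.2⟩,
        tr_eig ρ (el_comm (by decide) (by decide) (by decide) (by decide) _ _) hx.2⟩) w2 (by
      simp only [Submodule.mem_inf, Module.End.mem_eigenspace_iff]
      exact ⟨hw2m, hc⟩) hw2
  simp only [Submodule.mem_inf, Module.End.mem_eigenspace_iff, one_smul] at hw3m
  obtain ⟨⟨⟨y12, yγ⟩, y32⟩, y10⟩ := hw3m
  have hcγ : c ^ p ^ n ≠ 1 := by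
    intro hcon
    have h5 := el_eig ρ (by decide) 1 (p ^ n) w3 c y10
    rw [mul_one, yγ, hcon] at h5
    apply hγ1
    have h7 : (γ - 1) • w3 = 0 := by rw [sub_smul, h5, sub_self]
    exact sub_eq_zero.1 ((smul_eq_zero.1 h7).resolve_right hw3)
  have rl' := root_of_ker ρ (by decide) _ k32 w3 hw3 l' y32
  have rν := root_of_ker ρ (by decide) _ k30 w3 hw3 ν hν
  have hν0 : ν ≠ 0 := by
    rintro rfl
    rw [zero_pow (pow_ne_zero _ hp.ne_zero)] at rν
    exact zero_ne_one rν
  obtain ⟨s, hs⟩ := pow_of_root hp l' ν rl' hl'ne rν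
  -- clear the (3,0) entry
  have z32 : ρ (el 3 2 1) (ρ (el 0 2 (s : ZMod N)) w3) = l' • ρ (el 0 2 (s : ZMod N)) w3 :=
    tr_eig ρ (el_comm (by decide) (by decide) (by decide) (by decide) _ _) y32
  have z12 : ρ (el 1 2 1) (ρ (el 0 2 (s : ZMod N)) w3) = ρ (el 0 2 (s : ZMod N)) w3 :=
    tr_fix ρ (el_comm (by decide) (by decide) (by decide) (by decide) _ _) y12
  have z30 : ρ (el 3 0 1) (ρ (el 0 2 (s : ZMod N)) w3)
      = (1 : ℂ) • ρ (el 0 2 (s : ZMod N)) w3 := by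
    apply tr_eig ρ (el_rel (by decide) (by decide) (by decide) _ _)
    rw [rho_mul, one_mul, ← mul_one (s : ZMod N), el_eig ρ (by decide) 1 s w3 l' y32, map_smul, hν,
      smul_smul, hs, inv_mul_cancel₀ hν0]
  have z10 : ρ (el 1 0 1) (ρ (el 0 2 (s : ZMod N)) w3) = c • ρ (el 0 2 (s : ZMod N)) w3 := by
    apply tr_eig ρ (el_rel (by decide) (by decide) (by decide) _ _)
    rw [rho_mul, one_mul, ← mul_one (s : ZMod N), el_fix ρ (by decide) 1 s w3 y12, y10]
  have hw4 := rho_ne ρ (el 0 2 (s : ZMod N)) w3 hw3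
  generalize ρ (el 0 2 (s : ZMod N)) w3 = w4 at *
  obtain ⟨s1, s2, s3, s4⟩ := sg_rel (R := ZMod N)
  have n10 := (el_neg_eig ρ (by decide) _ w4 c hw4 z10).2
  have n30 := (el_neg_eig ρ (by decide) _ w4 1 hw4 z30).2
  rw [inv_one, one_smul] at n30
  have hfin := hn l' c⁻¹ (ρ sg w4) ⟨rho_ne ρ _ _ hw4, tr_eig ρ s1 z32, tr_fix ρ s3 n30,
    tr_fix ρ s4 z12, tr_eig ρ s2 n10⟩ hl'ne
  apply hcγ
  rw [inv_pow] at hfin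
  exact inv_eq_one.1 hfin

end Local

section Final
variable {V : Type*} [AddCommGroup V] [Module ℂ V]

lemma dvd_of_val {N : ℕ} [NeZero N] (r : ℕ) (y : ZMod N) (h : r ∣ y.val) :
    ∃ z : ZMod N, y = (r : ZMod N) * z := by
  obtain ⟨t, ht⟩ := h
  refine ⟨(t : ZMod N), ?_⟩
  rw [← Nat.cast_mul, ← ht, ZMod.natCast_zmod_val]

lemma el_eig_val {N : ℕ} [NeZero N]
    (ρ : Matrix.SpecialLinearGroup (Fin 4) (ZMod N) →* Module.End ℂ V)
    {i j : Fin 4} (h : i ≠ j) (x : ZMod N) (v : V) (ν : ℂ)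
    (hv : ρ (el i j 1) v = ν • v) : ρ (el i j x) v = ν ^ x.val • v := by
  have := el_eig ρ h 1 x.val v ν hv
  rwa [ZMod.natCast_zmod_val, mul_one] at this

lemma el_fix_val {N : ℕ} [NeZero N]
    (ρ : Matrix.SpecialLinearGroup (Fin 4) (ZMod N) →* Module.End ℂ V)
    {i j : Fin 4} (h : i ≠ j) (x y : ZMod N) (v : V) 
    (hv : ρ (el i j x) v = v) : ρ (el i j (x * y)) v = v := by
  have := el_fix ρ h x y.val v hv
  rwa [ZMod.natCast_zmod_val, mul_comm] at this

/-- The stabiliser acts trivially. -/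
lemma stab_fix {N : ℕ} [NeZero N]
    (ρ : Matrix.SpecialLinearGroup (Fin 4) (ZMod N) →* Module.End ℂ V)
    (a b : ZMod N) (h1 : ρ (el 0 2 a) = 1) (w : V) (hw : ρ (el 1 0 b) w = w)
    (A : Matrix.SpecialLinearGroup (Fin 2) (ZMod N)) (u : ZMod N) (hu : A.1 1 1 * u = 1)
    (h11 : ∃ x, A.1 1 1 - 1 = a * x) (h01 : ∃ y, A.1 0 1 = a * y) (h10 : ∃ z, A.1 1 0 = b * z) :
    ρ (iota A) w = w := by
  obtain ⟨k01, k10, -, -, -, -⟩ := ker_all ρ _ h1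
  obtain ⟨x, hx⟩ := h11
  obtain ⟨y, hy⟩ := h01
  obtain ⟨z, hz⟩ := h10
  rw [iota_decomp A u hu, hx, hy, hz]
  have e1 : (a * y + a * x) * u = a * ((y + x) * u) := by ring
  have e2 : -(a * x * u) = a * (-(x * u)) := by ring
  have e3 : b * z * u = b * (z * u) := by ring
  rw [e1, e2, e3]
  simp only [rho_mul]
  rw [el_fix_val ρ (by decide) _ _ w hw, ker_mul ρ (by decide) _ _ k10,
    ker_mul ρ (by decide) _ _ k10, ker_mul ρ (by decide) _ _ k01]
  simp only [Module.End.one_apply]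
  rw [← rho_mul, ← el_add (by decide), neg_add_cancel, el_zero, map_one]
  rfl

lemma final_sum {N : ℕ} [NeZero N]
    (ρ : Matrix.SpecialLinearGroup (Fin 4) (ZMod N) →* Module.End ℂ V)
    (l μ : ℂ) (w : V) (hocc : Occ ρ l μ w)
    (hst : ∀ A : Matrix.SpecialLinearGroup (Fin 2) (ZMod N), l ^ (A.1 1 1 - 1).val = 1 →
      l ^ (-A.1 0 1).val = 1 → μ ^ (-A.1 1 0).val = 1 → ρ (iota A) w = w) :
    ∃ v : V, v ≠ 0 ∧ ∀ A : Matrix.SpecialLinearGroup (Fin 2) (ZMod N), ρ (iota A) v = v := by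
  classical
  have : Finite (Matrix.SpecialLinearGroup (Fin 2) (ZMod N)) :=
    inferInstanceAs (Finite {A : Matrix (Fin 2) (Fin 2) (ZMod N) // A.det = 1})
  have := Fintype.ofFinite (Matrix.SpecialLinearGroup (Fin 2) (ZMod N))
  obtain ⟨hw, f02, f03, f12, f13⟩ := hocc
  have f03' : ρ (el 0 3 1) w = (1 : ℂ) • w := by rw [f03, one_smul]
  have f12' : ρ (el 1 2 1) w = (1 : ℂ) • w := by rw [f12, one_smul]
  have hN0 : ((N : ℕ) : ZMod N) = 0 := by simp
  have hker : ∀ {i j : Fin 4}, ρ (el i j ((N : ℕ) : ZMod N)) = 1 := by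
    intro i j; rw [hN0, el_zero, map_one]
  have rl : l ^ N = 1 := root_of_ker ρ (by decide) N hker w hw l f02
  have rμ : μ ^ N = 1 := root_of_ker ρ (by decide) N hker w hw μ f13
  have hl0 : l ≠ 0 := by
    rintro rfl
    rw [zero_pow (NeZero.ne N)] at rl
    exact zero_ne_one rl
  have pw : ∀ (x : ℂ) (n : ℕ), x ^ N = 1 → (x ^ n) ^ N = 1 := by
    intro x n h
    rw [← pow_mul, mul_comm, pow_mul, h, one_pow]
  have F02 : ∀ A, ρ (el 0 2 1) (ρ (iota A) w) = (l ^ (A.1 1 1 - 1).val * l) • ρ (iota A) w := by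
    intro A
    apply tr_eig ρ (conj_row0 A 2 (Or.inl rfl))
    rw [rho_mul, el_eig_val ρ (by decide) _ w 1 f12', one_pow, one_smul]
    conv_lhs => rw [← sub_add_cancel (A.1 1 1) 1]
    rw [el_add (by decide), rho_mul, f02, map_smul, el_eig_val ρ (by decide) _ w l f02, smul_smul,
      mul_comm]
  have F03 : ∀ A, ρ (el 0 3 1) (ρ (iota A) w) = (μ ^ (-A.1 1 0).val) • ρ (iota A) w := by
    intro A
    apply tr_eig ρ (conj_row0 A 3 (Or.inr rfl))
    rw [rho_mul, el_eig_val ρ (by decide) _ w μ f13, map_smul,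
      el_eig_val ρ (by decide) _ w 1 f03', one_pow, one_smul]
  have F12 : ∀ A, ρ (el 1 2 1) (ρ (iota A) w) = (l ^ (-A.1 0 1).val) • ρ (iota A) w := by
    intro A
    apply tr_eig ρ (conj_row1 A)
    rw [rho_mul, el_eig_val ρ (by decide) _ w 1 f12', one_pow, one_smul,
      el_eig_val ρ (by decide) _ w l f02]
  let Q : Module.End ℂ V :=
    avg N 1 (ρ (el 1 2 1)) * (avg N 1 (ρ (el 0 3 1)) * avg N l (ρ (el 0 2 1)))
  let r : Matrix.SpecialLinearGroup (Fin 2) (ZMod N) → ℕ := fun A =>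
    if l ^ (A.1 1 1 - 1).val = 1 ∧ l ^ (-A.1 0 1).val = 1 ∧ μ ^ (-A.1 1 0).val = 1
      then N * (N * N) else 0
  have hQ : ∀ A, Q (ρ (iota A) w) = (r A : ℂ) • w := by
    intro A
    have e1 := avg_eig N l _ _ rl (by rw [mul_pow, pw l _ rl, rl, one_mul]) _ (F02 A)
    have e2 := avg_eig N 1 _ _ (one_pow N) (pw μ _ rμ) _ (F03 A)
    have e3 := avg_eig N 1 _ _ (one_pow N) (pw l _ rl) _ (F12 A)
    have e0 : (l ^ (A.1 1 1 - 1).val * l = l) ↔ l ^ (A.1 1 1 - 1).val = 1 := by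
      rw [mul_eq_right₀ hl0]
    simp only [Q, r, Module.End.mul_apply]
    rw [e1, map_smul, e2, map_smul, map_smul, e3]
    simp only [e0]
    by_cases c1 : l ^ (A.1 1 1 - 1).val = 1
    · by_cases c2 : l ^ (-A.1 0 1).val = 1
      · by_cases c3 : μ ^ (-A.1 1 0).val = 1
        · rw [hst A c1 c2 c3]
          simp [c1, c2, c3, smul_smul]
        · simp [c3]
      · simp [c2]
    · simp [c1]
  refine ⟨∑ A, ρ (iota A) w, ?_, ?_⟩
  · intro h0
    have h1 : Q (∑ A, ρ (iota A) w) = ((∑ A, r A : ℕ) : ℂ) • w := by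
      rw [map_sum, Finset.sum_congr rfl (fun A _ => hQ A), ← Finset.sum_smul, Nat.cast_sum]
    rw [h0, map_zero] at h1
    have h2 := (smul_eq_zero.1 h1.symm).resolve_right hw
    have h3 : ∑ A, r A = 0 := by exact_mod_cast h2
    have h4 := (Finset.sum_eq_zero_iff.1 h3) 1 (Finset.mem_univ _)
    have hNN := NeZero.ne N
    simp [r, hNN] at h4
  · intro B
    rw [map_sum]
    simp only [← rho_mul, ← iota_mul]
    exact Equiv.sum_comp (Equiv.mulLeft B) (fun A => ρ (iota A) w)

theorem local_case [FiniteDimensional ℂ V] [Nontrivial V] (p k : ℕ) (hp : p.Prime)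
    (ρ : Matrix.SpecialLinearGroup (Fin 4) (ZMod (p ^ k)) →* Module.End ℂ V) :
    ∃ v : V, v ≠ 0 ∧ ∀ A : Matrix.SpecialLinearGroup (Fin 2) (ZMod (p ^ k)),
      ρ (iota A) v = v := by
  classical
  have hNe : NeZero (p ^ k) := ⟨pow_ne_zero _ hp.ne_zero⟩
  have hpk : ((p ^ k : ℕ) : ZMod (p ^ k)) = 0 := by simp
  have hnil : IsNilpotent ((p : ℕ) : ZMod (p ^ k)) := ⟨k, by rw [← Nat.cast_pow, hpk]⟩
  have hM : ∃ M, ρ (el 0 2 ((p ^ M : ℕ) : ZMod (p ^ k))) = 1 := ⟨k, by rw [hpk, el_zero, map_one]⟩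
  have hM1 := Nat.find_spec hM
  have hM2 := fun n => Nat.find_min hM (m := n)
  generalize Nat.find hM = M at hM1 hM2
  rcases M with _ | m
  · -- everything acts trivially
    rw [pow_zero, Nat.cast_one] at hM1
    obtain ⟨v, hv⟩ := exists_ne (0 : V)
    obtain ⟨k01, k10, -, -, -, -⟩ := ker_all ρ _ hM1
    have hunit : ∀ A : Matrix.SpecialLinearGroup (Fin 2) (ZMod (p ^ k)), IsUnit (A.1 1 1) →
        ρ (iota A) v = v := by
      intro A hA
      obtain ⟨u, hu⟩ := hA.exists_right_inv
      exact stab_fix ρ 1 1 hM1 v (by rw [k10]; rfl) A u hu ⟨_, (one_mul _).symm⟩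
        ⟨_, (one_mul _).symm⟩ ⟨_, (one_mul _).symm⟩
    refine ⟨v, hv, fun A => ?_⟩
    by_cases hA : IsUnit (A.1 1 1)
    · exact hunit A hA
    have hdiv : ∀ x : ZMod (p ^ k), IsUnit x ∨ IsNilpotent x := by
      intro x
      by_cases h : p ∣ x.val
      · right
        obtain ⟨z, hz⟩ := dvd_of_val p x h
        rw [hz]
        exact (Commute.all _ _).isNilpotent_mul_right hnil
      · left
        rw [← ZMod.natCast_zmod_val x, ZMod.isUnit_iff_coprime]
        exact Nat.Coprime.pow_right _ ((hp.coprime_iff_not_dvd.2 h).symm)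
    have hd := (hdiv (A.1 1 1)).resolve_left hA
    have h2 : IsUnit (A.1 1 0) := by
      have h3 : IsUnit (-(A.1 0 1 * A.1 1 0)) := by
        have h4 := det2 A
        have h5 : -(A.1 0 1 * A.1 1 0) = 1 + -(A.1 0 0 * A.1 1 1) := by linear_combination h4
        rw [h5]
        exact ((Commute.all _ _).isNilpotent_mul_left hd).neg.isUnit_one_add
      exact isUnit_of_mul_isUnit_right ((IsUnit.neg_iff _).1 h3)
    have h3 := hunit (A * u2 1) (by
      have : (A * u2 1).1 1 1 = A.1 1 0 + A.1 1 1 := by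
        rw [Matrix.SpecialLinearGroup.coe_mul]
        simp [Matrix.mul_apply, Fin.sum_univ_succ, u2]
      rw [this]
      exact hd.isUnit_add_left_of_commute h2 (Commute.all _ _))
    rw [iota_mul, iota_u2, rho_mul, k01] at h3
    exact h3
  · have hm0 := hM2 m (Nat.lt_succ_self m)
    obtain ⟨l0, μ0, v0, hocc0, hl0⟩ := occ_init ρ hp hM1 hm0
    have hn : ∃ n, ∀ l μ v, Occ ρ l μ v → l ^ p ^ m ≠ 1 → μ ^ p ^ n = 1 := by
      refine ⟨k, fun l μ v h _ => ?_⟩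
      exact root_of_ker ρ (i := 1) (j := 3) (by decide) (p ^ k) (by rw [hpk, el_zero, map_one])
        v h.1 μ h.2.2.2.2
    have hn1 := Nat.find_spec hn
    have hn2 := fun n => Nat.find_min hn (m := n)
    generalize Nat.find hn = n at hn1 hn2
    have hF := Fact.mk hp
    obtain ⟨l, μ, v, hocc, hl, hord⟩ : ∃ l μ v, Occ ρ l μ v ∧ l ^ p ^ m ≠ 1 ∧
        ∀ c : ℕ, μ ^ c = 1 → p ^ n ∣ c := by
      rcases n with _ | n
      · exact ⟨l0, μ0, v0, hocc0, hl0, fun c _ => by simp⟩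
      · have := hn2 n (Nat.lt_succ_self n)
        push Not at this
        obtain ⟨l, μ, v, h1, h2, h3⟩ := this
        refine ⟨l, μ, v, h1, h2, fun c hc => ?_⟩
        rw [← orderOf_eq_prime_pow h3 (hn1 l μ v h1 h2)]
        exact orderOf_dvd_of_pow_eq_one hc
    obtain ⟨w, hwo, hwf⟩ := occ_key ρ hp hM1 hn1 l μ v hocc hl
    have hl1 : l ^ p ^ (m + 1) = 1 := root_of_ker ρ (by decide) _ hM1 w hwo.1 l hwo.2.1
    have hlord : ∀ c : ℕ, l ^ c = 1 → p ^ (m + 1) ∣ c := by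
      intro c hc
      rw [← orderOf_eq_prime_pow hl hl1]
      exact orderOf_dvd_of_pow_eq_one hc
    apply final_sum ρ l μ w hwo
    intro A c1 c2 c3
    obtain ⟨x, hx⟩ := dvd_of_val _ _ (hlord _ c1)
    obtain ⟨y, hy⟩ := dvd_of_val _ _ (hlord _ c2)
    obtain ⟨z, hz⟩ := dvd_of_val _ _ (hord _ c3)
    have hu : IsUnit (A.1 1 1) := by
      have : A.1 1 1 = 1 + ((p ^ (m + 1) : ℕ) : ZMod (p ^ k)) * x := by linear_combination hx
      rw [this]
      apply IsNilpotent.isUnit_one_add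
      apply (Commute.all _ _).isNilpotent_mul_right
      rw [Nat.cast_pow]
      exact hnil.pow_succ m
    obtain ⟨u, hu⟩ := hu.exists_right_inv
    exact stab_fix ρ _ _ hM1 w hwf A u hu ⟨x, hx⟩ ⟨-y, by linear_combination -hy⟩
      ⟨-z, by linear_combination -hz⟩

end Final

section CRT

universe u

/-- the property of the ring we want -/
def P (R : Type) [CommRing R] : Prop :=
  ∀ (V : Type u) [AddCommGroup V] [Module ℂ V] [FiniteDimensional ℂ V] [Nontrivial V]
    (ρ : Matrix.SpecialLinearGroup (Fin 4) R →* Module.End ℂ V),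
    ∃ v : V, v ≠ 0 ∧ ∀ A : Matrix.SpecialLinearGroup (Fin 2) R, ρ (iota A) v = v

lemma map_iota {R S : Type*} [CommRing R] [CommRing S] (f : R →+* S)
    (A : Matrix.SpecialLinearGroup (Fin 2) R) :
    Matrix.SpecialLinearGroup.map f (iota A) = iota (Matrix.SpecialLinearGroup.map f A) := by
  apply Subtype.ext
  change f.mapMatrix (iota A).1 = _
  rw [iota_coe, iota_coe]
  ext i j
  fin_cases i <;> fin_cases j <;> simp

lemma P_equiv {R S : Type} [CommRing R] [CommRing S] (e : R ≃+* S) (h : P.{u} R) : P.{u} S := by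
  intro V _ _ _ _ ρ
  obtain ⟨v, hv, hA⟩ := h V (ρ.comp (Matrix.SpecialLinearGroup.map (e : R →+* S)))
  refine ⟨v, hv, fun A => ?_⟩
  have := hA (Matrix.SpecialLinearGroup.map (e.symm : S →+* R) A)
  rw [MonoidHom.comp_apply, map_iota] at this
  convert this using 3
  congr 1
  ext i j
  simp

/-- pairing of special linear matrices -/
def pr {n : ℕ} {R S : Type*} [CommRing R] [CommRing S] :
    Matrix.SpecialLinearGroup (Fin n) R × Matrix.SpecialLinearGroup (Fin n) S →*
    Matrix.SpecialLinearGroup (Fin n) (R × S) where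
  toFun A := ⟨Matrix.of fun i j => (A.1.1 i j, A.2.1 i j), by
    apply Prod.ext
    · have := RingHom.map_det (RingHom.fst R S) (Matrix.of fun i j => (A.1.1 i j, A.2.1 i j))
      refine this.trans ?_
      exact A.1.2
    · have := RingHom.map_det (RingHom.snd R S) (Matrix.of fun i j => (A.1.1 i j, A.2.1 i j))
      refine this.trans ?_
      exact A.2.2⟩
  map_one' := by
    apply Subtype.ext
    ext i j <;> by_cases h : i = j <;> simp [h, Matrix.one_apply]
  map_mul' A B := by
    apply Subtype.ext
    change _ = (Matrix.of fun i j => (A.1.1 i j, A.2.1 i j)) *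
      (Matrix.of fun i j => (B.1.1 i j, B.2.1 i j))
    ext i j
    · simp [Matrix.mul_apply, Prod.fst_sum]
    · simp [Matrix.mul_apply, Prod.snd_sum]

lemma pr_coe {n : ℕ} {R S : Type*} [CommRing R] [CommRing S]
    (A : Matrix.SpecialLinearGroup (Fin n) R × Matrix.SpecialLinearGroup (Fin n) S) :
    (pr A).1 = Matrix.of fun i j => (A.1.1 i j, A.2.1 i j) := rfl

lemma iota_pr {R S : Type*} [CommRing R] [CommRing S]
    (A : Matrix.SpecialLinearGroup (Fin 2) R × Matrix.SpecialLinearGroup (Fin 2) S) :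
    iota (pr A) = pr (iota A.1, iota A.2) := by
  apply Subtype.ext
  rw [pr_coe, iota_coe, iota_coe, iota_coe, pr_coe]
  ext i j <;> fin_cases i <;> fin_cases j <;> simp

lemma pr_surj {R S : Type*} [CommRing R] [CommRing S]
    (A : Matrix.SpecialLinearGroup (Fin 2) (R × S)) : ∃ B, A = pr B := by
  refine ⟨(Matrix.SpecialLinearGroup.map (RingHom.fst R S) A,
    Matrix.SpecialLinearGroup.map (RingHom.snd R S) A), ?_⟩
  apply Subtype.ext
  rw [pr_coe]
  ext i j <;> simp

lemma P_prod {R S : Type} [CommRing R] [CommRing S] (hR : P.{u} R) (hS : P.{u} S) :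
    P.{u} (R × S) := by
  intro V _ _ _ _ ρ
  obtain ⟨v, hv, hA⟩ := hR V (ρ.comp (pr.comp (MonoidHom.inl _ _)))
  let W : Submodule ℂ V :=
    ⨅ A : Matrix.SpecialLinearGroup (Fin 2) R, LinearMap.eqLocus (ρ (pr (iota A, 1))) LinearMap.id
  have memW : ∀ x, x ∈ W ↔ ∀ A : Matrix.SpecialLinearGroup (Fin 2) R, ρ (pr (iota A, 1)) x = x := by
    intro x
    simp [W, Submodule.mem_iInf]
  have hvW : v ∈ W := (memW v).2 hA
  have hst : ∀ (B : Matrix.SpecialLinearGroup (Fin 4) S), ∀ x ∈ W, ρ (pr (1, B)) x ∈ W := by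
    intro B x hx
    rw [memW] at hx ⊢
    intro A
    apply tr_fix ρ _ (hx A)
    rw [← map_mul, ← map_mul]
    simp
  have : Nontrivial W := ⟨⟨⟨v, hvW⟩, 0, fun h => hv (congrArg Subtype.val h)⟩⟩
  let σ : Matrix.SpecialLinearGroup (Fin 4) S →* Module.End ℂ W :=
    { toFun := fun B => LinearMap.restrict (ρ (pr (1, B))) (hst B)
      map_one' := by
        ext x
        change ρ (pr 1) x = x
        rw [map_one, map_one]; rfl
      map_mul' := by
        intro B C
        ext x
        change ρ (pr (1, B * C)) x = ρ (pr (1, B)) (ρ (pr (1, C)) x)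
        rw [← rho_mul, ← map_mul]
        simp }
  obtain ⟨w, hw, hB⟩ := hS W σ
  refine ⟨w, fun h => hw (Subtype.ext h), fun A => ?_⟩
  obtain ⟨⟨B, C⟩, rfl⟩ := pr_surj A
  have h1 : ρ (pr (1, iota C)) w = w := congrArg Subtype.val (hB C)
  have h2 : ρ (pr (iota B, 1)) w = w := (memW w).1 w.2 B
  have h3 : (iota B, iota C) = ((iota B, 1) : Matrix.SpecialLinearGroup (Fin 4) R ×
    Matrix.SpecialLinearGroup (Fin 4) S) * (1, iota C) := by simp
  rw [iota_pr, h3, map_mul, rho_mul, h1, h2]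

theorem P_zmod (N : ℕ) : 1 ≤ N → P.{u} (ZMod N) := by
  induction N using Nat.recOnPosPrimePosCoprime with
  | prime_pow p n hp hn =>
    intro _ V _ _ _ _ ρ
    exact local_case p n hp ρ
  | zero => intro h; omega
  | one =>
    intro _ V _ _ _ _ ρ
    obtain ⟨v, hv⟩ := exists_ne (0 : V)
    refine ⟨v, hv, fun A => ?_⟩
    have : iota A = 1 := by
      apply Subtype.ext
      ext i j
      exact Subsingleton.elim (α := Fin 1) _ _
    rw [this, map_one]; rfl
  | coprime a b ha hb hab iha ihb =>
    intro _
    exact P_equiv (ZMod.chineseRemainder hab).symm (P_prod (iha ha.le) (ihb hb.le))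

end CRT

end S5

theorem stmt5 (N : ℕ) (hN : 1 ≤ N) {V : Type*} [AddCommGroup V] [Module ℂ V]
    [FiniteDimensional ℂ V] [Nontrivial V]
    (φ : Matrix.SpecialLinearGroup (Fin 4) (ZMod N) →* LinearMap.GeneralLinearGroup ℂ V) :
    ∃ v : V, v ≠ 0 ∧ ∀ g : Matrix.SpecialLinearGroup (Fin 2) (ZMod N),
      (φ (iota g) : V →ₗ[ℂ] V) v = v := by
  obtain ⟨v, hv, h⟩ := S5.P_zmod N hN V ((Units.coeHom (V →ₗ[ℂ] V)).comp φ)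
  exact ⟨v, hv, h⟩
end

section
/- Let p be a prime, r ≥ 1, and let φ be an irreducible unitary representation of SL₄(ℤ/p^rℤ) on a nonzero finite-dimensional complex inner product space V which is new, i.e. the kernel of the reduction homomorphism SL₄(ℤ/p^rℤ) → SL₄(ℤ/p^{r-1}ℤ) is not contained in the kernel of φ. Then there exist a nonzero vector v ∈ V and integers ξ₁, ξ₂, ξ₃ with (ξ₁, ξ₂, ξ₃) ≢ (0,0,0) mod p such that for all integers u₁, u₂, u₃, φ(u(u₁,u₂,u₃)) v = exp(2πi(ξ₁u₁ + ξ₂u₂ + ξ₃u₃)/p^r) · v. -/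
open Matrix

/-- The matrix `u(u₁,u₂,u₃)` in SL₄(ℤ/p^r): the identity except for entries
`u₁, u₂, u₃` in positions (1,4), (2,4), (3,4) (1-indexed). -/
def uMat (p r : ℕ) (u₁ u₂ u₃ : ℤ) :
    Matrix.SpecialLinearGroup (Fin 4) (ZMod (p ^ r)) :=
  ⟨!![1, 0, 0, (u₁ : ZMod (p ^ r)); 0, 1, 0, (u₂ : ZMod (p ^ r));
      0, 0, 1, (u₃ : ZMod (p ^ r)); 0, 0, 0, 1], by
    simp [Matrix.det_succ_row_zero, Fin.sum_univ_succ]⟩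

set_option linter.unusedSimpArgs false

open Matrix.SpecialLinearGroup in
theorem diag2n_decomp {F : Type*} [Field F] {i j : Fin 4} (hij : i ≠ j) (a : F) (ha : a ≠ 0) :
    diag2n hij a ha = transvection hij a * transvection hij.symm (-a⁻¹) * transvection hij a *
      transvection hij (-1) * transvection hij.symm 1 * transvection hij (-1) := by
  have h1 : (diag2n hij a ha).1 = 1 + single i i (a - 1) + single j j (a⁻¹ - 1) := by
    rw [diag2n_coe]
    ext k l
    simp only [diagonal_apply, Matrix.add_apply, one_apply, single_apply]
    grind
  apply Subtype.ext
  simp only [coe_mul, transvection_coe]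
  rw [h1]
  simp only [mul_add, add_mul, one_mul, mul_one, zero_mul, mul_zero, add_zero, zero_add, single_mul_single_same, ne_eq, hij, hij.symm,
    not_false_eq_true, single_mul_single_of_ne]
  ext k l
  simp only [Matrix.add_apply, one_apply, single_apply, Matrix.zero_apply]
  have := mul_inv_cancel₀ ha
  split_ifs <;> grind

open Matrix.SpecialLinearGroup in
theorem field_top {F : Type*} [Field F] (N : Subgroup (SpecialLinearGroup (Fin 4) F))
    (h : ∀ (i j : Fin 4) (hij : i ≠ j) (x : F), transvection hij x ∈ N) (g) : g ∈ N := by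
  refine diagonal_transvection_induction' (fun g => g ∈ N) g ?_ h (fun _ _ => mul_mem)
  intro i j hij c hc
  show _ ∈ N
  rw [diag2n_decomp]
  refine mul_mem (mul_mem (mul_mem (mul_mem (mul_mem ?_ ?_) ?_) ?_) ?_) ?_
  all_goals exact h _ _ _ _

open Matrix.SpecialLinearGroup in
theorem comm_transvec {R : Type*} [CommRing R] {i j k : Fin 4} (hij : i ≠ j) (hjk : j ≠ k)
    (hik : i ≠ k) (a b : R) :
    transvection hij a * transvection hjk b * (transvection hij a)⁻¹ * (transvection hjk b)⁻¹
      = transvection hik (a * b) := by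
  rw [transvection_inv, transvection_inv]
  apply Subtype.ext
  simp only [coe_mul, transvection_coe]
  simp only [mul_add, add_mul, one_mul, mul_one, zero_mul, mul_zero, add_zero, zero_add, single_mul_single_same, ne_eq, hij, hij.symm, hik,
    hik.symm, hjk, hjk.symm,
    not_false_eq_true, single_mul_single_of_ne]
  ext k l
  simp only [Matrix.add_apply, one_apply, single_apply, Matrix.zero_apply]
  split_ifs <;> ring

open Matrix.SpecialLinearGroup in
theorem all_transvec {R : Type*} [CommRing R] (N : Subgroup (SpecialLinearGroup (Fin 4) R))
    [N.Normal] (y : R) (h : transvection (show (0 : Fin 4) ≠ 3 by decide) y ∈ N)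
    (i j : Fin 4) (hij : i ≠ j) : transvection hij y ∈ N := by
  have right (i j k : Fin 4) (hij : i ≠ j) (hjk : j ≠ k) (hik : i ≠ k)
      (hm : transvection hij y ∈ N) : transvection hik y ∈ N := by
    have := comm_transvec hij hjk hik y 1
    rw [mul_one] at this
    rw [← this, mul_assoc, mul_assoc, ← mul_assoc (transvection hjk 1)]
    exact mul_mem hm (Subgroup.Normal.conj_mem ‹_› _ (inv_mem hm) _)
  have left (k i j : Fin 4) (hki : k ≠ i) (hij : i ≠ j) (hkj : k ≠ j)
      (hm : transvection hij y ∈ N) : transvection hkj y ∈ N := by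
    have := comm_transvec hki hij hkj 1 y
    rw [one_mul] at this
    rw [← this]
    exact mul_mem (Subgroup.Normal.conj_mem ‹_› _ hm _) (inv_mem hm)
  have h0 (j : Fin 4) (hj : 0 ≠ j) : transvection hj y ∈ N := by
    by_cases h3 : j = 3
    · subst h3; exact h
    · exact right 0 3 j _ (Ne.symm h3) hj h
  have h1 (i j : Fin 4) (hij : i ≠ j) (hj : 0 ≠ j) : transvection hij y ∈ N := by
    by_cases hi : i = 0
    · subst hi; exact h0 j hij
    · exact left i 0 j hi hj hij (h0 j hj)
  by_cases hj : 0 = j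
  · subst hj
    obtain ⟨m, hm⟩ : ∃ m : Fin 4, 0 ≠ m ∧ i ≠ m := by revert i; decide
    exact right i m 0 hm.2 hm.1.symm hij (h1 i m hm.2 hm.1)
  · exact h1 i j hij hj

open Matrix.SpecialLinearGroup in
theorem nilp_mem {R : Type*} [CommRing R] (N : Subgroup (SpecialLinearGroup (Fin 4) R))
    [N.Normal] (q : R) (hq : q * q = 0)
    (h : ∀ (i j : Fin 4) (hij : i ≠ j) (x : R), transvection hij (q * x) ∈ N)
    (g : SpecialLinearGroup (Fin 4) R) (X : Matrix (Fin 4) (Fin 4) R) (hg : g.1 = 1 + q • X) :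
    g ∈ N := by
  let S : AddSubmonoid (Matrix (Fin 4) (Fin 4) R) :=
    { carrier := {M | ∃ h ∈ N, h.1 = 1 + q • M}
      zero_mem' := ⟨1, one_mem _, by simp⟩
      add_mem' := by
        rintro A B ⟨a, ha, ha'⟩ ⟨b, hb, hb'⟩
        refine ⟨a * b, mul_mem ha hb, ?_⟩
        show a.1 * b.1 = _
        rw [ha', hb']
        simp only [mul_add, add_mul, one_mul, mul_one, smul_mul_smul_comm, hq, zero_smul, smul_add]
        abel }
  have hS (i j : Fin 4) : single i j (X i j) - (if i = j then single 0 0 (X i j) else 0) ∈ S := by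
    split_ifs with hij
    · subst hij
      by_cases hi : i = 0
      · subst hi; rw [sub_self]; exact zero_mem S
      · have hi' : 0 ≠ i := Ne.symm hi
        have e1 : single i i (X i i) - single 0 0 (X i i) =
          (single 0 i (-X i i) + single i 0 (X i i)) + 
          (single 0 i (X i i) + single i i (X i i) - single 0 0 (X i i) - single i 0 (X i i)) := by
          rw [← single_neg]; abel
        rw [e1]
        refine add_mem (add_mem ⟨_, h 0 i hi' (- X i i), ?_⟩ ⟨_, h i 0 hi (X i i), ?_⟩)
          ⟨transvection hi 1 * transvection hi' (q * X i i) * (transvection hi 1)⁻¹,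
            Subgroup.Normal.conj_mem ‹_› _ (h _ _ _ _) _, ?_⟩
        · simp [transvection_coe, smul_single]
        · simp [transvection_coe, smul_single]
        · rw [transvection_inv]
          simp only [coe_mul, transvection_coe]
          simp only [mul_add, add_mul, one_mul, mul_one, zero_mul, mul_zero, add_zero, zero_add, single_mul_single_same, ne_eq, hi, hi',
            not_false_eq_true, single_mul_single_of_ne]
          ext k l
          simp only [Matrix.add_apply, Matrix.sub_apply, Matrix.smul_apply, one_apply, single_apply, Matrix.zero_apply,
            smul_eq_mul]
          split_ifs <;> ring
    · rw [sub_zero]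
      exact ⟨_, h i j hij (X i j), by simp [transvection_coe, smul_single]⟩
  have hsum : X - single 0 0 X.trace ∈ S := by
    have : X - single 0 0 X.trace =
        ∑ i, ∑ j, (single i j (X i j) - (if i = j then single 0 0 (X i j) else 0)) := by
      simp only [Finset.sum_sub_distrib, ← matrix_eq_sum_single, Finset.sum_ite_eq,
        Finset.mem_univ, if_true]
      congr 1
      simp [trace, Fin.sum_univ_succ, single_add]
    rw [this]
    exact sum_mem fun i _ => sum_mem fun j _ => hS i j
  have htr : q * X.trace = 0 := by
    have := g.2
    rw [hg, det_one_add_smul, pow_two, hq] at this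
    linear_combination this
  obtain ⟨k, hk, hk'⟩ := hsum
  have : g = k := by
    apply Subtype.ext
    rw [hg, hk', smul_sub, smul_single, smul_eq_mul, htr]
    simp
  rw [this]; exact hk

theorem castHom_zero {m n : ℕ} [NeZero n] (h : m ∣ n) (x : ZMod n)
    (hx : ZMod.castHom h (ZMod m) x = 0) : ∃ y, x = (m : ZMod n) * y := by
  rw [← ZMod.natCast_zmod_val x, map_natCast, ZMod.natCast_eq_zero_iff] at hx
  obtain ⟨k, hk⟩ := hx
  refine ⟨k, ?_⟩
  rw [← ZMod.natCast_zmod_val x, hk]; push_cast; rfl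

theorem uMat_mul (p r : ℕ) (a b c a' b' c' : ℤ) :
    uMat p r a b c * uMat p r a' b' c' = uMat p r (a + a') (b + b') (c + c') := by
  apply Subtype.ext
  show (uMat p r a b c).1 * (uMat p r a' b' c').1 = _
  simp only [uMat]
  ext i j
  fin_cases i <;> fin_cases j <;> simp [Matrix.mul_apply, Fin.sum_univ_succ, add_comm]

theorem uMat_zero (p r : ℕ) : uMat p r 0 0 0 = 1 := by
  apply Subtype.ext
  ext i j
  fin_cases i <;> fin_cases j <;> simp [uMat]

theorem uMat_zpow (p r : ℕ) (a b c n : ℤ) :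
    uMat p r a b c ^ n = uMat p r (n * a) (n * b) (n * c) := by
  let f : Multiplicative ℤ →* Matrix.SpecialLinearGroup (Fin 4) (ZMod (p ^ r)) :=
    { toFun := fun n => uMat p r (n.toAdd * a) (n.toAdd * b) (n.toAdd * c)
      map_one' := by simp [uMat_zero]
      map_mul' := by intro x y; rw [uMat_mul]; simp [add_mul] }
  have := map_zpow f (Multiplicative.ofAdd 1) n
  rw [← ofAdd_zsmul] at this
  simpa [f] using this.symm

open Matrix.SpecialLinearGroup in
theorem uMat_transvec (p r : ℕ) (a : ℤ) :
    uMat p r a 0 0 = transvection (show (0 : Fin 4) ≠ 3 by decide) (a : ZMod (p ^ r)) := by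
  apply Subtype.ext
  rw [transvection_coe]
  ext i j
  fin_cases i <;> fin_cases j <;> simp [uMat, single_apply]

open Matrix.SpecialLinearGroup in
theorem ker_le (p : ℕ) (hp : p.Prime) (r : ℕ) (hr : 1 ≤ r) (hle : r - 1 ≤ r)
    (N : Subgroup (SpecialLinearGroup (Fin 4) (ZMod (p ^ r)))) [N.Normal]
    (h : uMat p r ((p ^ (r - 1) : ℕ) : ℤ) 0 0 ∈ N) :
    (Matrix.SpecialLinearGroup.map (n := Fin 4)
        (ZMod.castHom (pow_dvd_pow p hle)
          (ZMod (p ^ (r - 1))))).ker ≤ N := by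
  have hne : NeZero (p ^ r) := ⟨(pow_pos hp.pos r).ne'⟩
  have key : ∀ (i j : Fin 4) (hij : i ≠ j) (x : ZMod (p ^ r)),
      transvection hij (((p ^ (r - 1) : ℕ) : ZMod (p ^ r)) * x) ∈ N := by
    intro i j hij x
    apply all_transvec
    have h2 := zpow_mem h (x.val : ℤ)
    rw [uMat_zpow, mul_zero, uMat_transvec] at h2
    convert h2 using 2
    push_cast
    rw [ZMod.natCast_zmod_val, mul_comm]
  intro g hg
  rcases Nat.eq_or_lt_of_le hr with rfl | hr2
  · have : Fact (p ^ 1).Prime := ⟨by simpa using hp⟩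
    refine field_top N (fun i j hij x => ?_) g
    simpa using key i j hij x
  · have hX : ∀ i j, ∃ y, g.1 i j - (1 : Matrix (Fin 4) (Fin 4) (ZMod (p ^ r))) i j
        = ((p ^ (r - 1) : ℕ) : ZMod (p ^ r)) * y := by
      intro i j
      apply castHom_zero (pow_dvd_pow p hle)
      rw [MonoidHom.mem_ker] at hg
      have := congrArg (fun M => M.1 i j) hg
      rw [map_sub, sub_eq_zero]
      refine Eq.trans this ?_
      show (1 : Matrix (Fin 4) (Fin 4) _) i j = _
      simp only [one_apply]
      split_ifs
      · exact (map_one _).symm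
      · exact (map_zero _).symm
    choose X hX using hX
    refine nilp_mem N _ ?_ key g (Matrix.of X) ?_
    · rw [← Nat.cast_mul, ZMod.natCast_eq_zero_iff, ← pow_add]
      exact pow_dvd_pow p (by omega)
    · ext i j
      simp only [Matrix.add_apply, Matrix.smul_apply, of_apply, smul_eq_mul, ← hX]
      ring

theorem eig_step {V : Type*} [AddCommGroup V] [Module ℂ V] [FiniteDimensional ℂ V]
    (A : Module.End ℂ V) (W : Submodule ℂ V) (hW : W ≠ ⊥) (hA : ∀ w ∈ W, A w ∈ W) :
    ∃ μ, W ⊓ Module.End.eigenspace A μ ≠ ⊥ := by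
  have : Nontrivial W := Submodule.nontrivial_iff_ne_bot.2 hW
  obtain ⟨μ, hμ⟩ := Module.End.exists_eigenvalue (A.restrict hA)
  obtain ⟨v, hv⟩ := hμ.exists_hasEigenvector
  refine ⟨μ, (Submodule.ne_bot_iff _).2 ⟨v, ⟨v.2, ?_⟩, ?_⟩⟩
  · rw [SetLike.mem_coe, Module.End.mem_eigenspace_iff]
    have := congrArg Subtype.val hv.apply_eq_smul
    simpa using this
  · simpa using hv.2

theorem common_eig {V : Type*} [AddCommGroup V] [Module ℂ V] [FiniteDimensional ℂ V]
    (A B C : Module.End ℂ V) (hAB : Commute A B) (hAC : Commute A C) (hBC : Commute B C)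
    (W : Submodule ℂ V) (hW : W ≠ ⊥) (hA : ∀ w ∈ W, A w ∈ W) (hB : ∀ w ∈ W, B w ∈ W)
    (hC : ∀ w ∈ W, C w ∈ W) :
    ∃ v ∈ W, v ≠ 0 ∧ ∃ a b c : ℂ, A v = a • v ∧ B v = b • v ∧ C v = c • v := by
  have inv (S T : Module.End ℂ V) (hST : Commute S T) (U : Submodule ℂ V) (μ : ℂ)
      (hT : ∀ w ∈ U, T w ∈ U) : ∀ w ∈ U ⊓ S.eigenspace μ, T w ∈ U ⊓ S.eigenspace μ := by
    rintro w ⟨h1, h2⟩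
    refine ⟨hT w h1, ?_⟩
    rw [SetLike.mem_coe, Module.End.mem_eigenspace_iff] at h2 ⊢
    have : S (T w) = T (S w) := congrArg (fun f => f w) hST.eq
    rw [this, h2, map_smul]
  obtain ⟨a, ha⟩ := eig_step A W hW hA
  obtain ⟨b, hb⟩ := eig_step B _ ha (inv A B hAB W a hB)
  obtain ⟨c, hc⟩ := eig_step C _ hb (inv B C hBC _ b (inv A C hAC W a hC))
  obtain ⟨v, ⟨⟨⟨h0, h1⟩, h2⟩, h3⟩, hv⟩ := (Submodule.ne_bot_iff _).1 hc
  exact ⟨v, h0, hv, a, b, c, Module.End.mem_eigenspace_iff.1 h1,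
    Module.End.mem_eigenspace_iff.1 h2, Module.End.mem_eigenspace_iff.1 h3⟩

theorem range_no_fix {V : Type*} [AddCommGroup V] [Module ℂ V]
    (T : Module.End ℂ V) (p : ℕ) (hp : 0 < p) (hT : T ^ p = 1) (w : V)
    (hw : w ∈ LinearMap.range (T - 1)) (hf : T w = w) : w = 0 := by
  obtain ⟨x, rfl⟩ := hw
  have h1 : (∑ k ∈ Finset.range p, T ^ k) ((T - 1) x) = 0 := by
    rw [← Module.End.mul_apply, geom_sum_mul, hT]; simp
  have h2 : ∀ k, (T ^ k) ((T - 1) x) = (T - 1) x := by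
    intro k
    induction k with
    | zero => simp
    | succ k ih => rw [pow_succ, Module.End.mul_apply, hf, ih]
  rw [LinearMap.sum_apply, Finset.sum_congr rfl (fun k _ => h2 k)] at h1
  rw [Finset.sum_const, Finset.card_range, ← Nat.cast_smul_eq_nsmul ℂ] at h1
  exact (smul_eq_zero.1 h1).resolve_left (by exact_mod_cast hp.ne')

theorem rho_zpow {G V : Type*} [Group G] [AddCommGroup V] [Module ℂ V]
    (ρ : G →* Module.End ℂ V) (g : G) (v : V) (hv : v ≠ 0) (μ : ℂ) (h : ρ g v = μ • v) (n : ℤ) :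
    ρ (g ^ n) v = μ ^ n • v := by
  have hpow (n : ℕ) : ρ (g ^ n) v = μ ^ n • v := by
    induction n with
    | zero => simp
    | succ n ih => rw [pow_succ, map_mul, Module.End.mul_apply, h, map_smul, ih, smul_smul,
        pow_succ, mul_comm]
  have hinv : ∀ k : G, ρ k⁻¹ (ρ k v) = v := by
    intro k; rw [← Module.End.mul_apply, ← map_mul]; simp
  have hμ : μ ≠ 0 := by
    rintro rfl
    have := hinv g
    rw [h] at this; simp at this; exact hv this.symm
  obtain ⟨m, rfl | rfl⟩ := n.eq_nat_or_neg
  · simpa using hpow m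
  · have := hinv (g ^ m)
    rw [hpow, map_smul] at this
    rw [_root_.zpow_neg, _root_.zpow_neg, zpow_natCast, zpow_natCast]
    rw [← this, smul_smul, inv_mul_cancel₀ (pow_ne_zero _ hμ), one_smul, this]

theorem root_exp (n : ℕ) (hn : n ≠ 0) (μ : ℂ) (h : μ ^ n = 1) :
    ∃ k : ℤ, μ = Complex.exp (2 * Real.pi * Complex.I * (k / n)) := by
  have : NeZero n := ⟨hn⟩
  obtain ⟨i, -, hi⟩ := (Complex.isPrimitiveRoot_exp n hn).eq_pow_of_pow_eq_one h
  refine ⟨i, ?_⟩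
  rw [← hi, ← Complex.exp_nat_mul]
  congr 1
  push_cast; ring

theorem stmt10 (p : ℕ) (hp : p.Prime) (r : ℕ) (hr : 1 ≤ r)
    {V : Type*} [NormedAddCommGroup V] [InnerProductSpace ℂ V]
    [FiniteDimensional ℂ V] [Nontrivial V]
    (φ : Matrix.SpecialLinearGroup (Fin 4) (ZMod (p ^ r)) →* unitary (V →L[ℂ] V))
    (hirr : ∀ W : Submodule ℂ V,
      (∀ g, ∀ w ∈ W, (φ g : V →L[ℂ] V) w ∈ W) → W = ⊥ ∨ W = ⊤)
    (hnew : ¬ (Matrix.SpecialLinearGroup.map (n := Fin 4)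
        (ZMod.castHom (pow_dvd_pow p (by omega : r - 1 ≤ r))
          (ZMod (p ^ (r - 1))))).ker ≤ φ.ker) :
    ∃ v : V, v ≠ 0 ∧ ∃ ξ₁ ξ₂ ξ₃ : ℤ,
      ¬((ξ₁ : ZMod p) = 0 ∧ (ξ₂ : ZMod p) = 0 ∧ (ξ₃ : ZMod p) = 0) ∧
      ∀ u₁ u₂ u₃ : ℤ,
        (φ (uMat p r u₁ u₂ u₃) : V →L[ℂ] V) v
          = Complex.exp (2 * Real.pi * Complex.I *
              (((ξ₁ : ℂ) * u₁ + (ξ₂ : ℂ) * u₂ + (ξ₃ : ℂ) * u₃) / (p : ℂ) ^ r)) • v := by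
  let ρ : Matrix.SpecialLinearGroup (Fin 4) (ZMod (p ^ r)) →* Module.End ℂ V :=
    { toFun := fun g => ((φ g : V →L[ℂ] V) : V →ₗ[ℂ] V)
      map_one' := by ext; simp
      map_mul' := by intro x y; ext; simp }
  have hρ : ∀ g v, (φ g : V →L[ℂ] V) v = ρ g v := fun _ _ => rfl
  have hρ1 : ∀ g, ρ g = 1 → g ∈ φ.ker := by
    intro g hg
    rw [MonoidHom.mem_ker]
    apply Subtype.ext
    ext v
    rw [hρ, hg]; simp
  set q := p ^ (r - 1) with hq
  have hpq : q * p = p ^ r := by rw [hq, ← pow_succ]; congr 1; omega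
  have hT : ρ (uMat p r (q : ℤ) 0 0) ≠ 1 := fun h => hnew (ker_le p hp r hr (Nat.sub_le r 1) φ.ker (hρ1 _ h))
  have hord : ∀ a b c : ℤ, uMat p r a b c ^ (p ^ r) = 1 := by
    intro a b c
    rw [← zpow_natCast, uMat_zpow, ← uMat_zero p r]
    apply Subtype.ext
    have : (p : ZMod (p ^ r)) ^ r = 0 := by exact_mod_cast ZMod.natCast_self (p ^ r)
    simp [uMat, this]
  have hcomm : ∀ a b c a' b' c' : ℤ, Commute (ρ (uMat p r a b c)) (ρ (uMat p r a' b' c')) := by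
    intro a b c a' b' c'
    show _ * _ = _ * _
    rw [← map_mul, ← map_mul, uMat_mul, uMat_mul, add_comm a, add_comm b, add_comm c]
  set T := ρ (uMat p r (q : ℤ) 0 0) with hTdef
  have hTpow : uMat p r 1 0 0 ^ q = uMat p r (q : ℤ) 0 0 := by
    rw [← zpow_natCast, uMat_zpow]; simp
  have hTp : T ^ p = 1 := by
    rw [hTdef, ← hTpow, ← map_pow, ← pow_mul, hpq, hord, map_one]
  have hWinv : ∀ a b c : ℤ, ∀ w ∈ LinearMap.range (T - 1),
      ρ (uMat p r a b c) w ∈ LinearMap.range (T - 1) := by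
    rintro a b c _ ⟨x, rfl⟩
    refine ⟨ρ (uMat p r a b c) x, ?_⟩
    have : T (ρ (uMat p r a b c) x) = ρ (uMat p r a b c) (T x) :=
      congrArg (fun f => f x) (hcomm _ _ _ _ _ _).eq
    simp [this]
  have hWne : LinearMap.range (T - 1) ≠ ⊥ := by
    rw [Ne, LinearMap.range_eq_bot, sub_eq_zero]; exact hT
  obtain ⟨v, hvW, hv, a, b, c, ha, hb, hc⟩ := common_eig (ρ (uMat p r 1 0 0)) (ρ (uMat p r 0 1 0))
    (ρ (uMat p r 0 0 1)) (hcomm _ _ _ _ _ _) (hcomm _ _ _ _ _ _) (hcomm _ _ _ _ _ _) _ hWne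
    (hWinv _ _ _) (hWinv _ _ _) (hWinv _ _ _)
  have hn0 : p ^ r ≠ 0 := (pow_pos hp.pos r).ne'
  have hroot : ∀ (g) (μ : ℂ), g ^ (p ^ r) = 1 → ρ g v = μ • v → μ ^ (p ^ r) = 1 := by
    intro g μ hg h
    have h2 := rho_zpow ρ g v hv μ h ((p ^ r : ℕ) : ℤ)
    rw [zpow_natCast, zpow_natCast, hg, map_one] at h2
    have h3 : (μ ^ (p ^ r) - 1) • v = 0 := by rw [sub_smul, ← h2]; simp
    exact sub_eq_zero.1 ((smul_eq_zero.1 h3).resolve_right hv)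
  obtain ⟨x, hx⟩ := root_exp _ hn0 a (hroot _ _ (hord _ _ _) ha)
  obtain ⟨y, hy⟩ := root_exp _ hn0 b (hroot _ _ (hord _ _ _) hb)
  obtain ⟨z, hz⟩ := root_exp _ hn0 c (hroot _ _ (hord _ _ _) hc)
  refine ⟨v, hv, x, y, z, ?_, ?_⟩
  · rintro ⟨h, -, -⟩
    rw [ZMod.intCast_zmod_eq_zero_iff_dvd] at h
    obtain ⟨k, rfl⟩ := h
    apply hv
    apply range_no_fix T p hp.pos hTp v hvW
    have h2 := rho_zpow ρ _ v hv a ha (q : ℤ)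
    rw [zpow_natCast, hTpow] at h2
    rw [hTdef, h2]
    have hp0 : (p : ℂ) ≠ 0 := by exact_mod_cast hp.ne_zero
    have hq0 : (q : ℂ) ≠ 0 := by exact_mod_cast (pow_pos hp.pos (r - 1)).ne'
    have : a ^ (q : ℤ) = 1 := by
      rw [zpow_natCast, hx, ← Complex.exp_nat_mul, ← hpq]
      rw [Complex.exp_eq_one_iff]
      refine ⟨k, ?_⟩
      push_cast
      field_simp
    rw [this, one_smul]
  · intro u₁ u₂ u₃
    have e : uMat p r u₁ u₂ u₃ =
        uMat p r 1 0 0 ^ u₁ * (uMat p r 0 1 0 ^ u₂ * uMat p r 0 0 1 ^ u₃) := by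
      simp [uMat_zpow, uMat_mul]
    rw [hρ, e, map_mul, map_mul, Module.End.mul_apply, Module.End.mul_apply,
      rho_zpow ρ _ v hv c hc, map_smul, rho_zpow ρ _ v hv b hb, map_smul, map_smul,
      rho_zpow ρ _ v hv a ha, smul_smul, smul_smul, hx, hy, hz, ← Complex.exp_int_mul,
      ← Complex.exp_int_mul, ← Complex.exp_int_mul, ← Complex.exp_add, ← Complex.exp_add]
    congr 2
    push_cast
    ring
end
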